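/- arXiv:2001.11306 — 3 statements merged into one kernel-verified Lean document; each statement's English description precedes it below -/
import Mathlib

section
/- Let X be a complete metric space with 0 < dim_A X < ∞. Then for every real number s > dim_A X there exists a Borel regular measure μ on X with support equal to X such that dim_A μ = s. -/
open Metric MeasureTheory Set
open scoped ENNReal

noncomputable section

/-- `coverNumber x R r` : the minimal number of closed `r`-balls needed to cover the closed
ball `B(x,R)` (`⊤` if no finite family of closed `r`-balls covers it). -/
noncomputable def coverNumber {X : Type*} [MetricSpace X] (x : X) (R r : ℝ) : ℕ∞ :=
  sInf {n : ℕ∞ | ∃ s : Finset X, (s.card : ℕ∞) = n ∧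
    Metric.closedBall x R ⊆ ⋃ y ∈ s, Metric.closedBall y r}

/-- The Assouad dimension of a metric space `X`: the infimum of those `α ≥ 0` for which there
is a constant `0 < C < ∞` with `N(x,R,r) ≤ C (R/r)^α` for all `x ∈ X` and `0 < r < R < ∞`
(`⊤` if no such `α` exists). -/
noncomputable def assouadDim (X : Type*) [MetricSpace X] : ℝ≥0∞ :=
  sInf {d : ℝ≥0∞ | ∃ α : ℝ, 0 ≤ α ∧ d = ENNReal.ofReal α ∧ ∃ C : ℝ, 0 < C ∧
    ∀ x : X, ∀ r R : ℝ, 0 < r → r < R →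
      (coverNumber x R r : ℝ≥0∞) ≤ ENNReal.ofReal (C * (R / r) ^ α)}

/-- The Assouad dimension of a measure `μ` on a metric space `X`: the infimum of those `α ≥ 0`
for which there is a constant `0 < C < ∞` with `μ(B(x,R))/μ(B(x,r)) ≤ C (R/r)^α` for all
`x ∈ X` and `0 < r < R < ∞` (`⊤` if no such `α` exists). -/
noncomputable def measureAssouadDim {X : Type*} [MetricSpace X] [MeasurableSpace X]
    (μ : Measure X) : ℝ≥0∞ :=
  sInf {d : ℝ≥0∞ | ∃ α : ℝ, 0 ≤ α ∧ d = ENNReal.ofReal α ∧ ∃ C : ℝ, 0 < C ∧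
    ∀ x : X, ∀ r R : ℝ, 0 < r → r < R →
      μ (Metric.closedBall x R) / μ (Metric.closedBall x r) ≤
        ENNReal.ofReal (C * (R / r) ^ α)}

/-- The lower dimension of a metric space `X`: the supremum of those `α ≥ 0` for which there
is a constant `0 < C < ∞` with `N(x,R,r) ≥ C (R/r)^α` for all `x ∈ X` and
`0 < r < R < diam X`. -/
noncomputable def lowerDim (X : Type*) [MetricSpace X] : ℝ≥0∞ :=
  sSup {d : ℝ≥0∞ | ∃ α : ℝ, 0 ≤ α ∧ d = ENNReal.ofReal α ∧ ∃ C : ℝ, 0 < C ∧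
    ∀ x : X, ∀ r R : ℝ, 0 < r → r < R →
      ENNReal.ofReal R < EMetric.diam (Set.univ : Set X) →
      ENNReal.ofReal (C * (R / r) ^ α) ≤ (coverNumber x R r : ℝ≥0∞)}

/-- The lower dimension of a measure `μ` on a metric space `X`: the supremum of those `α ≥ 0`
for which there is a constant `0 < C < ∞` with `μ(B(x,R))/μ(B(x,r)) ≥ C (R/r)^α` for all
`x ∈ X` and `0 < r < R < diam X`. -/
noncomputable def measureLowerDim {X : Type*} [MetricSpace X] [MeasurableSpace X]
    (μ : Measure X) : ℝ≥0∞ :=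
  sSup {d : ℝ≥0∞ | ∃ α : ℝ, 0 ≤ α ∧ d = ENNReal.ofReal α ∧ ∃ C : ℝ, 0 < C ∧
    ∀ x : X, ∀ r R : ℝ, 0 < r → r < R →
      ENNReal.ofReal R < EMetric.diam (Set.univ : Set X) →
      ENNReal.ofReal (C * (R / r) ^ α) ≤
        μ (Metric.closedBall x R) / μ (Metric.closedBall x r)}

/-- A measure has full support (`spt μ = X`) iff every nonempty open set has positive measure. -/
def HasFullSupport {X : Type*} [MetricSpace X] [MeasurableSpace X] (μ : Measure X) : Prop :=
  ∀ U : Set X, IsOpen U → U.Nonempty → 0 < μ U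

/-- A `δ`-adic cube system on a metric space `X`: countable collections `cubes k` (`k ∈ ℤ`) of
Borel sets, each cube `Q` of generation `k` carrying a center `center k Q`, satisfying the
properties (i)–(v) of Theorem 2.1 of Käenmäki–Rajala–Suomala. -/
structure CubeSystem (X : Type*) [MetricSpace X] [MeasurableSpace X] (δ : ℝ) where
  cubes : ℤ → Set (Set X)
  center : ℤ → Set X → X
  countable : ∀ k : ℤ, (cubes k).Countable
  borel : ∀ k : ℤ, ∀ Q ∈ cubes k, MeasurableSet Q
  covers : ∀ k : ℤ, ⋃₀ cubes k = Set.univ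
  nested : ∀ ⦃k k' : ℤ⦄, k ≤ k' → ∀ ⦃Q : Set X⦄, Q ∈ cubes k → ∀ ⦃Q' : Set X⦄,
    Q' ∈ cubes k' → (Q ∩ Q').Nonempty → Q' ⊆ Q
  ball_subset : ∀ k : ℤ, ∀ Q ∈ cubes k, Metric.closedBall (center k Q) (δ ^ k / 3) ⊆ Q
  subset_ball : ∀ k : ℤ, ∀ Q ∈ cubes k, Q ⊆ Metric.closedBall (center k Q) (2 * δ ^ k)
  origin : ∃ x₀ : X, ∀ k : ℤ, x₀ ∈ center k '' cubes k
  centers_nested : ∀ k : ℤ, center k '' cubes k ⊆ center (k + 1) '' cubes (k + 1)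

namespace CubeSystem

variable {X : Type*} [MetricSpace X] [MeasurableSpace X] {δ : ℝ}

/-- The children of a cube `Q` of generation `k`: the cubes of generation `k+1` contained
in `Q`. -/
def children (S : CubeSystem X δ) (k : ℤ) (Q : Set X) : Set (Set X) :=
  {Q' ∈ S.cubes (k + 1) | Q' ⊆ Q}

/-- `M_Q`, the number of children of a cube `Q` of generation `k` (as an extended natural). -/
noncomputable def childCount (S : CubeSystem X δ) (k : ℤ) (Q : Set X) : ℕ∞ :=
  (S.children k Q).encard

/-- `M = sup_Q M_Q`, the supremum of the numbers of children over all cubes. -/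
noncomputable def maxChildCount (S : CubeSystem X δ) : ℕ∞ :=
  ⨆ k : ℤ, ⨆ Q ∈ S.cubes k, S.childCount k Q

/-- `Q'` is the central child of the cube `Q` of generation `k`: it is a child of `Q` whose
center coincides with that of `Q`. -/
def IsCentralChild (S : CubeSystem X δ) (k : ℤ) (Q Q' : Set X) : Prop :=
  Q' ∈ S.children k Q ∧ S.center (k + 1) Q' = S.center k Q

/-- `Q'` is a boundary child of the cube `Q` of generation `k`: a child which is not central. -/
def IsBoundaryChild (S : CubeSystem X δ) (k : ℤ) (Q Q' : Set X) : Prop :=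
  Q' ∈ S.children k Q ∧ S.center (k + 1) Q' ≠ S.center k Q

/-- The `m`-th generation offspring of a cube `Q` of generation `k`: the cubes `Q' ≺_m Q`,
i.e. `Q' ∈ cubes (k+m)` with `Q' ⊆ Q`. -/
def descendants (S : CubeSystem X δ) (k : ℤ) (Q : Set X) (m : ℕ) : Set (Set X) :=
  {Q' ∈ S.cubes (k + m) | Q' ⊆ Q}

/-- A measure `μ` adapted to the parameter `p`: a fully supported measure such that each
boundary child inherits `p` times the mass of its parent, while the central child inherits
`1 - (M_Q - 1)p` times the mass of its parent. -/
def Adapted (S : CubeSystem X δ) (p : ℝ) (μ : Measure X) : Prop :=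
  HasFullSupport μ ∧
  ∀ k : ℤ, ∀ Q ∈ S.cubes k, ∀ Q' ∈ S.children k Q,
    (S.IsBoundaryChild k Q Q' → μ Q' = ENNReal.ofReal p * μ Q) ∧
    (S.IsCentralChild k Q Q' →
      μ Q' = ENNReal.ofReal (1 - (((S.children k Q).ncard : ℝ) - 1) * p) * μ Q)

/-- `c 0 ≻ c 1 ≻ ... ≻ c N` is a chain of cubes starting at generation `k`: `c 0` is a cube of
generation `k` and each `c (i+1)` is a child of `c i`. -/
def IsChain (S : CubeSystem X δ) (k : ℤ) (N : ℕ) (c : ℕ → Set X) : Prop :=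
  c 0 ∈ S.cubes k ∧ ∀ i : ℕ, i < N → c (i + 1) ∈ S.children (k + i) (c i)

/-- The number of boundary cubes among `c 1, ..., c N` in a chain starting at generation `k`. -/
noncomputable def boundaryCount (S : CubeSystem X δ) (k : ℤ) (N : ℕ) (c : ℕ → Set X) : ℕ :=
  {i : ℕ | i < N ∧ S.IsBoundaryChild (k + i) (c i) (c (i + 1))}.ncard

end CubeSystem

end

open Filter Topology CompactlySupported

/-- Vague limits along an ultrafilter: a sequence of measures that is uniformly bounded on balls
of a proper metric space has a limit measure, whose values on closed balls are controlled
by the values of the sequence on slightly larger and slightly smaller balls. -/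
theorem exists_vague_limit {X : Type*} [MetricSpace X] [ProperSpace X] [MeasurableSpace X]
    [BorelSpace X] (x₀ : X) (ν : ℕ → Measure X)
    (hb : ∀ R : ℝ, ∃ B : ℝ, ∀ j, ν j (closedBall x₀ R) ≤ ENNReal.ofReal B) :
    ∃ μ : Measure X, ∀ (x : X) (r a : ℝ), 0 < r → 0 ≤ a →
      ((∀ᶠ j in atTop, ν j (closedBall x (2 * r)) ≤ ENNReal.ofReal a) →
        μ (closedBall x r) ≤ ENNReal.ofReal a) ∧
      ((∀ᶠ j in atTop, ENNReal.ofReal a ≤ ν j (closedBall x (r / 2))) →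
        ENNReal.ofReal a ≤ μ (closedBall x r)) := by
  have hfin : ∀ j, IsFiniteMeasureOnCompacts (ν j) := fun j ↦ ⟨fun K hK ↦ by
    obtain ⟨R, hR⟩ := hK.isBounded.subset_closedBall x₀
    obtain ⟨B, hB⟩ := hb R
    exact ((measure_mono hR).trans (hB j)).trans_lt ENNReal.ofReal_lt_top⟩
  have hgi : ∀ (g : C_c(X, ℝ)) j, Integrable g (ν j) := fun g j ↦
    g.continuous.integrable_of_hasCompactSupport g.hasCompactSupport
  have L (g : C_c(X, ℝ)) :
      ∃ t : ℝ, Tendsto (fun j ↦ ∫ x, g x ∂(ν j)) (hyperfilter ℕ) (𝓝 t) := by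
    obtain ⟨R, hR⟩ := g.hasCompactSupport.isBounded.subset_closedBall x₀
    obtain ⟨B, hB⟩ := hb R
    set c := ‖g.toBoundedContinuousFunction‖
    have hmem : ∀ j, ∫ x, g x ∂(ν j) ∈ Icc (-(c * max B 0)) (c * max B 0) := fun j ↦ by
      rw [mem_Icc, ← abs_le, ← Real.norm_eq_abs]
      have h1 : ∫ x, g x ∂(ν j) = ∫ x in closedBall x₀ R, g x ∂(ν j) := by
        rw [setIntegral_eq_integral_of_forall_compl_eq_zero]
        exact fun x hx ↦ image_eq_zero_of_notMem_tsupport fun h ↦ hx (hR h)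
      rw [h1]
      have h2 : ν j (closedBall x₀ R) ≤ ENNReal.ofReal (max B 0) :=
        (hB j).trans (ENNReal.ofReal_le_ofReal (le_max_left _ _))
      refine (norm_setIntegral_le_of_norm_le_const (C := c)
        (h2.trans_lt ENNReal.ofReal_lt_top)
        (fun x _ ↦ g.toBoundedContinuousFunction.norm_coe_le_norm x)).trans ?_
      gcongr
      exact ENNReal.toReal_le_of_le_ofReal (le_max_right _ _) h2
    obtain ⟨t, -, ht⟩ := isCompact_Icc.ultrafilter_le_nhds'
      ((hyperfilter ℕ).map fun j ↦ ∫ x, g x ∂(ν j))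
      (Ultrafilter.mem_map.2 (Filter.univ_mem' hmem))
    exact ⟨t, ht⟩
  choose Λ hΛ using L
  let Λ' : C_c(X, ℝ) →ₚ[ℝ] ℝ :=
  { toFun := Λ
    map_add' g g' := by
      refine tendsto_nhds_unique (hΛ (g + g')) (((hΛ g).add (hΛ g')).congr fun j ↦ ?_)
      exact (integral_add (hgi g j) (hgi g' j)).symm
    map_smul' c g := by
      refine tendsto_nhds_unique (hΛ (c • g)) (((hΛ g).const_smul c).congr fun j ↦ ?_)
      exact (integral_smul c g).symm
    monotone' g g' hgg' :=
      le_of_tendsto_of_tendsto' (hΛ g) (hΛ g') fun j ↦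
        integral_mono (hgi g j) (hgi g' j) hgg' }
  have hcut : ∀ (x : X) (r s : ℝ), r < s → ∃ f : C_c(X, ℝ), EqOn f 1 (closedBall x r) ∧
      (∀ y ∉ ball x s, f y = 0) ∧ ∀ y, 0 ≤ f y ∧ f y ≤ 1 := fun x r s hrs ↦ by
    obtain ⟨f, h1, h2, h3, h4⟩ := exists_continuous_one_zero_of_isCompact
      (isCompact_closedBall x r) (isOpen_ball (x := x) (ε := s)).isClosed_compl
      (disjoint_compl_right_iff_subset.2 (closedBall_subset_ball hrs))
    exact ⟨⟨f, h3⟩, h1, fun y hy ↦ h2 hy, h4⟩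
  have hev : ∀ {q : ℕ → Prop}, (∀ᶠ j in atTop, q j) → ∀ᶠ j in (hyperfilter ℕ : Filter ℕ), q j :=
    fun h ↦ Nat.hyperfilter_le_atTop h
  refine ⟨RealRMK.rieszMeasure Λ', fun x r a hr ha ↦ ⟨fun h ↦ ?_, fun h ↦ ?_⟩⟩
  · obtain ⟨f, h1, h2, h3⟩ := hcut x r (2 * r) (by linarith)
    refine (RealRMK.rieszMeasure_le_of_eq_one Λ' (fun y ↦ (h3 y).1) (isCompact_closedBall x r)
      (fun y hy ↦ h1 hy)).trans (ENNReal.ofReal_le_ofReal ?_)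
    refine le_of_tendsto (hΛ f) ?_
    filter_upwards [hev h] with j hj
    have h5 : ∫ y, f y ∂(ν j) = ∫ y in closedBall x (2 * r), f y ∂(ν j) := by
      rw [setIntegral_eq_integral_of_forall_compl_eq_zero]
      exact fun y hy ↦ h2 y fun h ↦ hy (ball_subset_closedBall h)
    rw [h5]
    refine (Real.le_norm_self _).trans ((norm_setIntegral_le_of_norm_le_const (C := 1)
      (hj.trans_lt ENNReal.ofReal_lt_top) (fun y _ ↦ ?_)).trans ?_)
    · rw [Real.norm_of_nonneg (h3 y).1]; exact (h3 y).2
    · rw [one_mul]; exact ENNReal.toReal_le_of_le_ofReal ha hj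
  · obtain ⟨f, h1, h2, h3⟩ := hcut x (r / 2) r (by linarith)
    refine le_trans (ENNReal.ofReal_le_ofReal ?_)
      (RealRMK.le_rieszMeasure_tsupport_subset Λ' h3 (V := closedBall x r) ?_)
    · refine ge_of_tendsto (hΛ f) ?_
      filter_upwards [hev h] with j hj
      have hlt : ν j (closedBall x (r / 2)) < ⊤ := (isCompact_closedBall _ _).measure_lt_top
      calc a ≤ (ν j).real (closedBall x (r / 2)) :=
            (ENNReal.ofReal_le_iff_le_toReal hlt.ne).1 hj
        _ = ∫ y in closedBall x (r / 2), f y ∂(ν j) := by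
            rw [setIntegral_congr_fun measurableSet_closedBall h1]; simp
        _ ≤ ∫ y, f y ∂(ν j) :=
            setIntegral_le_integral (hgi f j) (Eventually.of_forall fun y ↦ (h3 y).1)
    · refine closure_minimal (fun y hy ↦ ?_) isClosed_closedBall
      by_contra hn
      exact hy (h2 y fun h ↦ hn (ball_subset_closedBall h))

/-- A hierarchy of nets in a metric space: for each generation `k : ℤ` a set `N k` of points with
local multiplicity bounds, together with projections `P k` onto `N k` that move points by at most
`δ ^ k` and fix the basepoint. Points of generation `k` are the children of their image under
`P (k - 1)`. -/
structure NetTree (X : Type*) [MetricSpace X] where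
  δ : ℝ
  N : ℤ → Set X
  P : ℤ → X → X
  x₀ : X
  M : ℝ
  K : ℝ
  δ_pos : 0 < δ
  δ_le : δ ≤ 1 / 20
  P_mem : ∀ k x, P k x ∈ N k
  dist_P : ∀ k x, dist x (P k x) ≤ δ ^ k
  P_eq : ∀ k x, ∀ u ∈ N k, dist x u < δ ^ k / 2 → P k x = u
  x₀_mem : ∀ k, x₀ ∈ N k
  finite_inter : ∀ k x R, (N k ∩ closedBall x R).Finite
  ncard_children : ∀ k x, ((N k ∩ closedBall x (δ ^ (k - 1))).ncard : ℝ) ≤ M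
  ncard_near : ∀ k x, ((N k ∩ closedBall x (4 * δ ^ k)).ncard : ℝ) ≤ K

namespace NetTree

variable {X : Type*} [MetricSpace X] (T : NetTree X)

/-- The generation `k` children of `u`. -/
def childSet (k : ℤ) (u : X) : Set X := {v ∈ T.N k | T.P (k - 1) v = u}

/-- The fraction of the mass of its parent that a point of generation `k` inherits: a point has
one distinguished child, and all other children inherit the fraction `p`. -/
noncomputable def q (p : ℝ) (k : ℤ) (v : X) : ℝ :=
  open Classical in
  if v = T.P k (T.P (k - 1) v) then 1 - (((T.childSet k (T.P (k - 1) v)).ncard : ℝ) - 1) * p else p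

/-- The ancestor of `v`, seen as a point of generation `k`, in generation `k - n`. -/
def anc : ℤ → ℕ → X → X
  | _, 0, v => v
  | k, n + 1, v => anc (k - 1) n (T.P (k - 1) v)

/-- The mass of `v`, seen as a point of generation `k`, relative to its ancestor in
generation `k - n`. -/
noncomputable def W (p : ℝ) : ℤ → ℕ → X → ℝ
  | _, 0, _ => 1
  | k, n + 1, v => T.q p k v * W p (k - 1) n (T.P (k - 1) v)

lemma zpow_pos (k : ℤ) : 0 < T.δ ^ k := _root_.zpow_pos T.δ_pos k

lemma zpow_le_sub_one (k : ℤ) : T.δ ^ k ≤ T.δ ^ (k - 1) / 20 := by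
  have h := zpow_sub_one₀ T.δ_pos.ne' (n := k)
  have h1 : T.δ ^ k = T.δ ^ (k - 1) * T.δ := by
    rw [h, inv_mul_cancel_right₀ T.δ_pos.ne']
  rw [h1]
  nlinarith [T.zpow_pos (k - 1), T.δ_le]

lemma zpow_anti {k l : ℤ} (h : k ≤ l) : T.δ ^ l ≤ T.δ ^ k :=
  zpow_le_zpow_right_of_le_one₀ T.δ_pos (by linarith [T.δ_le]) h

lemma P_x₀ (k : ℤ) : T.P k T.x₀ = T.x₀ :=
  T.P_eq k _ _ (T.x₀_mem k) (by simpa using T.zpow_pos k)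

lemma P_self {k : ℤ} {v : X} (hv : v ∈ T.N k) : T.P k v = v :=
  T.P_eq k _ _ hv (by simpa using T.zpow_pos k)

lemma P_P {k : ℤ} {u : X} (hu : u ∈ T.N (k - 1)) : T.P (k - 1) (T.P k u) = u := by
  refine T.P_eq _ _ _ hu ?_
  rw [dist_comm]
  linarith [T.dist_P k u, T.zpow_le_sub_one k, T.zpow_pos (k - 1)]

lemma childSet_subset (k : ℤ) (u : X) :
    T.childSet k u ⊆ T.N k ∩ closedBall u (T.δ ^ (k - 1)) := fun v hv ↦
  ⟨hv.1, by rw [mem_closedBall]; simpa [hv.2] using T.dist_P (k - 1) v⟩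

lemma childSet_finite (k : ℤ) (u : X) : (T.childSet k u).Finite :=
  (T.finite_inter k u _).subset (T.childSet_subset k u)

lemma ncard_childSet_le (k : ℤ) (u : X) : ((T.childSet k u).ncard : ℝ) ≤ T.M :=
  le_trans (by exact_mod_cast ncard_le_ncard (T.childSet_subset k u) (T.finite_inter k u _))
    (T.ncard_children k u)

lemma P_mem_childSet {k : ℤ} {u : X} (hu : u ∈ T.N (k - 1)) : T.P k u ∈ T.childSet k u :=
  ⟨T.P_mem k u, T.P_P hu⟩

lemma one_le_ncard {k : ℤ} {u : X} (hu : u ∈ T.N (k - 1)) :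
    (1 : ℝ) ≤ (T.childSet k u).ncard := by
  exact_mod_cast (ncard_pos (T.childSet_finite k u)).2 ⟨_, T.P_mem_childSet hu⟩

lemma one_le_M : 1 ≤ T.M :=
  (T.one_le_ncard (k := 0) (T.x₀_mem _)).trans (T.ncard_childSet_le _ _)

/-- The admissible range of the parameter `p`. -/
def Good (p : ℝ) : Prop := 0 < p ∧ T.M * p ≤ 1 / 2

variable {T} {p : ℝ}

lemma Good.le_half (hp : T.Good p) : p ≤ 1 / 2 := by
  nlinarith [hp.1, hp.2, T.one_le_M]

lemma central_mem (hp : T.Good p) (k : ℤ) {u : X} (hu : u ∈ T.N (k - 1)) :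
    (((T.childSet k u).ncard : ℝ) - 1) * p ∈ Icc 0 (1 / 2) := by
  refine ⟨mul_nonneg (by linarith [T.one_le_ncard hu]) hp.1.le, ?_⟩
  nlinarith [T.ncard_childSet_le k u, hp.1, hp.2]

lemma le_q (hp : T.Good p) (k : ℤ) (v : X) : p ≤ T.q p k v := by
  unfold q
  have := hp.le_half
  split_ifs
  · linarith [(central_mem hp k (T.P_mem (k - 1) v)).2]
  · exact le_rfl

lemma q_le_one (hp : T.Good p) (k : ℤ) (v : X) : T.q p k v ≤ 1 := by
  unfold q
  have := hp.le_half
  split_ifs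
  · linarith [(central_mem hp k (T.P_mem (k - 1) v)).1]
  · linarith

lemma q_pos (hp : T.Good p) (k : ℤ) (v : X) : 0 < T.q p k v := hp.1.trans_le (le_q hp k v)

lemma W_pos (hp : T.Good p) (k : ℤ) (n : ℕ) (v : X) : 0 < T.W p k n v := by
  induction n generalizing k v with
  | zero => exact one_pos
  | succ n ih => exact mul_pos (q_pos hp k v) (ih _ _)

lemma pow_le_W (hp : T.Good p) (k : ℤ) (n : ℕ) (v : X) : p ^ n ≤ T.W p k n v := by
  induction n generalizing k v with
  | zero => exact le_rfl
  | succ n ih =>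
    rw [pow_succ']
    exact mul_le_mul (le_q hp k v) (ih _ _) (pow_nonneg hp.1.le _) (q_pos hp k v).le

lemma W_comparison {p' c θ : ℝ} (hp : T.Good p) (hp' : T.Good p') (hc : 0 < c)
    (h : ∀ k v, c * T.q p k v ^ θ ≤ T.q p' k v) (k : ℤ) (n : ℕ) (v : X) :
    c ^ n * T.W p k n v ^ θ ≤ T.W p' k n v := by
  induction n generalizing k v with
  | zero => simp [W]
  | succ n ih =>
    simp only [W]
    rw [Real.mul_rpow (q_pos hp k v).le (W_pos hp _ _ _).le, pow_succ']
    calc _ = (c * T.q p k v ^ θ) * (c ^ n * T.W p (k - 1) n (T.P (k - 1) v) ^ θ) := by ring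
      _ ≤ _ := mul_le_mul (h k v) (ih _ _)
        (mul_nonneg (pow_nonneg hc.le _) (Real.rpow_nonneg (W_pos hp _ _ _).le _))
        (q_pos hp' k v).le

lemma anc_succ (k : ℤ) (n : ℕ) (v : X) :
    T.anc k (n + 1) v = T.P (k - n - 1) (T.anc k n v) := by
  induction n generalizing k v with
  | zero => simp [anc]
  | succ n ih =>
    rw [anc, ih, anc]
    congr 1
    push_cast; ring

lemma dist_anc (k : ℤ) (n : ℕ) (v : X) : dist v (T.anc k n v) ≤ 2 * T.δ ^ (k - n) := by
  induction n with
  | zero => simpa [anc] using (T.zpow_pos k).le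
  | succ n ih =>
    rw [anc_succ]
    have h1 := T.dist_P (k - n - 1) (T.anc k n v)
    have h2 := T.zpow_le_sub_one (k - n)
    have h3 := dist_triangle v (T.anc k n v) (T.P (k - n - 1) (T.anc k n v))
    have h4 := T.zpow_pos (k - n - 1)
    have : k - ((n + 1 : ℕ) : ℤ) = k - n - 1 := by push_cast; ring
    rw [this]; linarith

lemma anc_eq_of_le {k : ℤ} {n m : ℕ} {v : X} (h : T.anc k n v = T.x₀) (hnm : n ≤ m) :
    T.anc k m v = T.x₀ := by
  induction m, hnm using Nat.le_induction with
  | base => exact h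
  | succ m _ ih => rw [anc_succ, ih, T.P_x₀]

lemma exists_anc_eq (k : ℤ) (v : X) : ∃ n, T.anc k n v = T.x₀ := by
  have h1 : 1 < T.δ⁻¹ := by
    rw [one_lt_inv₀ T.δ_pos]; linarith [T.δ_le]
  obtain ⟨n, hn⟩ := pow_unbounded_of_one_lt (dist v T.x₀ * (T.δ ^ k)⁻¹) h1
  have h2 : dist v T.x₀ ≤ T.δ ^ (k - n) := by
    rw [zpow_sub₀ T.δ_pos.ne', zpow_natCast, div_eq_mul_inv, ← inv_pow]
    rw [← div_eq_mul_inv, div_lt_iff₀ (T.zpow_pos k)] at hn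
    linarith
  refine ⟨n + 1, ?_⟩
  rw [anc_succ]
  refine T.P_eq _ _ _ (T.x₀_mem _) ?_
  have h3 := T.dist_anc k n v
  have h4 := T.zpow_le_sub_one (k - n)
  have h5 := dist_triangle_left (T.anc k n v) T.x₀ v
  have h6 := T.zpow_pos (k - n - 1)
  linarith

/-- A positive sequence indexed by `ℤ` is the sequence of ratios of another one. -/
lemma exists_ratio_potential (c : ℤ → ℝ) (hc : ∀ k, 0 < c k) :
    ∃ h : ℤ → ℝ, (∀ k, 0 < h k) ∧ ∀ k, h k = c k * h (k - 1) := by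
  let h : ℤ → ℝ
    | Int.ofNat n => ∏ i ∈ Finset.range n, c (i + 1)
    | Int.negSucc n => ∏ i ∈ Finset.range (n + 1), (c (-i))⁻¹
  refine ⟨h, fun k ↦ ?_, fun k ↦ ?_⟩
  · cases k with
    | ofNat n => exact Finset.prod_pos fun i _ ↦ hc _
    | negSucc n => exact Finset.prod_pos fun i _ ↦ inv_pos.2 (hc _)
  · rcases k with (_ | n) | n
    · have : h (Int.ofNat 0 - 1) = (c 0)⁻¹ := by
        change ∏ i ∈ Finset.range (0 + 1), (c (-((i : ℕ) : ℤ)))⁻¹ = _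
        simp
      rw [this]
      simp [h, (hc 0).ne']
    · have : (Int.ofNat (n + 1) : ℤ) - 1 = Int.ofNat n := by simp
      rw [this]
      change ∏ i ∈ Finset.range (n + 1), c ((i : ℕ) + 1)
        = c ((n + 1 : ℕ) : ℤ) * ∏ i ∈ Finset.range n, c ((i : ℕ) + 1)
      rw [Finset.prod_range_succ, mul_comm]
      push_cast; rfl
    · have : (Int.negSucc n : ℤ) - 1 = Int.negSucc (n + 1) := by
        simp only [Int.negSucc_eq]; push_cast; ring
      rw [this]
      simp only [h]
      rw [Finset.prod_range_succ _ (n + 1)]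
      have h3 : (Int.negSucc n : ℤ) = -((n + 1 : ℕ) : ℤ) := rfl
      rw [h3, mul_comm, mul_assoc, inv_mul_cancel₀ (hc _).ne', mul_one]

lemma exists_mass (hp : T.Good p) :
    ∃ m : ℤ → X → ℝ, (∀ k v, 0 < m k v) ∧
      ∀ k v, m k v = T.q p k v * m (k - 1) (T.P (k - 1) v) := by
  classical
  obtain ⟨h, hpos, hh⟩ := exists_ratio_potential (fun k ↦ T.q p k T.x₀) fun k ↦ q_pos hp k _
  let n (k : ℤ) (v : X) : ℕ := Nat.find (T.exists_anc_eq k v)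
  refine ⟨fun k v ↦ T.W p k (n k v) v * h (k - n k v),
    fun k v ↦ mul_pos (W_pos hp _ _ _) (hpos _), fun k v ↦ ?_⟩
  by_cases hv : v = T.x₀
  · have h0 : ∀ j, n j T.x₀ = 0 := fun j ↦ (Nat.find_eq_zero _).2 rfl
    simp [hv, T.P_x₀, h0, W, hh k]
  · have h1 : n k v = n (k - 1) (T.P (k - 1) v) + 1 :=
      Nat.find_comp_succ (T.exists_anc_eq k v) (T.exists_anc_eq (k - 1) (T.P (k - 1) v)) hv
    simp only [h1, W]
    rw [mul_assoc]
    congr 3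
    push_cast; ring

end NetTree

namespace NetTree

variable {X : Type*} [MetricSpace X] {T : NetTree X} {p : ℝ} {m : ℤ → X → ℝ}

/-- `m k v` is a consistent assignment of masses to the points `v` of each generation `k`. -/
def IsMass (T : NetTree X) (p : ℝ) (m : ℤ → X → ℝ) : Prop :=
  (∀ k v, 0 < m k v) ∧ ∀ k v, m k v = T.q p k v * m (k - 1) (T.P (k - 1) v)

lemma IsMass.eq_W_mul (hm : T.IsMass p m) (k : ℤ) (n : ℕ) (v : X) :
    m k v = T.W p k n v * m (k - n) (T.anc k n v) := by
  induction n generalizing k v with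
  | zero => simp [W, anc]
  | succ n ih =>
    rw [hm.2, ih, W, anc, ← mul_assoc]
    congr 2
    push_cast; ring

/-- Points of the same generation at distance comparable to the scale have comparable masses. -/
lemma IsMass.comparable (hp : T.Good p) (hm : T.IsMass p m) {k : ℤ} {u u' : X}
    (h : dist u u' ≤ 5 * T.δ ^ k) : p * m k u ≤ m k u' := by
  have key : ∀ (n : ℕ) (k : ℤ) (u u' : X), T.anc k n u = T.anc k n u' →
      dist u u' ≤ 5 * T.δ ^ k → p * m k u ≤ m k u' := by
    intro n
    induction n with
    | zero =>
      rintro k u u' (rfl : u = u') -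
      nlinarith [hm.1 k u, hp.le_half]
    | succ n ih =>
      intro k u u' hanc hd
      have hd' : dist u' u ≤ 5 * T.δ ^ k := by rwa [dist_comm]
      rw [hm.2 k u, hm.2 k u']
      by_cases hw : T.P (k - 1) u = T.P (k - 1) u'
      · rw [hw]
        have h0 := hm.1 (k - 1) (T.P (k - 1) u')
        have h1 : T.q p k u * m (k - 1) (T.P (k - 1) u') ≤ 1 * m (k - 1) (T.P (k - 1) u') :=
          mul_le_mul_of_nonneg_right (q_le_one hp k u) h0.le
        rw [one_mul] at h1
        exact (mul_le_mul_of_nonneg_left h1 hp.1.le).trans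
          (mul_le_mul_of_nonneg_right (le_q hp k u') h0.le)
      · have hs := T.zpow_le_sub_one k
        have hpos := T.zpow_pos (k - 1)
        have boundary : ∀ a b : X, dist a b ≤ 5 * T.δ ^ k → T.P (k - 1) a ≠ T.P (k - 1) b →
            T.q p k a = p := by
          intro a b hab hne
          refine if_neg fun hc ↦ hne ?_
          refine (T.P_eq _ _ _ (T.P_mem _ _) ?_).symm
          have h1 := T.dist_P k (T.P (k - 1) a)
          rw [← hc] at h1
          have h2 := dist_triangle_left b (T.P (k - 1) a) a
          rw [dist_comm a] at h2
          rw [dist_comm] at h1 hab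
          rw [dist_comm a] at h2
          linarith [dist_comm a b, dist_comm a (T.P (k - 1) a)]
        rw [boundary u u' hd hw, boundary u' u hd' (Ne.symm hw)]
        refine mul_le_mul_of_nonneg_left (ih _ _ _ hanc ?_) hp.1.le
        have h1 := T.dist_P (k - 1) u
        have h2 := T.dist_P (k - 1) u'
        have h3 := dist_triangle4 (T.P (k - 1) u) u u' (T.P (k - 1) u')
        rw [dist_comm _ u] at h3
        linarith
  obtain ⟨n, hn⟩ := T.exists_anc_eq k u
  obtain ⟨n', hn'⟩ := T.exists_anc_eq k u'
  exact key (max n n') k u u' ((T.anc_eq_of_le hn (le_max_left _ _)).trans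
    (T.anc_eq_of_le hn' (le_max_right _ _)).symm) h

lemma IsMass.sum_children (hm : T.IsMass p m) {k : ℤ} {u : X} (hu : u ∈ T.N (k - 1)) :
    ∑ v ∈ (T.childSet_finite k u).toFinset, m k v = m (k - 1) u := by
  classical
  set s := (T.childSet_finite k u).toFinset
  have hmem : T.P k u ∈ s := by simpa [s] using T.P_mem_childSet hu
  have hcard : ((T.childSet k u).ncard : ℝ) = s.card := by
    rw [ncard_eq_toFinset_card _ (T.childSet_finite k u)]
  have hpar : ∀ v ∈ s, T.P (k - 1) v = u := fun v hv ↦ by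
    have : v ∈ T.childSet k u := by simpa [s] using hv
    exact this.2
  have h1 : ∀ v ∈ s, m k v = T.q p k v * m (k - 1) u := fun v hv ↦ by
    rw [hm.2, hpar v hv]
  rw [Finset.sum_congr rfl h1, ← Finset.sum_mul]
  suffices ∑ v ∈ s, T.q p k v = 1 by rw [this, one_mul]
  rw [← Finset.add_sum_erase _ _ hmem]
  have h2 : ∀ v ∈ s.erase (T.P k u), T.q p k v = p := fun v hv ↦ by
    rw [Finset.mem_erase] at hv
    exact if_neg (by rw [hpar v hv.2]; exact hv.1)
  have h3 : T.q p k (T.P k u) = 1 - (((T.childSet k u).ncard : ℝ) - 1) * p := by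
    unfold q
    rw [hpar _ hmem, if_pos rfl]
  rw [Finset.sum_congr rfl h2, h3, hcard, Finset.sum_const, Finset.card_erase_of_mem hmem,
    nsmul_eq_mul, Nat.cast_sub (Finset.card_pos.2 ⟨_, hmem⟩)]
  push_cast; ring

/-- The masses of generation `k`, as an extended nonnegative function vanishing off the net. -/
noncomputable def density (T : NetTree X) (m : ℤ → X → ℝ) (k : ℤ) : X → ℝ≥0∞ :=
  (T.N k).indicator fun v ↦ ENNReal.ofReal (m k v)

lemma IsMass.density_eq (hm : T.IsMass p m) (k : ℤ) (u : X) :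
    T.density m (k - 1) u =
      ∑' v, (T.childSet k u).indicator (fun v ↦ ENNReal.ofReal (m k v)) v := by
  by_cases hu : u ∈ T.N (k - 1)
  · rw [density, indicator_of_mem hu, ← hm.sum_children hu,
      ENNReal.ofReal_sum_of_nonneg fun v _ ↦ (hm.1 k v).le,
      tsum_eq_sum (s := (T.childSet_finite k u).toFinset)]
    · refine Finset.sum_congr rfl fun v hv ↦ ?_
      rw [indicator_of_mem (by simpa using hv)]
    · intro v hv
      rw [indicator_of_notMem (by simpa using hv)]
  · have : T.childSet k u = ∅ := by
      refine eq_empty_of_forall_notMem fun v hv ↦ hu ?_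
      rw [← hv.2]; exact T.P_mem _ _
    simp [density, hu, this]

lemma IsMass.tsum_density (hm : T.IsMass p m) (k : ℤ) (h : X → ℝ≥0∞) :
    ∑' v, T.density m k v * h (T.P (k - 1) v) = ∑' u, T.density m (k - 1) u * h u := by
  simp_rw [hm.density_eq k, ← ENNReal.tsum_mul_right]
  rw [ENNReal.tsum_comm]
  refine tsum_congr fun v ↦ ?_
  rw [tsum_eq_single (T.P (k - 1) v)]
  · by_cases hv : v ∈ T.N k
    · rw [density, indicator_of_mem hv, indicator_of_mem]
      exact ⟨hv, rfl⟩
    · rw [density, indicator_of_notMem hv, indicator_of_notMem]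
      exact fun h ↦ hv h.1
  · intro u hu
    rw [indicator_of_notMem, zero_mul]
    exact fun h ↦ hu h.2.symm

lemma exists_le_zpow (T : NetTree X) (R : ℝ) : ∃ k : ℤ, k ≤ 0 ∧ R ≤ T.δ ^ k := by
  have h1 : 1 < T.δ⁻¹ := by
    rw [one_lt_inv₀ T.δ_pos]; linarith [T.δ_le]
  obtain ⟨n, hn⟩ := pow_unbounded_of_one_lt R h1
  refine ⟨-n, by simp, ?_⟩
  rw [zpow_neg, zpow_natCast, ← inv_pow]
  exact hn.le

lemma K_pos (T : NetTree X) : 0 < T.K := by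
  have h : 0 < (T.N 0 ∩ closedBall T.x₀ (4 * T.δ ^ (0 : ℤ))).ncard :=
    (ncard_pos (T.finite_inter _ _ _)).2
      ⟨T.x₀, T.x₀_mem 0, mem_closedBall_self (mul_nonneg (by norm_num) (T.zpow_pos 0).le)⟩
  exact lt_of_lt_of_le (by exact_mod_cast h) (T.ncard_near 0 T.x₀)

variable [MeasurableSpace X] [BorelSpace X]

/-- The discrete measure of generation `k`. -/
noncomputable def discr (T : NetTree X) (m : ℤ → X → ℝ) (k : ℤ) : Measure X :=
  Measure.sum fun v ↦ T.density m k v • Measure.dirac v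

lemma discr_closedBall (k : ℤ) (x : X) (a : ℝ) :
    T.discr m k (closedBall x a) = ∑' v, T.density m k v * (closedBall x a).indicator 1 v := by
  rw [discr, Measure.sum_apply _ measurableSet_closedBall]
  refine tsum_congr fun v ↦ ?_
  rw [Measure.smul_apply, Measure.dirac_apply' _ measurableSet_closedBall, smul_eq_mul]

lemma IsMass.discr_le_sub_one (hm : T.IsMass p m) (k : ℤ) (x : X) (a : ℝ) :
    T.discr m k (closedBall x a) ≤ T.discr m (k - 1) (closedBall x (a + T.δ ^ (k - 1))) := by
  rw [discr_closedBall, discr_closedBall, ← hm.tsum_density]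
  gcongr with v
  by_cases hv : v ∈ closedBall x a
  · rw [indicator_of_mem hv, indicator_of_mem, Pi.one_apply, Pi.one_apply]
    have h1 := dist_triangle_left (T.P (k - 1) v) x v
    have h2 := T.dist_P (k - 1) v
    rw [mem_closedBall] at hv ⊢
    linarith
  · rw [indicator_of_notMem hv]
    exact zero_le

lemma IsMass.discr_sub_one_le (hm : T.IsMass p m) (k : ℤ) (x : X) (a : ℝ) :
    T.discr m (k - 1) (closedBall x a) ≤ T.discr m k (closedBall x (a + T.δ ^ (k - 1))) := by
  rw [discr_closedBall, discr_closedBall, ← hm.tsum_density]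
  gcongr with v
  by_cases hv : T.P (k - 1) v ∈ closedBall x a
  · rw [indicator_of_mem hv, indicator_of_mem, Pi.one_apply, Pi.one_apply]
    have h1 := dist_triangle v (T.P (k - 1) v) x
    have h2 := T.dist_P (k - 1) v
    rw [mem_closedBall] at hv ⊢
    linarith
  · rw [indicator_of_notMem hv]
    exact zero_le

lemma IsMass.discr_add_le (hm : T.IsMass p m) (k : ℤ) (n : ℕ) (x : X) (a : ℝ) :
    T.discr m (k + n) (closedBall x a) ≤
      T.discr m k (closedBall x (a + 2 * T.δ ^ k - 2 * T.δ ^ (k + n))) := by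
  induction n generalizing a with
  | zero => simp
  | succ n ih =>
    have e : k + ((n + 1 : ℕ) : ℤ) - 1 = k + n := by push_cast; ring
    have h1 := hm.discr_le_sub_one (k + (n + 1 : ℕ)) x a
    have h2 := T.zpow_le_sub_one (k + (n + 1 : ℕ))
    rw [e] at h1 h2
    refine h1.trans ((ih _).trans (measure_mono (closedBall_subset_closedBall ?_)))
    linarith [T.zpow_pos (k + n)]

lemma IsMass.discr_le_add (hm : T.IsMass p m) (k : ℤ) (n : ℕ) (x : X) (a : ℝ) :
    T.discr m k (closedBall x a) ≤
      T.discr m (k + n) (closedBall x (a + 2 * T.δ ^ k - 2 * T.δ ^ (k + n))) := by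
  induction n with
  | zero => simp
  | succ n ih =>
    have e : k + ((n + 1 : ℕ) : ℤ) - 1 = k + n := by push_cast; ring
    have h1 := hm.discr_sub_one_le (k + (n + 1 : ℕ)) x (a + 2 * T.δ ^ k - 2 * T.δ ^ (k + n))
    have h2 := T.zpow_le_sub_one (k + (n + 1 : ℕ))
    rw [e] at h1 h2
    refine ih.trans (h1.trans (measure_mono (closedBall_subset_closedBall ?_)))
    linarith [T.zpow_pos (k + n)]

lemma IsMass.discr_near_le (hp : T.Good p) (hm : T.IsMass p m) (k : ℤ) (x : X) :
    T.discr m k (closedBall x (4 * T.δ ^ k)) ≤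
      ENNReal.ofReal (T.K / p * m k (T.P k x)) := by
  classical
  have hfin := T.finite_inter k x (4 * T.δ ^ k)
  have h1 : ∀ v ∈ hfin.toFinset, T.density m k v * (closedBall x (4 * T.δ ^ k)).indicator 1 v ≤
      ENNReal.ofReal (m k (T.P k x) / p) := fun v hv ↦ by
    have hv : v ∈ T.N k ∩ closedBall x (4 * T.δ ^ k) := by simpa using hv
    rw [density, indicator_of_mem hv.1, indicator_of_mem hv.2, Pi.one_apply, mul_one]
    refine ENNReal.ofReal_le_ofReal ?_
    rw [le_div_iff₀ hp.1, mul_comm]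
    refine hm.comparable hp ?_
    have := dist_triangle v x (T.P k x)
    linarith [mem_closedBall.1 hv.2, T.dist_P k x]
  rw [discr_closedBall, tsum_eq_sum (s := hfin.toFinset)]
  · refine (Finset.sum_le_sum h1).trans ?_
    rw [Finset.sum_const, nsmul_eq_mul, ← ENNReal.ofReal_natCast,
      ← ENNReal.ofReal_mul (Nat.cast_nonneg _), ← ncard_eq_toFinset_card _ hfin]
    refine ENNReal.ofReal_le_ofReal ?_
    rw [div_mul_eq_mul_div, mul_div_assoc]
    exact mul_le_mul_of_nonneg_right (T.ncard_near k x) (div_pos (hm.1 _ _) hp.1).le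
  · intro v hv
    have hv : ¬ (v ∈ T.N k ∧ v ∈ closedBall x (4 * T.δ ^ k)) := by simpa using hv
    rw [not_and_or] at hv
    rcases hv with hv | hv
    · rw [density, indicator_of_notMem hv, zero_mul]
    · rw [indicator_of_notMem hv, mul_zero]

lemma le_discr {k : ℤ} {x v : X} {a : ℝ} (hv : v ∈ T.N k) (h : dist v x ≤ a) :
    ENNReal.ofReal (m k v) ≤ T.discr m k (closedBall x a) := by
  rw [discr_closedBall]
  refine le_trans (le_of_eq ?_) (ENNReal.le_tsum v)
  rw [density, indicator_of_mem hv, indicator_of_mem (mem_closedBall.2 h), Pi.one_apply, mul_one]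

lemma IsMass.exists_measure [ProperSpace X] (hp : T.Good p) (hm : T.IsMass p m) :
    ∃ μ : Measure X, ∀ (x : X) (k : ℤ) (r : ℝ), T.δ ^ (k + 1) < r → r ≤ T.δ ^ k →
      ENNReal.ofReal (p ^ 3 * m k (T.P k x)) ≤ μ (closedBall x r) ∧
      μ (closedBall x r) ≤ ENNReal.ofReal (T.K / p * m k (T.P k x)) := by
  obtain ⟨μ, hμ⟩ := exists_vague_limit T.x₀ (fun j ↦ T.discr m j) fun R ↦ by
    obtain ⟨k, hk, hR⟩ := T.exists_le_zpow R
    refine ⟨T.K / p * m k (T.P k T.x₀), fun j ↦ ?_⟩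
    obtain ⟨n, hn⟩ := Int.le.dest (hk.trans (Int.natCast_nonneg j))
    have h1 := hm.discr_add_le k n T.x₀ R
    rw [hn] at h1
    refine h1.trans ((measure_mono (closedBall_subset_closedBall ?_)).trans
      (hm.discr_near_le hp k T.x₀))
    linarith [T.zpow_pos j, T.zpow_pos k]
  refine ⟨μ, fun x k r hr1 hr2 ↦ ?_⟩
  have hr : 0 < r := (T.zpow_pos _).trans hr1
  refine ⟨(hμ x r _ hr (by have := hm.1 k (T.P k x); have := hp.1; positivity)).2 ?_,
    (hμ x r _ hr (by have := hm.1 k (T.P k x); have := hp.1; have := T.K_pos; positivity)).1 ?_⟩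
  · filter_upwards [eventually_ge_atTop (k + 2).toNat] with j hj
    obtain ⟨n, hn⟩ := Int.le.dest (Int.toNat_le.1 hj)
    have h1 := hm.discr_le_add (k + 2) n x (r / 2 - 2 * T.δ ^ (k + 2))
    rw [hn] at h1
    have z1 := T.zpow_le_sub_one (k + 2)
    have z2 := T.zpow_le_sub_one (k + 1)
    rw [show k + 2 - 1 = k + 1 by ring] at z1
    rw [show k + 1 - 1 = k by ring] at z2
    have z3 := T.zpow_pos k
    have hd := T.dist_P (k + 2) x
    calc ENNReal.ofReal (p ^ 3 * m k (T.P k x))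
        ≤ ENNReal.ofReal (m (k + 2) (T.P (k + 2) x)) := by
          refine ENNReal.ofReal_le_ofReal ?_
          rw [hm.eq_W_mul (k + 2) 2]
          have h2 := pow_le_W hp (k + 2) 2 (T.P (k + 2) x)
          have h4 := T.dist_anc (k + 2) 2 (T.P (k + 2) x)
          have e : k + 2 - ((2 : ℕ) : ℤ) = k := by push_cast; ring
          rw [e] at h4 ⊢
          have h3 : p * m k (T.P k x) ≤ m k (T.anc (k + 2) 2 (T.P (k + 2) x)) := by
            refine hm.comparable hp ?_
            have h5 := dist_triangle4 (T.P k x) x (T.P (k + 2) x)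
              (T.anc (k + 2) 2 (T.P (k + 2) x))
            have h6 := T.dist_P k x
            rw [dist_comm] at h6
            linarith
          calc p ^ 3 * m k (T.P k x) = p ^ 2 * (p * m k (T.P k x)) := by ring
            _ ≤ _ := mul_le_mul h2 h3 (mul_pos hp.1 (hm.1 _ _)).le (W_pos hp _ _ _).le
      _ ≤ T.discr m (k + 2) (closedBall x (r / 2 - 2 * T.δ ^ (k + 2))) := by
          refine le_discr (T.P_mem _ _) ?_
          rw [dist_comm]; linarith
      _ ≤ T.discr m j (closedBall x (r / 2)) := by
          refine h1.trans (measure_mono (closedBall_subset_closedBall ?_))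
          linarith [T.zpow_pos j]
  · filter_upwards [eventually_ge_atTop k.toNat] with j hj
    obtain ⟨n, hn⟩ := Int.le.dest (Int.toNat_le.1 hj)
    have h1 := hm.discr_add_le k n x (2 * r)
    rw [hn] at h1
    refine h1.trans ((measure_mono (closedBall_subset_closedBall ?_)).trans
      (hm.discr_near_le hp k x))
    linarith [T.zpow_pos j]

end NetTree

namespace NetTree

variable {X : Type*} [MetricSpace X] {T : NetTree X} {p : ℝ} {m : ℤ → X → ℝ}

/-- The exponents `α` for which relative masses over `n` generations are bounded below by a
constant multiple of `δ ^ (n * α)`. -/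
def Adm (T : NetTree X) (p α : ℝ) : Prop :=
  0 ≤ α ∧ ∃ C > 0, ∀ (k : ℤ) (n : ℕ), ∀ v ∈ T.N k, (T.δ ^ n) ^ α ≤ C * T.W p k n v

/-- The infimum of the admissible exponents. -/
noncomputable def rate (T : NetTree X) (p : ℝ) : ℝ := sInf {α | T.Adm p α}

lemma Adm.mono {α β : ℝ} (h : T.Adm p α) (hαβ : α ≤ β) : T.Adm p β := by
  obtain ⟨h0, C, hC, h⟩ := h
  refine ⟨h0.trans hαβ, C, hC, fun k n v hv ↦ le_trans ?_ (h k n v hv)⟩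
  exact Real.rpow_le_rpow_of_exponent_ge (pow_pos T.δ_pos n)
    (pow_le_one₀ T.δ_pos.le (by linarith [T.δ_le])) hαβ

lemma adm_of_rpow_le (hp : T.Good p) {α : ℝ} (hα : 0 ≤ α) (h : T.δ ^ α ≤ p) : T.Adm p α := by
  refine ⟨hα, 1, one_pos, fun k n v _ ↦ ?_⟩
  rw [one_mul, ← Real.rpow_natCast, ← Real.rpow_mul T.δ_pos.le, mul_comm, Real.rpow_mul T.δ_pos.le,
    Real.rpow_natCast]
  exact (pow_le_pow_left₀ (Real.rpow_nonneg T.δ_pos.le _) h n).trans (pow_le_W hp k n v)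

lemma log_δ_neg (T : NetTree X) : Real.log T.δ < 0 :=
  Real.log_neg T.δ_pos (by linarith [T.δ_le])

lemma exists_adm (hp : T.Good p) : ∃ α, T.Adm p α := by
  refine ⟨Real.log p / Real.log T.δ, adm_of_rpow_le hp ?_ ?_⟩
  · exact div_nonneg_of_nonpos
      (Real.log_nonpos hp.1.le (by linarith [hp.le_half])) T.log_δ_neg.le
  · rw [Real.rpow_def_of_pos T.δ_pos, mul_div_cancel₀ _ T.log_δ_neg.ne, Real.exp_log hp.1]

lemma bddBelow_adm (T : NetTree X) (p : ℝ) : BddBelow {α | T.Adm p α} := ⟨0, fun _ h ↦ h.1⟩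

lemma Adm.rate_le {α : ℝ} (h : T.Adm p α) : T.rate p ≤ α := csInf_le (T.bddBelow_adm p) h

lemma adm_of_rate_lt (hp : T.Good p) {α : ℝ} (h : T.rate p < α) : T.Adm p α := by
  obtain ⟨β, hβ, hlt⟩ := exists_lt_of_csInf_lt (exists_adm hp) h
  exact Adm.mono hβ hlt.le

lemma rate_le_add {p' : ℝ} (hp : T.Good p) (hp' : T.Good p') :
    T.rate p' ≤ T.rate p + |Real.log p - Real.log p'| / (-Real.log T.δ) := by
  set d := |Real.log p - Real.log p'| with hd
  set c := Real.exp (-d) with hc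
  have hc0 : 0 < c := Real.exp_pos _
  have hc1 : c ≤ 1 := Real.exp_le_one_iff.2 (neg_nonpos.2 (abs_nonneg _))
  have hcp : c * p ≤ p' := by
    rw [← Real.exp_log hp.1, hc, ← Real.exp_add, ← Real.le_log_iff_exp_le hp'.1]
    linarith [le_abs_self (Real.log p - Real.log p')]
  have hcp' : c * p' ≤ p := by
    rw [← Real.exp_log hp'.1, hc, ← Real.exp_add, ← Real.le_log_iff_exp_le hp.1]
    linarith [neg_abs_le (Real.log p - Real.log p')]
  have hq : ∀ k v, c * T.q p k v ^ (1 : ℝ) ≤ T.q p' k v := fun k v ↦ by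
    rw [Real.rpow_one]
    unfold q
    obtain ⟨h1, h2⟩ := central_mem hp k (T.P_mem (k - 1) v)
    obtain ⟨h3, h4⟩ := central_mem hp' k (T.P_mem (k - 1) v)
    have h5 := T.one_le_ncard (T.P_mem (k - 1) v)
    split_ifs
    · set a := (((T.childSet k (T.P (k - 1) v)).ncard : ℝ) - 1)
      have ha : 0 ≤ a := by linarith
      rcases le_or_gt p' p with h | h
      · nlinarith [mul_le_mul_of_nonneg_left h ha]
      · have h6 : p * (1 - a * p) ≤ p' * (1 - a * p') := by nlinarith
        have h7 : c * p' * (1 - a * p) ≤ p * (1 - a * p) :=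
          mul_le_mul_of_nonneg_right hcp' (by linarith)
        have h8 : p' * (c * (1 - a * p)) ≤ p' * (1 - a * p') := by linarith
        exact le_of_mul_le_mul_left h8 hp'.1
    · exact hcp
  have hδc : T.δ ^ (d / (-Real.log T.δ)) = c := by
    rw [Real.rpow_def_of_pos T.δ_pos, hc]
    congr 1
    have := T.log_δ_neg.ne
    field_simp
  refine le_of_forall_pos_le_add fun ε hε ↦ ?_
  obtain ⟨h0, C, hC, h⟩ := adm_of_rate_lt hp (lt_add_of_pos_right (T.rate p) hε)
  have hadm : T.Adm p' (T.rate p + ε + d / (-Real.log T.δ)) := by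
    refine ⟨add_nonneg h0 (div_nonneg (abs_nonneg _) (neg_pos.2 T.log_δ_neg).le), C, hC,
      fun k n v hv ↦ ?_⟩
    have h1 := W_comparison hp hp' hc0 hq k n v
    rw [Real.rpow_one] at h1
    have h2 : (T.δ ^ n) ^ (d / (-Real.log T.δ)) = c ^ n := by
      rw [← Real.rpow_natCast, ← Real.rpow_mul T.δ_pos.le, mul_comm, Real.rpow_mul T.δ_pos.le,
        Real.rpow_natCast, hδc]
    rw [Real.rpow_add (pow_pos T.δ_pos n), h2]
    calc _ ≤ C * T.W p k n v * c ^ n :=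
          mul_le_mul_of_nonneg_right (h k n v hv) (pow_nonneg hc0.le n)
      _ = C * (c ^ n * T.W p k n v) := by ring
      _ ≤ _ := mul_le_mul_of_nonneg_left h1 hC.le
  linarith [hadm.rate_le]

lemma Good.mono {p' : ℝ} (hp : T.Good p) (h0 : 0 < p') (h : p' ≤ p) : T.Good p' :=
  ⟨h0, (mul_le_mul_of_nonneg_left h (by linarith [T.one_le_M])).trans hp.2⟩

/-- If some positive exponent is never admissible, the rate becomes large for small `p`. -/
lemma exists_le_rate (hp : T.Good p) {β s : ℝ} (hβ : 0 < β) (hβs : β ≤ s)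
    (hno : ∀ p', T.Good p' → ¬ T.Adm p' β) : ∃ p', 0 < p' ∧ p' ≤ p ∧ s ≤ T.rate p' := by
  have hs : 0 < s := hβ.trans_le hβs
  set c := T.δ ^ (β / 2)
  have hc0 : 0 < c := Real.rpow_pos_of_pos T.δ_pos _
  have hc1 : c < 1 := Real.rpow_lt_one T.δ_pos.le (by linarith [T.δ_le]) (by linarith)
  have hM : 0 < T.M := by linarith [T.one_le_M]
  set p₁ := min p ((1 - c) / T.M)
  have hp₁0 : 0 < p₁ := lt_min hp.1 (div_pos (by linarith) hM)
  have hp₁ : T.Good p₁ := hp.mono hp₁0 (min_le_left _ _)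
  have hcM : c ≤ 1 - T.M * p₁ := by
    have : p₁ ≤ (1 - c) / T.M := min_le_right _ _
    rw [le_div_iff₀ hM] at this
    linarith
  set θ := β / (2 * s)
  have hθ0 : 0 < θ := by positivity
  have hθ1 : θ ≤ 1 := by rw [div_le_one (by positivity)]; linarith
  set p₂ := p₁ ^ θ⁻¹
  have hp₂0 : 0 < p₂ := Real.rpow_pos_of_pos hp₁0 _
  have hp₂₁ : p₂ ≤ p₁ := by
    have := Real.rpow_le_rpow_of_exponent_ge hp₁0 (by linarith [hp₁.le_half])
      ((one_le_inv₀ hθ0).2 hθ1)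
    rwa [Real.rpow_one] at this
  have hp₂ : T.Good p₂ := hp₁.mono hp₂0 hp₂₁
  refine ⟨p₂, hp₂0, hp₂₁.trans (min_le_left _ _), ?_⟩
  by_contra! hlt
  obtain ⟨-, C, hC, h⟩ := adm_of_rate_lt hp₂ hlt
  have hq : ∀ k v, c * T.q p₂ k v ^ θ ≤ T.q p₁ k v := fun k v ↦ by
    have h1 : T.q p₂ k v ^ θ ≤ 1 :=
      Real.rpow_le_one (q_pos hp₂ k v).le (q_le_one hp₂ k v) hθ0.le
    by_cases hv : v = T.P k (T.P (k - 1) v)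
    · have h2 : T.q p₁ k v = 1 - (((T.childSet k (T.P (k - 1) v)).ncard : ℝ) - 1) * p₁ :=
        if_pos hv
      rw [h2]
      nlinarith [T.ncard_childSet_le k (T.P (k - 1) v)]
    · have h2 : T.q p₁ k v = p₁ := if_neg hv
      have h3 : T.q p₂ k v = p₂ := if_neg hv
      rw [h2, h3, Real.rpow_inv_rpow hp₁0.le hθ0.ne']
      nlinarith
  refine hno p₁ hp₁ ⟨hβ.le, C ^ θ, Real.rpow_pos_of_pos hC _, fun k n v hv ↦ ?_⟩
  have hδn : 0 < T.δ ^ n := pow_pos T.δ_pos n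
  have h1 := W_comparison hp₂ hp₁ hc0 hq k n v
  have h2 := Real.rpow_le_rpow (Real.rpow_nonneg hδn.le _) (h k n v hv) hθ0.le
  rw [Real.mul_rpow hC.le (W_pos hp₂ _ _ _).le, ← Real.rpow_mul hδn.le,
    show s * θ = β / 2 by simp only [θ]; field_simp] at h2
  have h3 : (T.δ ^ n) ^ (β / 2) = c ^ n := by
    rw [← Real.rpow_natCast, ← Real.rpow_mul T.δ_pos.le, mul_comm, Real.rpow_mul T.δ_pos.le,
      Real.rpow_natCast]
  calc (T.δ ^ n) ^ β = c ^ n * (T.δ ^ n) ^ (β / 2) := by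
        rw [← h3, ← Real.rpow_add hδn, add_halves]
    _ ≤ c ^ n * (C ^ θ * T.W p₂ k n v ^ θ) := mul_le_mul_of_nonneg_left h2 (pow_nonneg hc0.le n)
    _ = C ^ θ * (c ^ n * T.W p₂ k n v ^ θ) := by ring
    _ ≤ _ := mul_le_mul_of_nonneg_left h1 (Real.rpow_nonneg hC.le _)

/-- The rates attain every value between the rate at `p` and a large value. -/
lemma exists_rate_eq (hp : T.Good p) {β s : ℝ} (hβ : 0 < β) (hβs : β ≤ s)
    (hno : ∀ p', T.Good p' → ¬ T.Adm p' β) (hps : T.rate p ≤ s) :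
    ∃ p', T.Good p' ∧ T.rate p' = s := by
  obtain ⟨p', h0, hle, hs⟩ := exists_le_rate hp hβ hβs hno
  have hlog : Real.log p' ≤ Real.log p := Real.log_le_log h0 hle
  have hgood : ∀ t ∈ Icc (Real.log p') (Real.log p), T.Good (Real.exp t) := fun t ht ↦
    hp.mono (Real.exp_pos t) (by rw [← Real.le_log_iff_exp_le hp.1]; exact ht.2)
  have hL := neg_pos.2 T.log_δ_neg
  have hcont : ContinuousOn (fun t ↦ T.rate (Real.exp t)) (Icc (Real.log p') (Real.log p)) := by
    refine (LipschitzOnWith.of_le_add_mul (Real.toNNReal (-Real.log T.δ)⁻¹)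
      fun t ht t' ht' ↦ ?_).continuousOn
    have := rate_le_add (hgood t' ht') (hgood t ht)
    rw [Real.log_exp, Real.log_exp] at this
    rw [Real.coe_toNNReal _ (inv_pos.2 hL).le, Real.dist_eq, abs_sub_comm, mul_comm,
      ← div_eq_mul_inv]
    exact this
  have := intermediate_value_Icc' hlog hcont
  rw [Real.exp_log h0, Real.exp_log hp.1] at this
  obtain ⟨t, ht, hts⟩ := this ⟨hps, hs⟩
  exact ⟨_, hgood t ht, hts⟩

lemma exists_scale (T : NetTree X) {r : ℝ} (hr : 0 < r) :
    ∃ k : ℤ, T.δ ^ (k + 1) < r ∧ r ≤ T.δ ^ k := by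
  have h1 : 1 < T.δ⁻¹ := by
    rw [one_lt_inv₀ T.δ_pos]; linarith [T.δ_le]
  obtain ⟨n, hn1, hn2⟩ := exists_mem_Ioc_zpow hr h1
  refine ⟨-(n + 1), ?_, ?_⟩
  · rwa [show -(n + 1) + 1 = -n by ring, zpow_neg, ← inv_zpow]
  · rwa [zpow_neg, ← inv_zpow]

lemma scale_le {r R : ℝ} {k l : ℤ} (hrR : r < R) (hR : R ≤ T.δ ^ k) (hr : T.δ ^ (l + 1) < r) :
    k ≤ l := by
  by_contra! h
  linarith [T.zpow_anti (show l + 1 ≤ k by lia)]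

lemma δ_zpow_add (T : NetTree X) (k : ℤ) (n : ℕ) : T.δ ^ (k + n) = T.δ ^ k * T.δ ^ n := by
  rw [zpow_add₀ T.δ_pos.ne', zpow_natCast]

section Measure

variable [MeasurableSpace X]

/-- The measure condition for an exponent is equivalent to admissibility. -/
lemma adm_iff {μ : Measure X} (hp : T.Good p) (hm : T.IsMass p m)
    (hμ : ∀ (x : X) (k : ℤ) (r : ℝ), T.δ ^ (k + 1) < r → r ≤ T.δ ^ k →
      ENNReal.ofReal (p ^ 3 * m k (T.P k x)) ≤ μ (closedBall x r) ∧
      μ (closedBall x r) ≤ ENNReal.ofReal (T.K / p * m k (T.P k x))) {α : ℝ} (hα : 0 ≤ α) :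
    (∃ C : ℝ, 0 < C ∧ ∀ x : X, ∀ r R : ℝ, 0 < r → r < R →
      μ (closedBall x R) / μ (closedBall x r) ≤ ENNReal.ofReal (C * (R / r) ^ α)) ↔
      T.Adm p α := by
  have hK := T.K_pos
  have hp0 := hp.1
  have hδ := T.δ_pos
  constructor
  · rintro ⟨C, hC, h⟩
    refine ⟨hα, C * T.K / p ^ 5 + 1, by positivity, fun k n v hv ↦ ?_⟩
    have hW := W_pos hp k n v
    rcases Nat.eq_zero_or_pos n with rfl | hn
    · simp only [pow_zero, Real.one_rpow, W]
      have : 0 < C * T.K / p ^ 5 := by positivity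
      linarith
    have hδn : 0 < T.δ ^ n := pow_pos hδ n
    have e1 := T.δ_zpow_add (k - n) n
    rw [sub_add_cancel] at e1
    have hz := T.zpow_pos (k - n)
    have hlt : ∀ j : ℤ, T.δ ^ (j + 1) < T.δ ^ j := fun j ↦ by
      have := T.zpow_le_sub_one (j + 1)
      rw [add_sub_cancel_right] at this
      linarith [T.zpow_pos j]
    have hRr : T.δ ^ k < T.δ ^ (k - n) := by
      rw [e1]
      have := pow_lt_one₀ hδ.le (show T.δ < 1 by linarith [T.δ_le]) hn.ne'
      nlinarith
    have h1 := (hμ v (k - n) _ (hlt _) le_rfl).1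
    have h2 := hμ v k _ (hlt _) le_rfl
    have h3 := h v _ _ (T.zpow_pos k) hRr
    rw [T.P_self hv] at h2
    have hmk := hm.1 k v
    have hpos : μ (closedBall v (T.δ ^ k)) ≠ 0 :=
      ((ENNReal.ofReal_pos.2 (by positivity)).trans_le h2.1).ne'
    have htop : μ (closedBall v (T.δ ^ k)) ≠ ⊤ := (h2.2.trans_lt ENNReal.ofReal_lt_top).ne
    rw [ENNReal.div_le_iff hpos htop] at h3
    have hA : 0 < (T.δ ^ (k - n) / T.δ ^ k) ^ α :=
      Real.rpow_pos_of_pos (div_pos hz (T.zpow_pos k)) _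
    have h4 := h1.trans (h3.trans (mul_le_mul_right h2.2 _))
    rw [← ENNReal.ofReal_mul (by positivity), ENNReal.ofReal_le_ofReal_iff (by positivity)] at h4
    have h5 : p * m (k - n) (T.anc k n v) ≤ m (k - n) (T.P (k - n) v) := by
      refine hm.comparable hp ?_
      have := dist_triangle_left (T.anc k n v) (T.P (k - n) v) v
      linarith [T.dist_anc k n v, T.dist_P (k - n) v]
    rw [hm.eq_W_mul k n v] at h4
    have hma := hm.1 (k - n) (T.anc k n v)
    have h6 : (T.δ ^ (k - n) / T.δ ^ k) ^ α = ((T.δ ^ n) ^ α)⁻¹ := by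
      rw [← Real.inv_rpow hδn.le, e1]
      congr 1
      field_simp
    rw [h6] at h4
    have hD : 0 < (T.δ ^ n) ^ α := Real.rpow_pos_of_pos hδn _
    generalize (T.δ ^ n) ^ α = D at *
    generalize m (k - n) (T.anc k n v) = a at *
    generalize T.W p k n v = w at *
    have h7 : p ^ 3 * (p * a) ≤ C * D⁻¹ * (T.K / p * (w * a)) := le_trans (by gcongr) h4
    have h8 : p ^ 3 * (p * a) * (D * p / a) ≤ C * D⁻¹ * (T.K / p * (w * a)) * (D * p / a) :=
      mul_le_mul_of_nonneg_right h7 (by positivity)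
    have h9 : D * p ^ 5 ≤ C * T.K * w := by
      convert h8 using 1
      · field_simp
      · field_simp
    rw [← le_div_iff₀ (by positivity)] at h9
    calc D ≤ C * T.K * w / p ^ 5 := h9
      _ = C * T.K / p ^ 5 * w := by ring
      _ ≤ _ := by nlinarith
  · rintro ⟨-, C, hC, h⟩
    refine ⟨T.K * C / p ^ 5 / T.δ ^ α, by positivity, fun x r R hr hrR ↦ ?_⟩
    obtain ⟨l, hl1, hl2⟩ := T.exists_scale hr
    obtain ⟨k, hk1, hk2⟩ := T.exists_scale (hr.trans hrR)
    obtain ⟨n, rfl⟩ := Int.le.dest (scale_le hrR hk2 hl1)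
    have h1 := (hμ x k R hk1 hk2).2
    have h2 := (hμ x _ r hl1 hl2).1
    have hA : 0 < (R / r) ^ α := Real.rpow_pos_of_pos (div_pos (hr.trans hrR) hr) _
    refine ENNReal.div_le_of_le_mul (h1.trans (le_trans ?_ (mul_le_mul_right h2 _)))
    rw [← ENNReal.ofReal_mul (by positivity)]
    refine ENNReal.ofReal_le_ofReal ?_
    have hδn : 0 < T.δ ^ n := pow_pos hδ n
    have h3 : T.δ ^ α ≤ (T.δ ^ n) ^ α * (R / r) ^ α := by
      rw [← Real.mul_rpow hδn.le (div_pos (hr.trans hrR) hr).le]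
      refine Real.rpow_le_rpow hδ.le ?_ hα
      rw [← mul_div_assoc, le_div_iff₀ hr]
      have e1 := T.δ_zpow_add k n
      have e2 := T.δ_zpow_add k 1
      rw [Nat.cast_one, pow_one] at e2
      rw [e2] at hk1
      rw [e1] at hl2
      calc T.δ * r ≤ T.δ * (T.δ ^ k * T.δ ^ n) := by gcongr
        _ = T.δ ^ n * (T.δ ^ k * T.δ) := by ring
        _ ≤ _ := by gcongr
    have h4 := h (k + n) n _ (T.P_mem (k + n) x)
    rw [hm.eq_W_mul (k + n) n]
    have h5 := T.dist_anc (k + n) n (T.P (k + n) x)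
    rw [add_sub_cancel_right] at h5 ⊢
    have h6 : p * m k (T.P k x) ≤ m k (T.anc (k + n) n (T.P (k + n) x)) := by
      refine hm.comparable hp ?_
      have h7 := dist_triangle4 (T.P k x) x (T.P (k + n) x) (T.anc (k + n) n (T.P (k + n) x))
      have h8 := T.dist_P k x
      rw [dist_comm] at h8
      linarith [T.dist_P (k + n) x, T.zpow_anti (show k ≤ k + n by lia), T.zpow_pos k]
    have hm0 := hm.1 k (T.P k x)
    have hW := W_pos hp (k + n) n (T.P (k + n) x)
    have hD : 0 < (T.δ ^ n) ^ α := Real.rpow_pos_of_pos hδn _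
    have hE : 0 < T.δ ^ α := Real.rpow_pos_of_pos hδ _
    generalize (T.δ ^ n) ^ α = D at *
    generalize T.δ ^ α = E at *
    generalize (R / r) ^ α = A at *
    generalize T.W p (k + n) n (T.P (k + n) x) = w at *
    generalize m k (T.anc (k + n) n (T.P (k + n) x)) = a at *
    generalize m k (T.P k x) = b at *
    calc T.K / p * b = T.K / p * b * E / E := by field_simp
      _ ≤ T.K / p * b * (D * A) / E := by gcongr
      _ ≤ T.K / p * b * (C * w * A) / E := by gcongr
      _ = T.K * C / p ^ 5 / E * A * (p ^ 3 * (w * (p * b))) := by field_simp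
      _ ≤ _ := by gcongr

variable [BorelSpace X]

/-- An admissible exponent bounds the Assouad dimension of the space. -/
lemma Adm.assouadDim_le {α : ℝ} (hp : T.Good p) (hm : T.IsMass p m) (h : T.Adm p α) :
    assouadDim X ≤ ENNReal.ofReal α := by
  obtain ⟨h0, C, hC, h⟩ := h
  have hK := T.K_pos
  have hp0 := hp.1
  refine sInf_le ⟨α, h0, rfl, T.K * C / p ^ 2 / (T.δ ^ (2 : ℕ)) ^ α,
    by have := T.δ_pos; positivity, fun x r R hr hrR ↦ ?_⟩
  obtain ⟨l, hl1, hl2⟩ := T.exists_scale hr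
  obtain ⟨k, hk1, hk2⟩ := T.exists_scale (hr.trans hrR)
  obtain ⟨n, hn⟩ := Int.le.dest ((scale_le hrR hk2 hl1).trans (Int.le_add_one le_rfl))
  have hfin := T.finite_inter (l + 1) x (2 * R)
  set S := hfin.toFinset with hS
  have hSmem : ∀ u, u ∈ S ↔ u ∈ T.N (l + 1) ∧ dist u x ≤ 2 * R := fun u ↦ by
    simp [hS, mem_closedBall]
  have hcov : closedBall x R ⊆ ⋃ u ∈ S, closedBall u r := fun y hy ↦ by
    have h1 := T.dist_P (l + 1) y
    rw [mem_closedBall] at hy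
    refine mem_biUnion ((hSmem _).2 ⟨T.P_mem (l + 1) y, ?_⟩) (mem_closedBall.2 (h1.trans hl1.le))
    linarith [dist_triangle_left (T.P (l + 1) y) x y]
  have hcard : (coverNumber x R r : ℝ≥0∞) ≤ (S.card : ℝ≥0∞) := by
    have : coverNumber x R r ≤ (S.card : ℕ∞) := sInf_le ⟨S, rfl, hcov⟩
    exact_mod_cast (ENat.toENNReal_le.2 this)
  refine hcard.trans ?_
  rw [← ENNReal.ofReal_natCast]
  refine ENNReal.ofReal_le_ofReal ?_
  set m₀ := m k (T.P k x)
  have hm₀ : 0 < m₀ := hm.1 _ _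
  have hδn : 0 < T.δ ^ n := pow_pos T.δ_pos n
  have hsum : ∑ u ∈ S, m (l + 1) u ≤ T.K / p * m₀ := by
    have h1 : ENNReal.ofReal (∑ u ∈ S, m (l + 1) u) ≤ ENNReal.ofReal (T.K / p * m₀) := by
      refine le_trans ?_ (hm.discr_near_le hp k x)
      refine le_trans ?_ ((hm.discr_add_le k n x (2 * R)).trans
        (measure_mono (closedBall_subset_closedBall ?_)))
      · rw [hn, discr_closedBall, ENNReal.ofReal_sum_of_nonneg fun v _ ↦ (hm.1 _ v).le]
        refine le_trans (Finset.sum_le_sum fun v hv ↦ ?_) (ENNReal.sum_le_tsum S)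
        rw [hSmem] at hv
        rw [density, indicator_of_mem hv.1, indicator_of_mem (mem_closedBall.2 hv.2),
          Pi.one_apply, mul_one]
      · linarith [T.zpow_pos (k + n)]
    exact (ENNReal.ofReal_le_ofReal_iff (by positivity)).1 h1
  have hlow : ∀ u ∈ S, (T.δ ^ n) ^ α / C * (p * m₀) ≤ m (l + 1) u := fun u hu ↦ by
    rw [hSmem] at hu
    rw [hm.eq_W_mul (l + 1) n u]
    have e : l + 1 - (n : ℤ) = k := by rw [← hn]; ring
    have h1 := T.dist_anc (l + 1) n u
    rw [e] at h1 ⊢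
    refine mul_le_mul ?_ (hm.comparable hp ?_) (by positivity) (W_pos hp _ _ _).le
    · rw [div_le_iff₀' hC]; exact h _ _ _ hu.1
    · have h2 := dist_triangle4 (T.P k x) x u (T.anc (l + 1) n u)
      have h3 := T.dist_P k x
      rw [dist_comm] at h3
      linarith [dist_comm x u]
  have h1 := Finset.card_nsmul_le_sum S _ _ hlow
  rw [nsmul_eq_mul] at h1
  have h2 : (T.δ ^ (2 : ℕ)) ^ α ≤ (T.δ ^ n) ^ α * (R / r) ^ α := by
    rw [← Real.mul_rpow hδn.le (div_pos (hr.trans hrR) hr).le]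
    refine Real.rpow_le_rpow (sq_nonneg _) ?_ h0
    rw [← mul_div_assoc, le_div_iff₀ hr]
    have e1 := T.δ_zpow_add k n
    have e2 := T.δ_zpow_add k 1
    have e3 := T.δ_zpow_add l 1
    rw [hn] at e1
    rw [Nat.cast_one, pow_one] at e2 e3
    rw [e2] at hk1
    rw [e3] at e1
    have z := T.δ_pos
    calc T.δ ^ 2 * r ≤ T.δ ^ 2 * T.δ ^ l := by gcongr
      _ = T.δ ^ n * (T.δ ^ k * T.δ) := by rw [sq, mul_assoc, mul_comm T.δ (T.δ ^ l), e1]; ring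
      _ ≤ _ := by gcongr
  have hδ2 : 0 < (T.δ ^ (2 : ℕ)) ^ α := Real.rpow_pos_of_pos (pow_pos T.δ_pos 2) _
  have hD : 0 < (T.δ ^ n) ^ α := Real.rpow_pos_of_pos hδn _
  have hA : 0 < (R / r) ^ α := Real.rpow_pos_of_pos (div_pos (hr.trans hrR) hr) _
  clear_value m₀
  generalize (T.δ ^ (2 : ℕ)) ^ α = E at *
  generalize (T.δ ^ n) ^ α = D at *
  generalize (R / r) ^ α = A at *
  have h3 : (S.card : ℝ) * D ≤ T.K * C / p ^ 2 := by
    have h4 := h1.trans hsum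
    rw [le_div_iff₀ (by positivity)]
    have h5 : (S.card : ℝ) * (D / C * (p * m₀)) * (C * p / m₀) ≤ T.K / p * m₀ * (C * p / m₀) :=
      mul_le_mul_of_nonneg_right h4 (by positivity)
    have e1 : (S.card : ℝ) * (D / C * (p * m₀)) * (C * p / m₀) = S.card * D * p ^ 2 := by
      field_simp
    have e2 : T.K / p * m₀ * (C * p / m₀) = T.K * C := by field_simp
    rwa [e1, e2] at h5
  rw [div_mul_eq_mul_div, le_div_iff₀ hδ2]
  calc (S.card : ℝ) * E ≤ S.card * (D * A) := by gcongr
    _ = S.card * D * A := by ring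
    _ ≤ _ := by gcongr

lemma exists_measure_dim_eq_rate [ProperSpace X] (hp : T.Good p) :
    ∃ μ : Measure X, HasFullSupport μ ∧ measureAssouadDim μ = ENNReal.ofReal (T.rate p) := by
  obtain ⟨m, hm⟩ := exists_mass hp
  replace hm : T.IsMass p m := hm
  obtain ⟨μ, hμ⟩ := hm.exists_measure hp
  refine ⟨μ, ?_, le_antisymm ?_ ?_⟩
  · rintro U hU ⟨x, hx⟩
    obtain ⟨ε, hε, hsub⟩ := Metric.nhds_basis_closedBall.mem_iff.1 (hU.mem_nhds hx)
    obtain ⟨k, hk1, hk2⟩ := T.exists_scale hε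
    refine lt_of_lt_of_le ?_ ((hμ x k ε hk1 hk2).1.trans (measure_mono hsub))
    exact ENNReal.ofReal_pos.2 (mul_pos (pow_pos hp.1 3) (hm.1 _ _))
  · refine le_of_forall_gt_imp_ge_of_dense fun c hc ↦ ?_
    obtain ⟨b, hb0, hb1, hb2⟩ := ENNReal.lt_iff_exists_real_btwn.1 hc
    have hb : T.rate p < b := ((ENNReal.ofReal_lt_ofReal_iff').1 hb1).1
    have := adm_of_rate_lt hp hb
    exact le_trans (sInf_le ⟨b, this.1, rfl, (adm_iff hp hm hμ this.1).2 this⟩) hb2.le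
  · refine le_sInf ?_
    rintro _ ⟨α, hα, rfl, h⟩
    exact ENNReal.ofReal_le_ofReal ((adm_iff hp hm hμ hα).1 h).rate_le

end Measure

end NetTree

section Construction

variable {X : Type*} [MetricSpace X]

lemma exists_cover_of_coverNumber_le {x : X} {R r b : ℝ} (hb : 0 ≤ b)
    (h : (coverNumber x R r : ℝ≥0∞) ≤ ENNReal.ofReal b) :
    ∃ s : Finset X, (s.card : ℝ) ≤ b ∧ closedBall x R ⊆ ⋃ y ∈ s, closedBall y r := by
  set A := {n : ℕ∞ | ∃ s : Finset X, (s.card : ℕ∞) = n ∧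
    closedBall x R ⊆ ⋃ y ∈ s, closedBall y r} with hA
  have hne : A.Nonempty := by
    by_contra hne
    rw [not_nonempty_iff_eq_empty] at hne
    have h1 : coverNumber x R r = ⊤ := by
      rw [coverNumber, ← hA, hne, sInf_empty]
    rw [h1, ENat.toENNReal_top, top_le_iff] at h
    exact ENNReal.ofReal_ne_top h
  obtain ⟨s, hs, hcov⟩ : coverNumber x R r ∈ A := csInf_mem hne
  refine ⟨s, ?_, hcov⟩
  rw [← hs, ENat.toENNReal_coe, ← ENNReal.ofReal_natCast] at h
  exact (ENNReal.ofReal_le_ofReal_iff hb).1 h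

/-- Separated sets in a ball are controlled by the covering numbers at a third of the scale. -/
lemma ncard_separated_le {S : Set X} {ρ b R : ℝ} {x : X} (hρ : 0 < ρ)
    (hS : ∀ u ∈ S, ∀ v ∈ S, u ≠ v → ρ ≤ dist u v) {s : Finset X} (hs : (s.card : ℝ) ≤ b)
    (hcov : closedBall x R ⊆ ⋃ y ∈ s, closedBall y (ρ / 3)) :
    (S ∩ closedBall x R).Finite ∧ ((S ∩ closedBall x R).ncard : ℝ) ≤ b := by
  have h1 : ∀ u : X, ∃ y, u ∈ closedBall x R → y ∈ s ∧ dist u y ≤ ρ / 3 := fun u ↦ by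
    by_cases hu : u ∈ closedBall x R
    · obtain ⟨y, hy, huy⟩ := mem_iUnion₂.1 (hcov hu)
      exact ⟨y, fun _ ↦ ⟨hy, huy⟩⟩
    · exact ⟨u, fun h ↦ absurd h hu⟩
  choose f hf using h1
  have hmaps : MapsTo f (S ∩ closedBall x R) (s : Set X) := fun u hu ↦ (hf u hu.2).1
  have hinj : InjOn f (S ∩ closedBall x R) := fun u hu v hv huv ↦ by
    by_contra hne
    have h2 := hS u hu.1 v hv.1 hne
    have h3 := dist_triangle_right u v (f u)
    have h4 := (hf u hu.2).2
    have h5 := (hf v hv.2).2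
    rw [← huv] at h5
    linarith
  refine ⟨Finite.of_injOn hmaps hinj s.finite_toSet, le_trans ?_ hs⟩
  rw [← ncard_coe_finset s]
  exact_mod_cast ncard_le_ncard_of_injOn f hmaps hinj s.finite_toSet

/-- Every point belongs to a maximal separated set. -/
lemma exists_maximal_separated (x₀ : X) {ρ : ℝ} (hρ : 0 < ρ) :
    ∃ S : Set X, x₀ ∈ S ∧ (∀ u ∈ S, ∀ v ∈ S, u ≠ v → ρ ≤ dist u v) ∧
      ∀ x, ∃ u ∈ S, dist x u ≤ ρ := by
  obtain ⟨S, hsub, hmax⟩ := zorn_subset_nonempty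
    {S : Set X | ∀ u ∈ S, ∀ v ∈ S, u ≠ v → ρ ≤ dist u v}
    (fun c hc hchain _ ↦ ⟨⋃₀ c, fun u hu v hv huv ↦ by
      obtain ⟨a, ha, hua⟩ := hu
      obtain ⟨b, hb, hvb⟩ := hv
      rcases hchain.total ha hb with hab | hab
      · exact hc hb u (hab hua) v hvb huv
      · exact hc ha u hua v (hab hvb) huv, fun a ha ↦ subset_sUnion_of_mem ha⟩)
    {x₀} (fun u hu v hv huv ↦ absurd (hu.trans hv.symm) huv)
  refine ⟨S, hsub rfl, hmax.prop, fun x ↦ ?_⟩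
  by_contra! hx
  have hins : ∀ u ∈ insert x S, ∀ v ∈ insert x S, u ≠ v → ρ ≤ dist u v := by
    rintro u (rfl | hu) v (rfl | hv) huv
    · exact absurd rfl huv
    · exact (hx v hv).le
    · rw [dist_comm]; exact (hx u hu).le
    · exact hmax.prop u hu v hv huv
  have := hmax.eq_of_subset hins (subset_insert x S)
  have hxS : x ∈ S := by rw [this]; exact mem_insert x S
  have := hx x hxS
  rw [dist_self] at this
  linarith

/-- A space with polynomially bounded covering numbers carries nets of every small ratio. -/
lemma exists_netTree (x₀ : X) {α C : ℝ}
    (H : ∀ x : X, ∀ r R : ℝ, 0 < r → r < R →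
      ∃ s : Finset X, (s.card : ℝ) ≤ C * (R / r) ^ α ∧ closedBall x R ⊆ ⋃ y ∈ s, closedBall y r)
    {δ : ℝ} (hδ0 : 0 < δ) (hδ : δ ≤ 1 / 20) :
    ∃ T : NetTree X, T.δ = δ ∧ T.M = C * 3 ^ α / δ ^ α := by
  have hz : ∀ k : ℤ, 0 < δ ^ k := fun k ↦ zpow_pos hδ0 k
  choose N hx₀ hsep hnet using fun k : ℤ ↦ exists_maximal_separated x₀ (hz k)
  have hP : ∀ (k : ℤ) (x : X), ∃ u ∈ N k, dist x u ≤ δ ^ k ∧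
      ∀ v ∈ N k, dist x v < δ ^ k / 2 → u = v := fun k x ↦ by
    by_cases h : ∃ u ∈ N k, dist x u < δ ^ k / 2
    · obtain ⟨u, hu, hxu⟩ := h
      refine ⟨u, hu, by linarith [hz k], fun v hv hxv ↦ ?_⟩
      by_contra hne
      linarith [hsep k u hu v hv hne, dist_triangle_left u v x]
    · obtain ⟨u, hu, hxu⟩ := hnet k x
      exact ⟨u, hu, hxu, fun v hv hxv ↦ absurd ⟨v, hv, hxv⟩ h⟩
  choose P hPmem hPdist hPeq using hP
  have hcard : ∀ (k : ℤ) (x : X) (R : ℝ), δ ^ k ≤ R → (N k ∩ closedBall x R).Finite ∧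
      ((N k ∩ closedBall x R).ncard : ℝ) ≤ C * (R / (δ ^ k / 3)) ^ α := fun k x R hR ↦ by
    obtain ⟨s, hs, hcov⟩ := H x (δ ^ k / 3) R (by linarith [hz k]) (by linarith [hz k])
    exact ncard_separated_le (hz k) (hsep k) hs hcov
  refine ⟨{ δ := δ, N := N, P := P, x₀ := x₀, M := C * 3 ^ α / δ ^ α, K := C * 12 ^ α
            δ_pos := hδ0
            δ_le := hδ
            P_mem := hPmem
            dist_P := hPdist
            P_eq := hPeq
            x₀_mem := hx₀
            finite_inter := fun k x R ↦ ?_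
            ncard_children := fun k x ↦ ?_
            ncard_near := fun k x ↦ ?_ }, rfl, rfl⟩
  · exact (hcard k x _ (le_max_right R _)).1.subset
      (inter_subset_inter_right _ (closedBall_subset_closedBall (le_max_left _ _)))
  · refine (hcard k x _ (zpow_le_zpow_right_of_le_one₀ hδ0 (by linarith) (by lia))).2.trans_eq ?_
    rw [mul_div_assoc, ← Real.div_rpow (by norm_num) hδ0.le, zpow_sub_one₀ hδ0.ne']
    congr 2
    have := hz k
    field_simp
  · refine (hcard k x _ (by linarith [hz k])).2.trans_eq ?_
    congr 2
    have := hz k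
    field_simp
    norm_num

lemma properSpace_of_covers [CompleteSpace X]
    (H : ∀ x : X, ∀ r R : ℝ, 0 < r → r < R →
      ∃ s : Finset X, closedBall x R ⊆ ⋃ y ∈ s, closedBall y r) : ProperSpace X := by
  refine ⟨fun x R ↦ TotallyBounded.isCompact_of_isClosed ?_ isClosed_closedBall⟩
  refine Metric.totallyBounded_iff.2 fun ε hε ↦ ?_
  obtain ⟨s, hs⟩ := H x (ε / 2) (max R ε) (by linarith)
    (lt_of_lt_of_le (by linarith) (le_max_right _ _))
  refine ⟨s, s.finite_toSet, (closedBall_subset_closedBall (le_max_left _ _)).trans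
    (hs.trans (iUnion₂_mono fun y _ ↦ closedBall_subset_ball (by linarith)))⟩

end Construction

/-- **Theorem (Intermediate value property for the Assouad dimension of measures).**
If `X` is a complete metric space with `0 < dim_A X < ∞`, then for every real `s > dim_A X`
there is a Borel measure `μ` on `X` with support equal to `X` such that `dim_A μ = s`. -/
theorem assouadDim_intermediate_value (X : Type*) [MetricSpace X] [CompleteSpace X]
    [MeasurableSpace X] [BorelSpace X]
    (h0 : 0 < assouadDim X) (h1 : assouadDim X < ⊤)
    (s : ℝ) (hs : assouadDim X < ENNReal.ofReal s) :
    ∃ μ : MeasureTheory.Measure X, HasFullSupport μ ∧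
      measureAssouadDim μ = ENNReal.ofReal s := by
  have hne : Nonempty X := by
    by_contra hX
    rw [not_nonempty_iff] at hX
    have : assouadDim X ≤ ENNReal.ofReal 0 :=
      sInf_le ⟨0, le_rfl, rfl, 1, one_pos, fun x ↦ isEmptyElim x⟩
    rw [ENNReal.ofReal_zero] at this
    exact absurd h0 (not_lt.2 this)
  obtain ⟨x₀⟩ := hne
  obtain ⟨β, -, hβ0, hβ⟩ := ENNReal.lt_iff_exists_real_btwn.1 h0
  have hβpos : 0 < β := ENNReal.ofReal_pos.1 hβ0
  have hβs : β ≤ s := ((ENNReal.ofReal_lt_ofReal_iff').1 (hβ.trans hs)).1.le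
  obtain ⟨_, ⟨α, hα0, rfl, C, hC, hcov⟩, hαs⟩ := sInf_lt_iff.1 hs
  replace hαs : α < s := ((ENNReal.ofReal_lt_ofReal_iff').1 hαs).1
  have H : ∀ x : X, ∀ r R : ℝ, 0 < r → r < R → ∃ t : Finset X,
      (t.card : ℝ) ≤ C * (R / r) ^ α ∧ closedBall x R ⊆ ⋃ y ∈ t, closedBall y r :=
    fun x r R hr hrR ↦ exists_cover_of_coverNumber_le
      (mul_nonneg hC.le (Real.rpow_nonneg (div_pos (hr.trans hrR) hr).le _)) (hcov x r R hr hrR)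
  have hproper : ProperSpace X := properSpace_of_covers fun x r R hr hrR ↦
    (H x r R hr hrR).imp fun _ h ↦ h.2
  obtain ⟨δ, hδ, hδ0, hδM⟩ : ∃ δ : ℝ, δ ≤ 1 / 20 ∧ 0 < δ ∧
      C * 3 ^ α * δ ^ ((s - α) / 2) ≤ 1 / 2 := by
    have hlim : Tendsto (fun δ : ℝ ↦ C * 3 ^ α * δ ^ ((s - α) / 2)) (𝓝[>] 0) (𝓝 0) := by
      have h2 : ContinuousAt (fun δ : ℝ ↦ C * 3 ^ α * δ ^ ((s - α) / 2)) 0 :=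
        continuousAt_const.mul (Real.continuousAt_rpow_const _ _ (Or.inr (by linarith)))
      have h3 := h2.tendsto
      rw [Real.zero_rpow (by linarith), mul_zero] at h3
      exact h3.mono_left nhdsWithin_le_nhds
    obtain ⟨δ, h2, h3, h4⟩ := ((hlim.eventually_le_const (show (0 : ℝ) < 1 / 2 by norm_num)).and
      ((eventually_mem_nhdsWithin).and
        (nhdsWithin_le_nhds (Iic_mem_nhds (show (0 : ℝ) < 1 / 20 by norm_num))))).exists
    exact ⟨δ, h4, h3, h2⟩
  obtain ⟨T, hTδ, hTM⟩ := exists_netTree x₀ H hδ0 hδ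
  have hgood : T.Good (δ ^ ((α + s) / 2)) := by
    refine ⟨Real.rpow_pos_of_pos hδ0 _, le_of_eq_of_le ?_ hδM⟩
    rw [hTM, div_mul_eq_mul_div, mul_div_assoc, ← Real.rpow_sub hδ0]
    congr 2
    ring
  have hrate : T.rate (δ ^ ((α + s) / 2)) ≤ s :=
    (NetTree.adm_of_rpow_le hgood (α := (α + s) / 2) (by linarith) (by rw [hTδ])).rate_le.trans
      (by linarith)
  have hno : ∀ p, T.Good p → ¬ T.Adm p β := fun p hp hadm ↦ by
    obtain ⟨m, hm⟩ := NetTree.exists_mass hp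
    exact absurd hβ (not_lt.2 (hadm.assouadDim_le hp hm))
  obtain ⟨p, hp, hps⟩ := NetTree.exists_rate_eq hgood hβpos hβs hno hrate
  obtain ⟨μ, hμ, hdim⟩ := NetTree.exists_measure_dim_eq_rate hp
  exact ⟨μ, hμ, by rw [hdim, hps]⟩
end

section
/- Let X be a nonempty metric space such that N(x,2r,r) < ∞ for all x ∈ X and r > 0. Then for each 0 < δ < 1/7 there exist at most countable collections Q_k (k ∈ ℤ) of Borel subsets of X and a choice of a point x_Q ∈ X for every Q ∈ ⋃_k Q_k, with the following properties: (i) X = ⋃_{Q ∈ Q_k} Q for every k ∈ ℤ; (ii) if Q ∈ Q_k, Q' ∈ Q_{k'}, k' ≥ k and Q ∩ Q' ≠ ∅, then Q' ⊂ Q; (iii) for every Q ∈ Q_k, B(x_Q, δ^k/3) ⊂ Q ⊂ B(x_Q, 2δ^k); (iv) there exists a point x_0 ∈ ⋂_{k ∈ ℤ} {x_Q : Q ∈ Q_k}; (v) {x_Q : Q ∈ Q_k} ⊂ {x_Q : Q ∈ Q_{k+1}} for all k ∈ ℤ. -/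
open Metric MeasureTheory Set
open scoped ENNReal

/-- Two-sided recursive choice: a bi-infinite sequence can be built from a starting value when it
can be prolonged in both directions. -/
theorem exists_int_chain {α : Type*} (P : ℤ → α → Prop) (R : ℤ → α → α → Prop) {a₀ : α}
    (h₀ : P 0 a₀) (up : ∀ k a, P k a → ∃ b, P (k + 1) b ∧ R k a b)
    (down : ∀ k b, P (k + 1) b → ∃ a, P k a ∧ R k a b) :
    ∃ f : ℤ → α, (∀ k, P k (f k)) ∧ ∀ k, R k (f k) (f (k + 1)) := by
  choose! u hu using up
  choose! d hd using down
  let F : ℕ → α := fun n ↦ Nat.rec a₀ (fun n a ↦ u n a) n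
  let G : ℕ → α := fun n ↦ Nat.rec (d (-1) a₀) (fun n a ↦ d (-(n : ℤ) - 2) a) n
  have hF : ∀ n : ℕ, P n (F n) := by
    intro n
    induction n with
    | zero => exact h₀
    | succ n ih => exact (hu n (F n) ih).1
  have hG : ∀ n : ℕ, P (-(n : ℤ) - 1) (G n) := by
    intro n
    induction n with
    | zero => exact (hd (-1) a₀ (by simpa using h₀)).1
    | succ n ih =>
      have h := (hd (-(n : ℤ) - 2) (G n) (by convert ih using 1; ring)).1
      convert h using 1
      push_cast
      ring
  refine ⟨fun k ↦ Int.rec F G k, ?_, ?_⟩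
  · rintro (n | n)
    · exact hF n
    · convert hG n using 1
      rw [Int.negSucc_eq]
      ring
  · rintro (n | n)
    · exact (hu n (F n) (hF n)).2
    · cases n with
      | zero => exact (hd (-1) a₀ (by simpa using h₀)).2
      | succ n =>
        have h := (hd (-(n : ℤ) - 2) (G n) (by convert hG n using 1; ring)).2
        have e₁ : Int.negSucc (n + 1) = -(n : ℤ) - 2 := by
          rw [Int.negSucc_eq]; push_cast; ring
        have e₂ : Int.negSucc (n + 1) + 1 = Int.negSucc n := by
          rw [Int.negSucc_eq, Int.negSucc_eq]; push_cast; ring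
        rw [e₂]
        change R (Int.negSucc (n + 1)) (d (-(n : ℤ) - 2) (G n)) (G n)
        rw [e₁]
        exact h

section Nets

variable {X : Type*} [MetricSpace X]

theorem exists_finset_cover_of_coverNumber_lt_top {x : X} {R r : ℝ} (h : coverNumber x R r < ⊤) :
    ∃ s : Finset X, closedBall x R ⊆ ⋃ y ∈ s, closedBall y r := by
  obtain ⟨-, ⟨s, -, hs⟩, -⟩ := sInf_lt_iff.1 h
  exact ⟨s, hs⟩

theorem totallyBounded_closedBall_of_coverNumber
    (hN : ∀ x : X, ∀ r : ℝ, 0 < r → coverNumber x (2 * r) r < ⊤) (x : X) (r : ℝ) :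
    TotallyBounded (closedBall x r) := by
  have key : ∀ n : ℕ, ∀ y : X, ∀ ρ : ℝ, 0 < ρ →
      ∃ s : Set X, s.Finite ∧ closedBall y ρ ⊆ ⋃ z ∈ s, closedBall z (ρ / 2 ^ n) := by
    intro n
    induction n with
    | zero => exact fun y ρ _ ↦ ⟨{y}, finite_singleton y, by simp⟩
    | succ n ih =>
      intro y ρ hρ
      obtain ⟨s, hs⟩ := exists_finset_cover_of_coverNumber_lt_top (hN y (ρ / 2) (by positivity))
      rw [mul_div_cancel₀ _ two_ne_zero] at hs
      choose t htf ht using fun z ↦ ih z (ρ / 2) (by positivity)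
      refine ⟨⋃ z ∈ s, t z, s.finite_toSet.biUnion fun z _ ↦ htf z, fun w hw ↦ ?_⟩
      obtain ⟨z, hz, hwz⟩ := mem_iUnion₂.1 (hs hw)
      obtain ⟨v, hv, hwv⟩ := mem_iUnion₂.1 (ht z hwz)
      refine mem_iUnion₂.2 ⟨v, mem_iUnion₂.2 ⟨z, hz, hv⟩, ?_⟩
      rwa [div_div, ← pow_succ'] at hwv
  refine Metric.totallyBounded_iff.2 fun ε hε ↦ ?_
  have hρ : 0 < max r 1 := by positivity
  obtain ⟨n, hn⟩ := pow_unbounded_of_one_lt (max r 1 / ε) (one_lt_two (α := ℝ))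
  obtain ⟨s, hs, hcov⟩ := key n x (max r 1) hρ
  refine ⟨s, hs, (closedBall_subset_closedBall (le_max_left r 1)).trans (hcov.trans ?_)⟩
  refine iUnion₂_mono fun z _ ↦ closedBall_subset_ball ?_
  rw [div_lt_iff₀ (by positivity)]
  rwa [div_lt_iff₀ hε, mul_comm] at hn

theorem TotallyBounded.finite_of_pairwise_le_dist {A : Set X} (hA : TotallyBounded A) {s : ℝ}
    (hs : 0 < s) (hsep : A.Pairwise fun x y ↦ s ≤ dist x y) : A.Finite := by
  obtain ⟨t, ht, hcov⟩ := Metric.totallyBounded_iff.1 hA (s / 2) (by positivity)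
  have h : ∀ x ∈ A, ∃ z ∈ t, dist x z < s / 2 := fun x hx ↦ by simpa using hcov hx
  choose! f hft hf using h
  refine Set.Finite.of_finite_image (ht.subset (image_subset_iff.2 hft)) fun x hx y hy hxy ↦ ?_
  by_contra hne
  have h₁ := hsep hx hy hne
  have h₂ := dist_triangle_right x y (f x)
  have h₃ := hf x hx
  have h₄ := hf y hy
  rw [← hxy] at h₄
  linarith

/-- A separated subset of `B` extends to a maximal one, which is then a net in `B`. -/
theorem exists_separated_net {S B : Set X} (hSB : S ⊆ B) {s : ℝ} (hs : 0 < s)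
    (hS : S.Pairwise fun x y ↦ s ≤ dist x y) :
    ∃ A, S ⊆ A ∧ A ⊆ B ∧ (A.Pairwise fun x y ↦ s ≤ dist x y) ∧
      ∀ b ∈ B, ∃ a ∈ A, dist a b ≤ s := by
  obtain ⟨A, hSA, hA⟩ := zorn_subset_nonempty
    {A : Set X | A ⊆ B ∧ A.Pairwise fun x y ↦ s ≤ dist x y}
    (fun c hc hchain _ ↦ ⟨⋃₀ c, ⟨sUnion_subset fun t ht ↦ (hc ht).1,
      (pairwise_sUnion hchain.directedOn).2 fun t ht ↦ (hc ht).2⟩,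
      fun t ht ↦ subset_sUnion_of_mem ht⟩) S ⟨hSB, hS⟩
  refine ⟨A, hSA, hA.prop.1, hA.prop.2, fun b hb ↦ ?_⟩
  by_contra! hfar
  have hmem : b ∈ A := by
    refine hA.le_of_ge (y := insert b A) ⟨insert_subset hb hA.prop.1, ?_⟩ (subset_insert b A)
      (mem_insert b A)
    refine hA.prop.2.insert fun a ha _ ↦ ⟨?_, (hfar a ha).le⟩
    rw [dist_comm]
    exact (hfar a ha).le
  have h := hfar b hmem
  rw [dist_self] at h
  exact hs.not_gt h

/-- Nested nets at all scales `δ ^ k`, with a common point. -/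
theorem exists_nested_nets (x₀ : X) {δ : ℝ} (hδ0 : 0 < δ) (hδ1 : δ < 1 / 7) :
    ∃ A : ℤ → Set X, (∀ k, x₀ ∈ A k) ∧ (∀ k, A k ⊆ A (k + 1)) ∧
      (∀ k, (A k).Pairwise fun x y ↦ 4 / 3 * δ ^ k ≤ dist x y) ∧
      ∀ k y, ∃ a ∈ A k, dist a y ≤ 14 / 9 * δ ^ k := by
  have hpos : ∀ k : ℤ, 0 < δ ^ k := fun k ↦ zpow_pos hδ0 k
  have hsucc : ∀ k : ℤ, δ ^ (k + 1) ≤ δ ^ k / 7 := fun k ↦ by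
    rw [zpow_add_one₀ hδ0.ne']
    nlinarith [hpos k]
  have extend : ∀ k : ℤ, ∀ S : Set X, (S.Pairwise fun x y ↦ 4 / 3 * δ ^ k ≤ dist x y) →
      ∃ A, S ⊆ A ∧ (A.Pairwise fun x y ↦ 4 / 3 * δ ^ k ≤ dist x y) ∧
        ∀ y, ∃ a ∈ A, dist a y ≤ 14 / 9 * δ ^ k := by
    intro k S hS
    obtain ⟨A, hSA, -, hsep, hnet⟩ :=
      exists_separated_net (subset_univ S) (mul_pos (by norm_num) (hpos k)) hS
    refine ⟨A, hSA, hsep, fun y ↦ ?_⟩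
    obtain ⟨a, ha, hay⟩ := hnet y (mem_univ y)
    exact ⟨a, ha, by linarith [hpos k]⟩
  obtain ⟨A₀, hx₀, hsep₀, hnet₀⟩ := extend 0 {x₀} (pairwise_singleton _ _)
  obtain ⟨A, hA, hmono⟩ := exists_int_chain
    (fun k (A : Set X) ↦ x₀ ∈ A ∧ (A.Pairwise fun x y ↦ 4 / 3 * δ ^ k ≤ dist x y) ∧
      ∀ y, ∃ a ∈ A, dist a y ≤ 14 / 9 * δ ^ k)
    (fun _ A B ↦ A ⊆ B) (a₀ := A₀) ⟨singleton_subset_iff.1 hx₀, hsep₀, hnet₀⟩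
    (fun k A ⟨hx, hsep, _⟩ ↦ by
      obtain ⟨B, hAB, hsepB, hnetB⟩ := extend (k + 1) A fun x hxA y hyA hne ↦ by
        linarith [hsep hxA hyA hne, hsucc k, hpos k]
      exact ⟨B, ⟨hAB hx, hsepB, hnetB⟩, hAB⟩)
    (fun k B ⟨hx, _, hnetB⟩ ↦ by
      obtain ⟨A, hxA, hAB, hsep, hnet⟩ := exists_separated_net (singleton_subset_iff.2 hx)
        (mul_pos (by norm_num : (0 : ℝ) < 4 / 3) (hpos k)) (pairwise_singleton _ _)
      refine ⟨A, ⟨singleton_subset_iff.1 hxA, hsep, fun y ↦ ?_⟩, hAB⟩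
      obtain ⟨b, hb, hby⟩ := hnetB y
      obtain ⟨a, ha, hab⟩ := hnet b hb
      exact ⟨a, ha, by linarith [dist_triangle a b y, hsucc k]⟩)
  exact ⟨A, fun k ↦ (hA k).1, hmono, fun k ↦ (hA k).2.1, fun k ↦ (hA k).2.2⟩

end Nets

section Ancestors

variable {X : Type*}

/-- The ancestor in generation `k` of a point, obtained by passing through the generations
`k + n, k + n - 1, …, k` along the parent maps `p`. -/
def ancestor (p : ℤ → X → X) : ℕ → ℤ → X → X
  | 0, k => p k
  | n + 1, k => p k ∘ ancestor p n (k + 1)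

/-- The points near which `a` occurs as the ancestor in generation `k` of points of
arbitrarily high generation. -/
def closedTree [TopologicalSpace X] (p : ℤ → X → X) (k : ℤ) (a : X) : Set X :=
  {y | ∃ᶠ q : ℤ × X in Filter.atTop ×ˢ nhds y, ancestor p (q.1 - k).toNat k q.2 = a}

theorem ancestor_of_lt (p : ℤ → X → X) {k m : ℤ} (h : k < m) (z : X) :
    ancestor p (m - k).toNat k z = p k (ancestor p (m - (k + 1)).toNat (k + 1) z) := by
  have e : (m - k).toNat = (m - (k + 1)).toNat + 1 := by omega
  rw [e]
  rfl

theorem isClosed_closedTree [TopologicalSpace X] (p : ℤ → X → X) (k : ℤ) (a : X) :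
    IsClosed (closedTree p k a) := by
  rw [← isOpen_compl_iff, isOpen_iff_mem_nhds]
  intro y hy
  obtain ⟨pa, ha, pb, hb, h⟩ := Filter.eventually_prod_iff.1 (Filter.not_frequently.1 hy)
  filter_upwards [eventually_eventually_nhds.2 hb] with z hz
  exact Filter.not_frequently.2 (Filter.eventually_prod_iff.2 ⟨pa, ha, pb, hz, h⟩)

variable {p : ℤ → X → X} {A : ℤ → Set X} {δ : ℝ}

theorem ancestor_mem (hp : ∀ k y, p k y ∈ A k) (n : ℕ) (k : ℤ) (y : X) :
    ancestor p n k y ∈ A k := by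
  cases n with
  | zero => exact hp k y
  | succ n => exact hp k _

variable [MetricSpace X]

theorem dist_ancestor_le (hδ0 : 0 < δ) (hδ1 : δ < 1 / 7)
    (hp : ∀ k y, dist (p k y) y ≤ 14 / 9 * δ ^ k) (n : ℕ) (k : ℤ) (y : X) :
    dist (ancestor p n k y) y ≤ 11 / 6 * δ ^ k := by
  induction n generalizing k with
  | zero => exact (hp k y).trans (by linarith [zpow_pos hδ0 k])
  | succ n ih =>
    have h₁ := hp k (ancestor p n (k + 1) y)
    have h₂ := ih (k + 1)
    have h₃ := dist_triangle (ancestor p (n + 1) k y) (ancestor p n (k + 1) y) y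
    have h₄ := zpow_pos hδ0 k
    rw [zpow_add_one₀ hδ0.ne'] at h₂
    change dist (ancestor p (n + 1) k y) _ ≤ _ at h₁
    nlinarith

theorem closedTree_subset_closedBall (hδ0 : 0 < δ) (hδ1 : δ < 1 / 7)
    (hp : ∀ k y, dist (p k y) y ≤ 14 / 9 * δ ^ k) (k : ℤ) (a : X) :
    closedTree p k a ⊆ closedBall a (2 * δ ^ k) := by
  intro y hy
  have hε : 0 < 1 / 6 * δ ^ k := mul_pos (by norm_num) (zpow_pos hδ0 k)
  obtain ⟨⟨m, z⟩, h, hz⟩ :=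
    (hy.and_eventually (Filter.tendsto_snd.eventually (ball_mem_nhds y hε))).exists
  have h₁ := dist_ancestor_le hδ0 hδ1 hp (m - k).toNat k z
  have h₂ : dist z y < 1 / 6 * δ ^ k := hz
  have h₃ := dist_triangle_left y a z
  dsimp only at h
  rw [h, dist_comm] at h₁
  rw [mem_closedBall]
  linarith

/-- The ancestors in generation `k` of the points near `y` lie in a finite set, so a property
satisfied by these ancestors frequently is satisfied by one that occurs frequently. -/
theorem exists_mem_closedTree (hδ0 : 0 < δ) (hδ1 : δ < 1 / 7)
    (hfin : ∀ k y r, (A k ∩ closedBall y r).Finite) (hpA : ∀ k y, p k y ∈ A k)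
    (hp : ∀ k y, dist (p k y) y ≤ 14 / 9 * δ ^ k) {k : ℤ} {y : X} {Φ : X → Prop}
    (h : ∃ᶠ q : ℤ × X in Filter.atTop ×ˢ nhds y, Φ (ancestor p (q.1 - k).toNat k q.2)) :
    ∃ b ∈ A k, Φ b ∧ y ∈ closedTree p k b := by
  have hnear : ∀ᶠ q : ℤ × X in Filter.atTop ×ˢ nhds y, dist q.2 y < 1 :=
    Filter.tendsto_snd.eventually (ball_mem_nhds y one_pos)
  have hfreq : ∃ᶠ q : ℤ × X in Filter.atTop ×ˢ nhds y,
      ∃ b ∈ A k ∩ closedBall y (11 / 6 * δ ^ k + 1),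
        Φ b ∧ ancestor p (q.1 - k).toNat k q.2 = b := by
    refine (h.and_eventually hnear).mono fun q ⟨hq, hqy⟩ ↦
      ⟨_, ⟨ancestor_mem hpA _ _ _, ?_⟩, hq, rfl⟩
    rw [mem_closedBall]
    linarith [dist_ancestor_le hδ0 hδ1 hp (q.1 - k).toNat k q.2,
      dist_triangle (ancestor p (q.1 - k).toNat k q.2) q.2 y]
  obtain ⟨b, hb, hfb⟩ := (Filter.frequently_exists_finite (hfin _ _ _)).1 hfreq
  obtain ⟨-, hΦ, -⟩ := hfb.exists
  exact ⟨b, hb.1, hΦ, hfb.mono fun _ hq ↦ hq.2⟩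

theorem exists_child_mem_closedTree (hδ0 : 0 < δ) (hδ1 : δ < 1 / 7)
    (hfin : ∀ k y r, (A k ∩ closedBall y r).Finite) (hpA : ∀ k y, p k y ∈ A k)
    (hp : ∀ k y, dist (p k y) y ≤ 14 / 9 * δ ^ k) {k : ℤ} {a y : X}
    (h : y ∈ closedTree p k a) :
    ∃ b ∈ A (k + 1), p k b = a ∧ y ∈ closedTree p (k + 1) b := by
  refine exists_mem_closedTree hδ0 hδ1 hfin hpA hp ?_
  refine (h.and_eventually
    (Filter.tendsto_fst.eventually (Filter.eventually_gt_atTop k))).mono fun q ⟨hq, hlt⟩ ↦ ?_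
  rwa [ancestor_of_lt p hlt] at hq

theorem mem_closedTree_parent {k : ℤ} {b y : X} (h : y ∈ closedTree p (k + 1) b) :
    y ∈ closedTree p k (p k b) := by
  refine (h.and_eventually
    (Filter.tendsto_fst.eventually (Filter.eventually_gt_atTop k))).mono fun q ⟨hq, hlt⟩ ↦ ?_
  rw [ancestor_of_lt p hlt, hq]

theorem eq_of_mem_closedTree_of_dist_le (hδ0 : 0 < δ) (hδ1 : δ < 1 / 7)
    (hp : ∀ k y, dist (p k y) y ≤ 14 / 9 * δ ^ k)
    (hpn : ∀ k y, ∀ x ∈ A k, dist x y < 2 / 3 * δ ^ k → p k y = x) {k : ℤ} {a x y : X}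
    (hx : x ∈ A k) (hxy : dist y x ≤ δ ^ k / 3) (h : y ∈ closedTree p k a) : a = x := by
  have hε : 0 < 1 / 42 * δ ^ k := mul_pos (by norm_num) (zpow_pos hδ0 k)
  obtain ⟨⟨m, z⟩, ⟨h, hz⟩, hlt⟩ :=
    ((h.and_eventually (Filter.tendsto_snd.eventually (ball_mem_nhds y hε))).and_eventually
      (Filter.tendsto_fst.eventually (Filter.eventually_gt_atTop k))).exists
  dsimp only at h hlt
  rw [ancestor_of_lt p hlt] at h
  rw [← h]
  refine hpn _ _ _ hx ?_
  have h₁ := dist_ancestor_le hδ0 hδ1 hp (m - (k + 1)).toNat (k + 1) z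
  rw [zpow_add_one₀ hδ0.ne'] at h₁
  have h₂ : dist z y < 1 / 42 * δ ^ k := hz
  have h₃ := dist_triangle_left x z y
  have h₄ := dist_triangle_right x (ancestor p (m - (k + 1)).toNat (k + 1) z) z
  rw [dist_comm y z] at h₃
  nlinarith [zpow_pos hδ0 k]

end Ancestors

/-- Simultaneous measurable choice from the countable subfamilies of a countable family of
measurable sets. -/
theorem exists_measurable_choice {X : Type*} [MeasurableSpace X] {D : Set X} (hD : D.Countable)
    {C : X → Set X} (hC : ∀ a, MeasurableSet (C a)) :
    ∃ σ : Set X → X → X, ∀ S ⊆ D,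
      (∀ y, (∃ b ∈ S, y ∈ C b) → σ S y ∈ S ∧ y ∈ C (σ S y)) ∧
      ∀ b, MeasurableSet {y | (∃ b ∈ S, y ∈ C b) ∧ σ S y = b} := by
  obtain ⟨e, he⟩ := countable_iff_exists_injOn.1 hD
  have hmin : ∀ (S : Set X) (y : X), (∃ b ∈ S, y ∈ C b) →
      ∃ b, (b ∈ S ∧ y ∈ C b) ∧ ∀ b' ∈ S, y ∈ C b' → e b ≤ e b' := by
    intro S y hy
    obtain ⟨b, hb, hle⟩ := (measure e).wf.has_min {b | b ∈ S ∧ y ∈ C b} hy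
    exact ⟨b, hb, fun b' hb' hy' ↦ not_lt.1 (hle b' ⟨hb', hy'⟩)⟩
  choose! σ hσ hle using hmin
  refine ⟨σ, fun S hS ↦ ⟨hσ S, fun b ↦ ?_⟩⟩
  by_cases hb : b ∈ S
  · have heq : {y | (∃ b ∈ S, y ∈ C b) ∧ σ S y = b} =
        C b \ ⋃ b' ∈ {b' ∈ S | e b' < e b}, C b' := by
      ext y
      simp only [mem_ofPred_eq, mem_sdiff, mem_iUnion, not_exists]
      constructor
      · rintro ⟨hy, rfl⟩
        exact ⟨(hσ S y hy).2, fun b' ⟨hb', hlt⟩ hyb' ↦ (hle S y hy b' hb' hyb').not_gt hlt⟩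
      · rintro ⟨hyb, hno⟩
        have hy : ∃ b ∈ S, y ∈ C b := ⟨b, hb, hyb⟩
        refine ⟨hy, he (hS (hσ S y hy).1) (hS hb) (le_antisymm (hle S y hy b hb hyb) ?_)⟩
        by_contra! hlt
        exact hno _ ⟨(hσ S y hy).1, hlt⟩ (hσ S y hy).2
    rw [heq]
    exact (hC b).diff (.biUnion ((hD.mono hS).mono (sep_subset _ _)) fun b' _ ↦ hC b')
  · convert MeasurableSet.empty
    refine eq_empty_of_forall_notMem ?_
    rintro y ⟨hy, rfl⟩
    exact hb (hσ S y hy).1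

/-- Given countable sets `A k`, parent maps `p k : A (k + 1) → A k` and measurable sets `C k a`
such that every point of `C k a` belongs to `C (k + 1) b` for a child `b` of `a`, there is a
consistent measurable way of selecting for each `y` and `k` an `a ∈ A k` with `y ∈ C k a`. -/
theorem exists_consistent_selection {X : Type*} [MeasurableSpace X] {A : ℤ → Set X}
    (hA : ∀ k, (A k).Countable) {p : ℤ → X → X} (hpA : ∀ k y, p k y ∈ A k)
    {C : ℤ → X → Set X} (hC : ∀ k a, MeasurableSet (C k a)) (hcov : ∀ y, ∃ a ∈ A 0, y ∈ C 0 a)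
    (hchild : ∀ k a, ∀ y ∈ C k a, ∃ b ∈ A (k + 1), p k b = a ∧ y ∈ C (k + 1) b)
    (hparent : ∀ k b, C (k + 1) b ⊆ C k (p k b)) :
    ∃ φ : ℤ → X → X, (∀ k y, φ k y ∈ A k) ∧ (∀ k y, y ∈ C k (φ k y)) ∧
      (∀ k a, MeasurableSet (φ k ⁻¹' {a})) ∧ ∀ k y, φ k y = p k (φ (k + 1) y) := by
  choose σ hσ using fun k ↦ exists_measurable_choice (hA k) (hC k)
  refine (exists_int_chain
    (fun k (φ : X → X) ↦ (∀ y, φ y ∈ A k) ∧ (∀ y, y ∈ C k (φ y)) ∧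
      ∀ a, MeasurableSet (φ ⁻¹' {a}))
    (fun k φ ψ ↦ ∀ y, φ y = p k (ψ y)) (a₀ := σ 0 (A 0)) ?init ?up ?down).imp
    fun φ ⟨hφ, hφp⟩ ↦
      ⟨fun k ↦ (hφ k).1, fun k ↦ (hφ k).2.1, fun k ↦ (hφ k).2.2, hφp⟩
  case init =>
    have h := hσ 0 (A 0) Subset.rfl
    refine ⟨fun y ↦ (h.1 y (hcov y)).1, fun y ↦ (h.1 y (hcov y)).2, fun a ↦ ?_⟩
    convert h.2 a using 1
    ext y
    simpa using fun _ ↦ hcov y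
  case up =>
    rintro k φ ⟨-, hφC, hφm⟩
    have hsub : ∀ a, {b ∈ A (k + 1) | p k b = a} ⊆ A (k + 1) := fun a ↦ sep_subset _ _
    have hex : ∀ y, ∃ b ∈ {b ∈ A (k + 1) | p k b = φ y}, y ∈ C (k + 1) b := fun y ↦ by
      obtain ⟨b, hb, hpb, hy⟩ := hchild k _ y (hφC y)
      exact ⟨b, ⟨hb, hpb⟩, hy⟩
    have h := fun y ↦ (hσ (k + 1) _ (hsub (φ y))).1 y (hex y)
    refine ⟨fun y ↦ σ (k + 1) {b ∈ A (k + 1) | p k b = φ y} y,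
      ⟨fun y ↦ (h y).1.1, fun y ↦ (h y).2, fun b ↦ ?_⟩, fun y ↦ (h y).1.2.symm⟩
    convert (hφm (p k b)).inter ((hσ (k + 1) _ (hsub (p k b))).2 b) using 1
    ext y
    constructor
    · intro hy
      have hyb : φ y = p k b := by
        rw [← (h y).1.2]
        exact congrArg (p k) hy
      refine ⟨hyb, ?_⟩
      rw [← hyb]
      exact ⟨hex y, hy⟩
    · rintro ⟨hyb, -, hy⟩
      rw [← show φ y = p k b from hyb] at hy
      exact hy
  case down =>
    rintro k ψ ⟨hψA, hψC, hψm⟩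
    refine ⟨p k ∘ ψ, ⟨fun y ↦ hpA k _, fun y ↦ hparent k _ (hψC y), fun a ↦ ?_⟩, fun y ↦ rfl⟩
    have heq : p k ∘ ψ ⁻¹' {a} = ⋃ b ∈ {b ∈ A (k + 1) | p k b = a}, ψ ⁻¹' {b} := by
      ext y
      simp [hψA]
    rw [heq]
    exact .biUnion ((hA (k + 1)).mono (sep_subset _ _)) fun b _ ↦ hψm b

/-- **Theorem (existence of generalized nested cubes, Käenmäki–Rajala–Suomala).**
If `X` is a nonempty metric space in which `N(x, 2r, r) < ∞` for all `x` and `r > 0`, then for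
every `0 < δ < 1/7` there is a `δ`-adic cube system on `X`, i.e. at most countable collections
`Q_k` (`k ∈ ℤ`) of Borel sets with centers satisfying properties (i)–(v). -/
theorem exists_cubeSystem (X : Type*) [MetricSpace X] [MeasurableSpace X] [BorelSpace X]
    [Nonempty X] (hN : ∀ x : X, ∀ r : ℝ, 0 < r → coverNumber x (2 * r) r < ⊤)
    (δ : ℝ) (hδ0 : 0 < δ) (hδ1 : δ < 1 / 7) :
    Nonempty (CubeSystem X δ) := by
  obtain ⟨x₀⟩ := ‹Nonempty X›
  obtain ⟨A, hx₀, hmono, hsep, hnet⟩ := exists_nested_nets x₀ hδ0 hδ1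
  have hpos : ∀ k : ℤ, 0 < δ ^ k := fun k ↦ zpow_pos hδ0 k
  have hfin : ∀ k y r, (A k ∩ closedBall y r).Finite := fun k y r ↦
    ((totallyBounded_closedBall_of_coverNumber hN y r).subset
      inter_subset_right).finite_of_pairwise_le_dist (mul_pos (by norm_num) (hpos k))
      ((hsep k).mono inter_subset_left)
  have hcount : ∀ k, (A k).Countable := fun k ↦ by
    rw [← inter_univ (A k), ← iUnion_closedBall_nat x₀, inter_iUnion]
    exact countable_iUnion fun n ↦ (hfin k x₀ n).countable
  have hparent : ∀ k y, ∃ a ∈ A k, dist a y ≤ 14 / 9 * δ ^ k ∧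
      ∀ x ∈ A k, dist x y < 2 / 3 * δ ^ k → a = x := by
    intro k y
    by_cases h : ∃ a ∈ A k, dist a y < 2 / 3 * δ ^ k
    · obtain ⟨a, ha, hay⟩ := h
      refine ⟨a, ha, by linarith [hpos k], fun x hx hxy ↦ ?_⟩
      by_contra hne
      linarith [hsep k ha hx hne, dist_triangle_right a x y]
    · obtain ⟨a, ha, hay⟩ := hnet k y
      exact ⟨a, ha, hay, fun x hx hxy ↦ absurd ⟨x, hx, hxy⟩ h⟩
  choose p hpA hp hpn using hparent
  obtain ⟨φ, hφA, hφC, hφm, hφp⟩ := exists_consistent_selection hcount hpA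
    (C := closedTree p) (fun k a ↦ (isClosed_closedTree p k a).measurableSet)
    (fun y ↦ by
      obtain ⟨b, hb, -, hy⟩ := exists_mem_closedTree hδ0 hδ1 hfin hpA hp (k := 0) (y := y)
        (Φ := fun _ ↦ True) (Filter.Eventually.frequently (.of_forall fun _ ↦ trivial))
      exact ⟨b, hb, hy⟩)
    (fun k a y hy ↦ exists_child_mem_closedTree hδ0 hδ1 hfin hpA hp hy)
    (fun k b y hy ↦ mem_closedTree_parent hy)
  have hball : ∀ k, ∀ a ∈ A k, closedBall a (δ ^ k / 3) ⊆ φ k ⁻¹' {a} := fun k a ha y hy ↦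
    eq_of_mem_closedTree_of_dist_le hδ0 hδ1 hp hpn ha hy (hφC k y)
  have hfix : ∀ k, ∀ a ∈ A k, φ k a = a := fun k a ha ↦
    hball k a ha (mem_closedBall_self (by linarith [hpos k]))
  have hcoarse : ∀ {k k' : ℤ}, k ≤ k' → ∀ y z, φ k' y = φ k' z → φ k y = φ k z := by
    intro k k' hk y z
    induction k', hk using Int.leInduction with
    | base => exact id
    | succ n _ ih => exact fun h ↦ ih (by rw [hφp, hφp n z, h])
  let cubes : ℤ → Set (Set X) := fun k ↦ (fun a ↦ φ k ⁻¹' {a}) '' A k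
  let center : ℤ → Set X → X := fun k Q ↦ φ k (Classical.epsilon fun y ↦ y ∈ Q)
  have hcenter : ∀ k, ∀ a ∈ A k, center k (φ k ⁻¹' {a}) = a := fun k a ha ↦
    Classical.epsilon_spec (p := fun y ↦ y ∈ φ k ⁻¹' {a}) ⟨a, hfix k a ha⟩
  have hcenters : ∀ k, center k '' cubes k = A k := fun k ↦ by
    rw [image_image, image_congr (hcenter k), image_id']
  exact ⟨{
    cubes := cubes
    center := center
    countable := fun k ↦ (hcount k).image _
    borel := by
      rintro k - ⟨a, -, rfl⟩
      exact hφm k a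
    covers := fun k ↦ eq_univ_of_forall fun y ↦ ⟨_, ⟨φ k y, hφA k y, rfl⟩, rfl⟩
    nested := by
      rintro k k' hk - ⟨a, -, rfl⟩ - ⟨a', -, rfl⟩ ⟨y, hy, hy'⟩ z hz
      exact (hcoarse hk z y (hz.trans hy'.symm)).trans hy
    ball_subset := by
      rintro k - ⟨a, ha, rfl⟩
      rw [hcenter k a ha]
      exact hball k a ha
    subset_ball := by
      rintro k - ⟨a, ha, rfl⟩ y hy
      rw [hcenter k a ha]
      have h := hφC k y
      rw [show φ k y = a from hy] at h
      exact closedTree_subset_closedBall hδ0 hδ1 hp k a h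
    origin := ⟨x₀, fun k ↦ by rw [hcenters]; exact hx₀ k⟩
    centers_nested := fun k ↦ by rw [hcenters, hcenters]; exact hmono k }⟩
end

section
/- Let X be a nonempty complete metric space with dim_A X < ∞. Then for every t > dim_A X there exist 0 < δ < 1/7, a δ-adic cube system on X, a number 0 < p < 1/M, and a Borel regular measure μ_p on X with support X which is adapted to p (i.e. satisfies the mass distribution rule μ_p(Q') = p·μ_p(Q) for boundary children Q' of Q and μ_p(Q') = (1-(M_Q-1)p)·μ_p(Q) for the central child), such that dim_A μ_p < t. -/
open Metric MeasureTheory Set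
open scoped ENNReal

/-- The covering numbers of `X` satisfy `N(x,R,r) ≤ C (R/r)^α`. -/
def CoverBound (X : Type*) [MetricSpace X] (C α : ℝ) : Prop :=
  ∀ x : X, ∀ r R : ℝ, 0 < r → r < R →
    (coverNumber x R r : ℝ≥0∞) ≤ ENNReal.ofReal (C * (R / r) ^ α)

namespace CoverBound

variable {X : Type*} [MetricSpace X] {C α : ℝ}

theorem card_le (H : CoverBound X C α) (hC : 0 ≤ C) {x : X} {r R : ℝ} (hr : 0 < r) (hrR : r < R)
    (s : Finset X) (hs : ∀ y ∈ s, dist y x ≤ R)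
    (sep : ∀ y ∈ s, ∀ z ∈ s, y ≠ z → 2 * r < dist y z) :
    (s.card : ℝ) ≤ C * (R / r) ^ α := by
  have h1 : (s.card : ℕ∞) ≤ coverNumber x R r := by
    refine le_sInf ?_
    rintro _ ⟨t, rfl, ht⟩
    have h2 : ∀ y ∈ s, ∃ z ∈ t, dist y z ≤ r := fun y hy => by
      simpa using ht (mem_closedBall.2 (hs y hy))
    choose! f hft hf using h2
    have h3 : s.card ≤ t.card := by
      refine Finset.card_le_card_of_injOn f hft fun y hy z hz hyz => ?_
      by_contra hne
      have h4 := sep y hy z hz hne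
      have h5 := dist_triangle_right y z (f y)
      have h6 := hf z hz
      rw [← hyz] at h6
      linarith [hf y hy]
    exact_mod_cast h3
  have h2 : ((s.card : ℕ∞) : ℝ≥0∞) ≤ ENNReal.ofReal (C * (R / r) ^ α) :=
    (ENat.toENNReal_mono h1).trans (H x r R hr hrR)
  have hnn : 0 ≤ C * (R / r) ^ α :=
    mul_nonneg hC (Real.rpow_nonneg (div_nonneg (hr.le.trans hrR.le) hr.le) _)
  rw [ENat.toENNReal_coe, ← ENNReal.ofReal_natCast] at h2
  exact (ENNReal.ofReal_le_ofReal_iff hnn).1 h2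

theorem finite_of_separated (H : CoverBound X C α) (hC : 0 ≤ C) {A : Set X} {ε : ℝ} (hε : 0 < ε)
    (sep : ∀ y ∈ A, ∀ z ∈ A, y ≠ z → ε ≤ dist y z) (x : X) (R : ℝ) :
    {y ∈ A | dist y x ≤ R}.Finite := by
  by_contra hinf
  obtain ⟨N, hN⟩ := exists_nat_gt (C * (max R ε / (ε / 3)) ^ α)
  obtain ⟨s, hs, hcard⟩ := Set.Infinite.exists_subset_card_eq hinf N
  have h := H.card_le hC (x := x) (r := ε / 3) (R := max R ε) (by positivity)
    (by linarith [le_max_right R ε]) s (fun y hy => (hs hy).2.trans (le_max_left _ _))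
    (fun y hy z hz hyz => by linarith [sep y (hs hy).1 z (hs hz).1 hyz])
  rw [hcard] at h
  linarith

theorem isCompact_closedBall (H : CoverBound X C α) [CompleteSpace X] (x : X) (R : ℝ) :
    IsCompact (closedBall x R) := by
  rcases le_or_gt R 0 with hR | hR
  · rcases hR.lt_or_eq with hR | rfl
    · simp [closedBall_eq_empty.2 hR]
    · simp
  refine isCompact_iff_totallyBounded_isComplete.2 ⟨?_, isClosed_closedBall.isComplete⟩
  refine Metric.totallyBounded_iff.2 fun ε hε => ?_
  have hr : 0 < min ε R / 2 := by positivity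
  have hle : min ε R / 2 < R := by linarith [min_le_right ε R]
  have h : (coverNumber x R (min ε R / 2) : ℝ≥0∞) ≠ ⊤ :=
    ne_top_of_le_ne_top ENNReal.ofReal_ne_top (H x _ R hr hle)
  have h' : coverNumber x R (min ε R / 2) ≠ ⊤ := fun h0 => h (by simp [h0])
  obtain ⟨n, ⟨t, -, ht⟩, -⟩ := sInf_lt_iff.1 (lt_top_iff_ne_top.2 h')
  refine ⟨t, t.finite_toSet, ht.trans ?_⟩
  refine iUnion₂_mono fun y _ => closedBall_subset_ball ?_
  have : 0 < min ε R := by positivity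
  linarith [min_le_left ε R]

end CoverBound

/-- A relation that can be followed forwards and backwards along `ℤ` has a two-sided orbit. -/
theorem exists_int_orbit {β : Type*} (P : ℤ → β → Prop) (r : ℤ → β → β → Prop)
    (start : ∃ b, P 0 b) (fwd : ∀ k b, P k b → ∃ b', P (k + 1) b' ∧ r k b b')
    (bwd : ∀ k b', P (k + 1) b' → ∃ b, P k b ∧ r k b b') :
    ∃ F : ℤ → β, (∀ k, P k (F k)) ∧ ∀ k, r k (F k) (F (k + 1)) := by
  obtain ⟨b₀, hb₀⟩ := start
  choose! f hf using fwd
  choose! g hg using bwd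
  let u : ℕ → β := fun n => Nat.rec b₀ (fun n b => f n b) n
  let v : ℕ → β := fun n => Nat.rec b₀ (fun n b => g (-(n : ℤ) - 1) b) n
  have hu : ∀ n : ℕ, P n (u n) := fun n => by
    induction n with
    | zero => exact_mod_cast hb₀
    | succ n ih => exact_mod_cast (hf n _ ih).1
  have hv : ∀ n : ℕ, P (-(n : ℤ)) (v n) := fun n => by
    induction n with
    | zero => exact hb₀
    | succ n ih =>
      have := (hg (-(n : ℤ) - 1) (v n) (by simpa using ih)).1
      rw [show -((n + 1 : ℕ) : ℤ) = -(n : ℤ) - 1 by push_cast; ring]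
      exact this
  refine ⟨fun k => if 0 ≤ k then u k.toNat else v (-k).toNat, fun k => ?_, fun k => ?_⟩
  · dsimp only
    split_ifs with hk
    · have := hu k.toNat
      rwa [Int.toNat_of_nonneg hk] at this
    · have := hv (-k).toNat
      rwa [Int.toNat_of_nonneg (by omega), neg_neg] at this
  · rcases le_or_gt 0 k with hk | hk
    · obtain ⟨n, rfl⟩ := Int.eq_ofNat_of_zero_le hk
      have h1 : ((n : ℤ) + 1).toNat = n + 1 := by omega
      simp only [hk, if_true, show (0 : ℤ) ≤ n + 1 by omega, h1, Int.toNat_natCast]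
      exact (hf n _ (hu n)).2
    · obtain ⟨n, rfl⟩ : ∃ n : ℕ, k = -(n : ℤ) - 1 := ⟨(-k - 1).toNat, by omega⟩
      have h1 : (-(-(n : ℤ) - 1)).toNat = n + 1 := by omega
      have h2 : (if 0 ≤ -(n : ℤ) - 1 + 1 then u (-(n : ℤ) - 1 + 1).toNat
          else v (-(-(n : ℤ) - 1 + 1)).toNat) = v n := by
        rcases Nat.eq_zero_or_pos n with rfl | hn
        · simp [u, v]
        · rw [if_neg (by omega)]
          congr 1
          omega
      simp only [h2, h1, if_neg (show ¬ (0 ≤ -(n : ℤ) - 1) by omega)]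
      exact (hg (-(n : ℤ) - 1) (v n) (by simpa using hv n)).2

/-- Nested `δ^k`-separated sets, each level being linked to the previous one by a parent map. -/
structure NestedNet (X : Type*) [MetricSpace X] (δ : ℝ) where
  N : ℤ → Set X
  par : ℤ → X → X
  root : X
  root_mem : ∀ k, root ∈ N k
  mono : ∀ k, N k ⊆ N (k + 1)
  sep : ∀ k, ∀ x ∈ N k, ∀ y ∈ N k, x ≠ y → δ ^ k ≤ dist x y
  par_mem : ∀ k, ∀ y ∈ N (k + 1), par k y ∈ N k
  dist_par : ∀ k, ∀ y ∈ N (k + 1), dist y (par k y) ≤ δ ^ k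
  par_eq : ∀ k, ∀ y ∈ N (k + 1), ∀ z ∈ N k, dist y z < δ ^ k / 2 → par k y = z
  dense : ∀ x : X, ∀ ε > 0, ∃ k, ∃ y ∈ N k, dist x y < ε

theorem NestedNet.exists_of_root {X : Type*} [MetricSpace X] {δ : ℝ} (h0 : 0 < δ) (h1 : δ < 1)
    (x₀ : X) : Nonempty (NestedNet X δ) := by
  have hpos : ∀ k : ℤ, 0 < δ ^ k := fun k => zpow_pos h0 k
  let 𝒮 : Set (Set (ℤ × X)) := {S | (∀ k x, (k, x) ∈ S → (k + 1, x) ∈ S) ∧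
    ∀ k x y, (k, x) ∈ S → (k, y) ∈ S → x ≠ y → δ ^ k ≤ dist x y}
  obtain ⟨S, hbase, hS⟩ := zorn_subset_nonempty 𝒮 (by
    intro c hc hchain _
    refine ⟨⋃₀ c, ⟨?_, ?_⟩, fun s hs => subset_sUnion_of_mem hs⟩
    · rintro k x ⟨s, hs, hx⟩
      exact ⟨s, hs, (hc hs).1 _ _ hx⟩
    · rintro k x y ⟨s, hs, hx⟩ ⟨s', hs', hy⟩ hxy
      rcases hchain.total hs hs' with h | h
      · exact (hc hs').2 k x y (h hx) hy hxy
      · exact (hc hs).2 k x y hx (h hy) hxy) {q | q.2 = x₀} (by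
    refine ⟨fun k x hx => hx, fun k x y hx hy hxy => absurd ?_ hxy⟩
    exact (show x = x₀ from hx).trans (show y = x₀ from hy).symm)
  have hup : ∀ k x, (k, x) ∈ S → (k + 1, x) ∈ S := hS.prop.1
  have hsep : ∀ k x y, (k, x) ∈ S → (k, y) ∈ S → x ≠ y → δ ^ k ≤ dist x y := hS.prop.2
  have hnet : ∀ k y, (k + 1, y) ∈ S → ∃ z, (k, z) ∈ S ∧ dist y z < δ ^ k := by
    intro k y hy
    by_contra! hcon
    have hins : insert (k, y) S ∈ 𝒮 := by
      refine ⟨?_, ?_⟩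
      · rintro j x (hx | hx)
        · obtain ⟨rfl, rfl⟩ := Prod.mk.inj hx
          exact Or.inr hy
        · exact Or.inr (hup _ _ hx)
      · rintro j x z (hx | hx) (hz | hz) hxz
        · exact absurd ((Prod.mk.inj hx).2.trans (Prod.mk.inj hz).2.symm) hxz
        · obtain ⟨rfl, rfl⟩ := Prod.mk.inj hx
          exact hcon z hz
        · obtain ⟨rfl, rfl⟩ := Prod.mk.inj hz
          rw [dist_comm]
          exact hcon x hx
        · exact hsep _ _ _ hx hz hxz
    have hmem : (k, y) ∈ S := hS.le_of_ge hins (subset_insert _ _) (mem_insert _ _)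
    have := hcon y hmem
    rw [dist_self] at this
    exact absurd this (not_le.2 (hpos k))
  have hdense : ∀ x : X, ∀ ε > 0, ∃ k y, (k, y) ∈ S ∧ dist x y < ε := by
    intro x ε hε
    by_contra! hcon
    obtain ⟨j₀, hj₀⟩ := exists_pow_lt_of_lt_one hε h1
    have hins : S ∪ {q | (j₀ : ℤ) ≤ q.1 ∧ q.2 = x} ∈ 𝒮 := by
      have hle : ∀ j : ℤ, (j₀ : ℤ) ≤ j → δ ^ j ≤ ε := fun j hj =>
        (zpow_le_zpow_right_of_le_one₀ h0 h1.le hj).trans (by exact_mod_cast hj₀.le)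
      refine ⟨?_, ?_⟩
      · rintro j z (hz | ⟨hj, hz⟩)
        · exact Or.inl (hup _ _ hz)
        · exact Or.inr ⟨(show (j₀ : ℤ) ≤ j from hj).trans (by simp), hz⟩
      · rintro j y z (hy | ⟨hj, hy⟩) (hz | ⟨hj', hz⟩) hyz
        · exact hsep _ _ _ hy hz hyz
        · rw [show z = x from hz, dist_comm]
          exact (hle j hj').trans (hcon j y hy)
        · rw [show y = x from hy]
          exact (hle j hj).trans (hcon j z hz)
        · exact absurd ((show y = x from hy).trans (show z = x from hz).symm) hyz
    have hmem : ((j₀ : ℤ), x) ∈ S :=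
      hS.le_of_ge hins subset_union_left (Or.inr ⟨le_rfl, rfl⟩)
    have := hcon _ _ hmem
    rw [dist_self] at this
    linarith
  have hpar : ∀ k y, (k + 1, y) ∈ S → ∃ z, (k, z) ∈ S ∧ dist y z ≤ δ ^ k ∧
      ∀ z', (k, z') ∈ S → dist y z' < δ ^ k / 2 → z = z' := by
    intro k y hy
    by_cases hz : ∃ z, (k, z) ∈ S ∧ dist y z < δ ^ k / 2
    · obtain ⟨z, hzS, hz⟩ := hz
      refine ⟨z, hzS, by linarith [hpos k], fun z' hz'S hz' => ?_⟩
      by_contra hne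
      linarith [hsep k z z' hzS hz'S hne, dist_triangle_left z z' y]
    · obtain ⟨z, hzS, hz'⟩ := hnet k y hy
      exact ⟨z, hzS, hz'.le, fun z' h h' => absurd ⟨z', h, h'⟩ hz⟩
  choose! par hpar using hpar
  exact ⟨{
    N := fun k => {x | (k, x) ∈ S}
    par := par
    root := x₀
    root_mem := fun k => hbase rfl
    mono := fun k x => hup k x
    sep := fun k x hx y hy => hsep k x y hx hy
    par_mem := fun k y hy => (hpar k y hy).1
    dist_par := fun k y hy => (hpar k y hy).2.1
    par_eq := fun k y hy z hz => (hpar k y hy).2.2 z hz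
    dense := fun x ε hε => by simpa using hdense x ε hε }⟩

namespace NestedNet

variable {X : Type*} [MetricSpace X] {δ : ℝ}

theorem par_self (T : NestedNet X δ) (h0 : 0 < δ) {k : ℤ} {y : X} (hy : y ∈ T.N k) :
    T.par k y = y :=
  T.par_eq k y (T.mono k hy) y hy (by rw [dist_self]; have := zpow_pos h0 k; positivity)

/-- `T.Desc k y z`: the point `z` descends from the vertex `y` of level `k`. -/
inductive Desc (T : NestedNet X δ) : ℤ → X → X → Prop
  | refl {k : ℤ} {y : X} : y ∈ T.N k → Desc T k y y
  | step {k : ℤ} {y z : X} : y ∈ T.N (k + 1) → Desc T (k + 1) y z → Desc T k (T.par k y) z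

/-- The closed cube of a vertex: the closure of its set of descendants. -/
def closedCube (T : NestedNet X δ) (k : ℤ) (y : X) : Set X := closure {z | T.Desc k y z}

variable (T : NestedNet X δ)

theorem Desc.exists_child (h0 : 0 < δ) {k : ℤ} {y z : X} (h : T.Desc k y z) :
    ∃ y' ∈ T.N (k + 1), T.par k y' = y ∧ T.Desc (k + 1) y' z := by
  cases h with
  | refl hy => exact ⟨y, T.mono k hy, T.par_self h0 hy, .refl (T.mono k hy)⟩
  | step hy' h => exact ⟨_, hy', rfl, h⟩

theorem Desc.dist_le (h0 : 0 < δ) (hδ : δ ≤ 1 / 100) {k : ℤ} {y z : X} (h : T.Desc k y z) :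
    dist y z ≤ 101 / 99 * δ ^ k := by
  induction h with
  | @refl k y hy => rw [dist_self]; have := zpow_pos h0 k; positivity
  | @step k y z hy h ih =>
    have h1 := T.dist_par k y hy
    have h2 : δ ^ (k + 1) = δ ^ k * δ := zpow_add_one₀ h0.ne' k
    have h3 := zpow_pos h0 k
    have h4 := dist_triangle_left (T.par k y) z y
    have h5 := mul_le_mul_of_nonneg_left hδ h3.le
    linarith

theorem exists_desc {j : ℤ} {z : X} (hz : z ∈ T.N j) (k : ℤ) : ∃ y ∈ T.N k, T.Desc k y z := by
  rcases le_total j k with hjk | hjk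
  · have : z ∈ T.N k := by
      induction k, hjk using Int.leInduction with
      | base => exact hz
      | succ k _ ih => exact T.mono k ih
    exact ⟨z, this, .refl this⟩
  · induction k, hjk using Int.leInductionDown with
    | base => exact ⟨z, hz, .refl hz⟩
    | pred k _ ih =>
      obtain ⟨y, hy, h⟩ := ih
      obtain ⟨k, rfl⟩ : ∃ k', k = k' + 1 := ⟨k - 1, by ring⟩
      rw [add_sub_cancel_right]
      exact ⟨_, T.par_mem k y hy, .step hy h⟩

theorem closedCube_subset_par {k : ℤ} {y : X} (hy : y ∈ T.N (k + 1)) :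
    T.closedCube (k + 1) y ⊆ T.closedCube k (T.par k y) :=
  closure_mono fun _ hz => Desc.step hy hz

theorem dist_le_of_mem_closedCube (h0 : 0 < δ) (hδ : δ ≤ 1 / 100) {k : ℤ} {p y : X}
    (h : p ∈ T.closedCube k y) : dist p y ≤ 2 * δ ^ k := by
  have h1 : T.closedCube k y ⊆ closedBall y (2 * δ ^ k) :=
    closure_minimal (fun z hz => by
      rw [mem_closedBall, dist_comm]
      linarith [Desc.dist_le T h0 hδ hz, zpow_pos h0 k]) isClosed_closedBall
  exact h1 h

theorem eq_of_mem_closedCube (h0 : 0 < δ) (hδ : δ ≤ 1 / 100) {k : ℤ} {p x y : X}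
    (h : p ∈ T.closedCube k y) (hx : x ∈ T.N k) (hpx : dist p x ≤ δ ^ k / 3) : y = x := by
  have h3 := zpow_pos h0 k
  obtain ⟨z, hz, hpz⟩ := Metric.mem_closure_iff.1 h (δ ^ k / 100) (by positivity)
  obtain ⟨y', hy', rfl, hd⟩ := Desc.exists_child T h0 hz
  have h2 : δ ^ (k + 1) = δ ^ k * δ := zpow_add_one₀ h0.ne' k
  have h5 := mul_le_mul_of_nonneg_left hδ h3.le
  refine T.par_eq k y' hy' x hx ?_
  have h6 := Desc.dist_le T h0 hδ hd
  have h7 := dist_triangle y' z x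
  have h8 := dist_triangle_left z x p
  linarith

theorem _root_.Set.Finite.closure_subset_biUnion {ι : Type*} {s : Set ι} (hs : s.Finite)
    {A : Set X} {B : ι → Set X} (h : A ⊆ ⋃ i ∈ s, B i) : closure A ⊆ ⋃ i ∈ s, closure (B i) := by
  rw [← hs.closure_biUnion]
  exact closure_mono h

variable {C α : ℝ}

theorem finite_near (H : CoverBound X C α) (hC : 0 ≤ C) (h0 : 0 < δ) (k : ℤ) (x : X) (R : ℝ) :
    {y ∈ T.N k | dist y x ≤ R}.Finite :=
  H.finite_of_separated hC (zpow_pos h0 k) (T.sep k) x R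

theorem countable_N (H : CoverBound X C α) (hC : 0 ≤ C) (h0 : 0 < δ) (k : ℤ) :
    (T.N k).Countable := by
  have : T.N k ⊆ ⋃ n : ℕ, {y ∈ T.N k | dist y T.root ≤ n} := fun y hy => by
    obtain ⟨n, hn⟩ := exists_nat_ge (dist y T.root)
    exact mem_iUnion.2 ⟨n, hy, hn⟩
  exact (countable_iUnion fun n => (T.finite_near H hC h0 k _ _).countable).mono this

theorem exists_mem_closedCube (H : CoverBound X C α) (hC : 0 ≤ C) (h0 : 0 < δ)
    (hδ : δ ≤ 1 / 100) (k : ℤ) (p : X) : ∃ y ∈ T.N k, p ∈ T.closedCube k y := by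
  have hp : p ∈ closure {z | (∃ j, z ∈ T.N j) ∧ dist p z < 1} := by
    refine Metric.mem_closure_iff.2 fun ε hε => ?_
    obtain ⟨j, z, hz, hd⟩ := T.dense p (min ε 1) (by positivity)
    exact ⟨z, ⟨⟨j, hz⟩, hd.trans_le (min_le_right _ _)⟩, hd.trans_le (min_le_left _ _)⟩
  have hfin := T.finite_near H hC h0 k p (1 + 2 * δ ^ k)
  have := hfin.closure_subset_biUnion (B := fun y => {z | T.Desc k y z}) (A :=
    {z | (∃ j, z ∈ T.N j) ∧ dist p z < 1}) (by
      rintro z ⟨⟨j, hz⟩, hd⟩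
      obtain ⟨y, hy, h⟩ := T.exists_desc hz k
      refine mem_iUnion₂.2 ⟨y, ⟨hy, ?_⟩, h⟩
      have h1 := Desc.dist_le T h0 hδ h
      have h2 := dist_triangle_right y p z
      linarith [zpow_pos h0 k])
  obtain ⟨y, hy, h⟩ := mem_iUnion₂.1 (this hp)
  exact ⟨y, hy.1, h⟩

theorem exists_child_mem_closedCube (H : CoverBound X C α) (hC : 0 ≤ C) (h0 : 0 < δ) {k : ℤ}
    {p y : X} (h : p ∈ T.closedCube k y) :
    ∃ y' ∈ T.N (k + 1), T.par k y' = y ∧ p ∈ T.closedCube (k + 1) y' := by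
  have hfin : {y' ∈ T.N (k + 1) | T.par k y' = y}.Finite := by
    refine (T.finite_near H hC h0 (k + 1) y (δ ^ k)).subset ?_
    rintro y' ⟨hy', rfl⟩
    exact ⟨hy', T.dist_par k y' hy'⟩
  have := hfin.closure_subset_biUnion (B := fun y' => {z | T.Desc (k + 1) y' z})
    (A := {z | T.Desc k y z}) (by
      rintro z hz
      obtain ⟨y', hy', hp, hd⟩ := Desc.exists_child T h0 hz
      exact mem_iUnion₂.2 ⟨y', ⟨hy', hp⟩, hd⟩)
  obtain ⟨y', ⟨hy', hp⟩, h'⟩ := mem_iUnion₂.1 (this h)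
  exact ⟨y', hy', hp, h'⟩

end NestedNet

/-- A countable measurable cover admits a selector with measurable fibres. -/
theorem exists_measurable_selector {X ι : Type*} [MeasurableSpace X] {s : Set ι}
    (hs : s.Countable) (A : ι → Set X) (hA : ∀ i ∈ s, MeasurableSet (A i))
    (hcov : ∀ p, ∃ i ∈ s, p ∈ A i) :
    ∃ f : X → ι, (∀ p, f p ∈ s ∧ p ∈ A (f p)) ∧ ∀ i, MeasurableSet {p | f p = i} := by
  classical
  rcases isEmpty_or_nonempty X with hX | ⟨⟨p₀⟩⟩
  · exact ⟨fun p => hX.elim p, fun p => hX.elim p, fun i => by simp [Set.eq_empty_of_isEmpty]⟩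
  have hne : s.Nonempty := (hcov p₀).imp fun _ h => h.1
  obtain ⟨a, rfl⟩ := hs.exists_eq_range hne
  have hex : ∀ p, ∃ n, p ∈ A (a n) := fun p => by simpa using hcov p
  refine ⟨fun p => a (Nat.find (hex p)), fun p => ⟨mem_range_self _, Nat.find_spec (hex p)⟩,
    fun i => ?_⟩
  have : {p | a (Nat.find (hex p)) = i} =
      ⋃ n ∈ {n | a n = i}, A (a n) ∩ ⋂ m ∈ {m | m < n}, (A (a m))ᶜ := by
    ext p
    simp only [mem_ofPred_eq, mem_iUnion, mem_inter_iff, mem_iInter, mem_compl_iff, exists_prop]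
    constructor
    · exact fun h => ⟨_, h, Nat.find_spec (hex p), fun m hm => Nat.find_min (hex p) hm⟩
    · rintro ⟨n, hn, h1, h2⟩
      rwa [(Nat.find_eq_iff (hex p)).2 ⟨h1, h2⟩]
  rw [this]
  exact .biUnion (to_countable _) fun n _ => (hA _ (mem_range_self n)).inter
    (.biInter (to_countable _) fun m _ => (hA _ (mem_range_self m)).compl)

/-- A `δ`-adic system of cubes, encoded by the maps `F k` sending a point to the centre of the
cube of level `k` containing it. -/
structure CubeMap (X : Type*) [MetricSpace X] [MeasurableSpace X] (δ : ℝ) where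
  N : ℤ → Set X
  F : ℤ → X → X
  root : X
  root_mem : ∀ k, root ∈ N k
  mono : ∀ k, N k ⊆ N (k + 1)
  countable : ∀ k, (N k).Countable
  F_mem : ∀ k p, F k p ∈ N k
  F_congr : ∀ k p q, F (k + 1) p = F (k + 1) q → F k p = F k q
  dist_F : ∀ k p, dist p (F k p) ≤ 2 * δ ^ k
  F_eq : ∀ k p, ∀ y ∈ N k, dist p y ≤ δ ^ k / 3 → F k p = y
  meas : ∀ k y, MeasurableSet {p | F k p = y}

theorem CubeMap.nonempty {X : Type*} [MetricSpace X] [MeasurableSpace X] [BorelSpace X]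
    [Nonempty X] {δ C α : ℝ} (H : CoverBound X C α) (hC : 0 ≤ C) (h0 : 0 < δ)
    (hδ : δ ≤ 1 / 100) : Nonempty (CubeMap X δ) := by
  obtain ⟨x₀⟩ := ‹Nonempty X›
  obtain ⟨T⟩ := NestedNet.exists_of_root h0 (hδ.trans_lt (by norm_num)) x₀
  have hcount := T.countable_N H hC h0
  have hclosed : ∀ k y, MeasurableSet (T.closedCube k y) := fun k y => isClosed_closure.measurableSet
  obtain ⟨F, hF, hr⟩ := exists_int_orbit
    (fun k (f : X → X) => (∀ p, f p ∈ T.N k ∧ p ∈ T.closedCube k (f p)) ∧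
      ∀ y, MeasurableSet {p | f p = y})
    (fun k f f' => ∀ p, f p = T.par k (f' p))
    (exists_measurable_selector (hcount 0) _ (fun y _ => hclosed 0 y)
      (T.exists_mem_closedCube H hC h0 hδ 0))
    (by
      rintro k f ⟨hf, hm⟩
      obtain ⟨f', hf', hm'⟩ := exists_measurable_selector (hcount (k + 1))
        (fun y => {p | f p = T.par k y} ∩ T.closedCube (k + 1) y)
        (fun y _ => (hm _).inter (hclosed _ y)) (fun p => by
          obtain ⟨y, hy, hp, h⟩ := T.exists_child_mem_closedCube H hC h0 (hf p).2
          exact ⟨y, hy, hp.symm, h⟩)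
      exact ⟨f', ⟨fun p => ⟨(hf' p).1, (hf' p).2.2⟩, hm'⟩, fun p => (hf' p).2.1⟩)
    (by
      rintro k f' ⟨hf, hm⟩
      refine ⟨fun p => T.par k (f' p), ⟨fun p => ⟨T.par_mem k _ (hf p).1,
        T.closedCube_subset_par (hf p).1 (hf p).2⟩, fun y => ?_⟩, fun p => rfl⟩
      have : {p | T.par k (f' p) = y} = ⋃ z ∈ {z ∈ T.N (k + 1) | T.par k z = y}, {p | f' p = z} := by
        ext p
        simp only [mem_ofPred_eq, mem_iUnion, exists_prop]
        exact ⟨fun h => ⟨_, ⟨(hf p).1, h⟩, rfl⟩, fun ⟨z, h, hz⟩ => hz ▸ h.2⟩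
      rw [this]
      exact .biUnion ((hcount (k + 1)).mono (sep_subset _ _)) fun z _ => hm z)
  exact ⟨{
    N := T.N
    F := F
    root := T.root
    root_mem := T.root_mem
    mono := T.mono
    countable := hcount
    F_mem := fun k p => ((hF k).1 p).1
    F_congr := fun k p q h => by rw [hr k p, hr k q, h]
    dist_F := fun k p => T.dist_le_of_mem_closedCube h0 hδ ((hF k).1 p).2
    F_eq := fun k p y hy h => T.eq_of_mem_closedCube h0 hδ ((hF k).1 p).2 hy h
    meas := fun k => (hF k).2 }⟩

namespace CubeMap

variable {X : Type*} [MetricSpace X] [MeasurableSpace X] {δ : ℝ} (T : CubeMap X δ)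

theorem F_self (h0 : 0 < δ) {k : ℤ} {y : X} (hy : y ∈ T.N k) : T.F k y = y :=
  T.F_eq k y y hy (by rw [dist_self]; have := zpow_pos h0 k; positivity)

theorem F_congr_le {j k : ℤ} (h : j ≤ k) {p q : X} (hpq : T.F k p = T.F k q) :
    T.F j p = T.F j q := by
  induction k, h using Int.leInduction with
  | base => exact hpq
  | succ k _ ih => exact ih (T.F_congr k p q hpq)

theorem F_F (h0 : 0 < δ) {j k : ℤ} (h : j ≤ k) (p : X) : T.F j (T.F k p) = T.F j p :=
  T.F_congr_le h (T.F_self h0 (T.F_mem k p))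

theorem sep (h0 : 0 < δ) {k : ℤ} {y z : X} (hy : y ∈ T.N k) (hz : z ∈ T.N k) (hyz : y ≠ z) :
    δ ^ k / 3 < dist y z := by
  by_contra! h
  exact hyz ((T.F_self h0 hy).symm.trans (T.F_eq k y z hz h))

/-- Seen from a sufficiently coarse level, every point lies in the cube of the root. -/
theorem exists_F_eq_root (h0 : 0 < δ) (h1 : δ < 1) (k : ℤ) (p : X) :
    ∃ n₀ : ℕ, ∀ n ≥ n₀, T.F (k - n) p = T.root := by
  obtain ⟨n₀, hn₀⟩ := pow_unbounded_of_one_lt (3 * dist p T.root / δ ^ k) (one_lt_inv_iff₀.2 ⟨h0, h1⟩)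
  refine ⟨n₀, fun n hn => T.F_eq _ p _ (T.root_mem _) ?_⟩
  have hk := zpow_pos h0 k
  have h2 : δ ^ (k - n) = δ ^ k * δ⁻¹ ^ n := by
    rw [zpow_sub₀ h0.ne', zpow_natCast, inv_pow, div_eq_mul_inv]
  have h3 : δ⁻¹ ^ n₀ ≤ δ⁻¹ ^ n := pow_le_pow_right₀ (one_lt_inv_iff₀.2 ⟨h0, h1⟩).le hn
  rw [h2]
  rw [div_lt_iff₀ hk] at hn₀
  have := mul_le_mul_of_nonneg_left h3 hk.le
  linarith

/-- The cube of level `k` with centre `y`. -/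
def cube (k : ℤ) (y : X) : Set X := {p | T.F k p = y}

/-- The centres of the children of the cube of level `k` with centre `x`. -/
def ch (k : ℤ) (x : X) : Set X := {y ∈ T.N (k + 1) | T.F k y = x}

theorem mem_cube {k : ℤ} {p y : X} : p ∈ T.cube k y ↔ T.F k p = y := Iff.rfl

theorem measurableSet_cube (k : ℤ) (y : X) : MeasurableSet (T.cube k y) := T.meas k y

theorem self_mem_ch (h0 : 0 < δ) {k : ℤ} {x : X} (hx : x ∈ T.N k) : x ∈ T.ch k x :=
  ⟨T.mono k hx, T.F_self h0 hx⟩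

theorem cube_eq_biUnion (h0 : 0 < δ) (k : ℤ) (x : X) :
    T.cube k x = ⋃ y ∈ T.ch k x, T.cube (k + 1) y := by
  ext p
  simp only [mem_iUnion, exists_prop, mem_cube]
  constructor
  · exact fun h => ⟨_, ⟨T.F_mem _ p, (T.F_F h0 (by omega) p).trans h⟩, rfl⟩
  · rintro ⟨y, hy, rfl⟩
    exact (T.F_F h0 (by omega) p).symm.trans hy.2

theorem pairwiseDisjoint_cube (k : ℤ) (s : Set X) : s.PairwiseDisjoint (T.cube k) :=
  fun _ _ _ _ hyz => disjoint_left.2 fun _ (h : _ = _) (h' : _ = _) => hyz (h.symm.trans h')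

variable {C α : ℝ}

theorem finite_near (H : CoverBound X C α) (hC : 0 ≤ C) (h0 : 0 < δ) (k : ℤ) (x : X) (R : ℝ) :
    {y ∈ T.N k | dist y x ≤ R}.Finite :=
  H.finite_of_separated hC (by have := zpow_pos h0 k; positivity : 0 < δ ^ k / 3)
    (fun _ hy _ hz hyz => (T.sep h0 hy hz hyz).le) x R

theorem finite_ch (H : CoverBound X C α) (hC : 0 ≤ C) (h0 : 0 < δ) (k : ℤ) (x : X) :
    (T.ch k x).Finite := by
  refine (T.finite_near H hC h0 (k + 1) x (2 * δ ^ k)).subset ?_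
  rintro y ⟨hy, rfl⟩
  exact ⟨hy, T.dist_F k y⟩

theorem ncard_near_le (H : CoverBound X C α) (hC : 0 ≤ C) (h0 : 0 < δ) (k : ℤ) (x : X) {R : ℝ}
    (hR : δ ^ k ≤ R) :
    ({y ∈ T.N k | dist y x ≤ R}.ncard : ℝ) ≤ C * (6 * R / δ ^ k) ^ α := by
  have hk := zpow_pos h0 k
  have hfin := T.finite_near H hC h0 k x R
  rw [ncard_eq_toFinset_card _ hfin]
  have := H.card_le hC (x := x) (r := δ ^ k / 6) (R := R) (by positivity) (by linarith)
    hfin.toFinset (fun y hy => (hfin.mem_toFinset.1 hy).2) (fun y hy z hz hyz => by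
      have := T.sep h0 (hfin.mem_toFinset.1 hy).1 (hfin.mem_toFinset.1 hz).1 hyz
      linarith)
  rwa [show R / (δ ^ k / 6) = 6 * R / δ ^ k by field_simp] at this

theorem ncard_ch_le (H : CoverBound X C α) (hC : 0 ≤ C) (h0 : 0 < δ) (h1 : δ < 1) (k : ℤ)
    (x : X) : ((T.ch k x).ncard : ℝ) ≤ C * (12 / δ) ^ α := by
  have hk := zpow_pos h0 k
  have h2 : δ ^ (k + 1) = δ ^ k * δ := zpow_add_one₀ h0.ne' k
  have h3 : (T.ch k x).ncard ≤ {y ∈ T.N (k + 1) | dist y x ≤ 2 * δ ^ k}.ncard := by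
    refine ncard_le_ncard ?_ (T.finite_near H hC h0 (k + 1) x (2 * δ ^ k))
    rintro y ⟨hy, rfl⟩
    exact ⟨hy, T.dist_F k y⟩
  have h4 := T.ncard_near_le H hC h0 (k + 1) x (R := 2 * δ ^ k) (by rw [h2]; nlinarith)
  rw [h2, show 6 * (2 * δ ^ k) / (δ ^ k * δ) = 12 / δ by field_simp; norm_num] at h4
  exact (Nat.cast_le.2 h3).trans h4

end CubeMap

namespace CubeMap

variable {X : Type*} [MetricSpace X] [MeasurableSpace X] {δ : ℝ} (T : CubeMap X δ)

open Classical in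
/-- The share of the mass of its parent received by the cube of level `k + 1` with centre `y`. -/
noncomputable def weight (p : ℝ) (k : ℤ) (y : X) : ℝ :=
  if y ∈ T.N k then 1 - (((T.ch k y).ncard : ℝ) - 1) * p else p

/-- `p` is an admissible parameter: every cube has finitely many children, at most `M` of them,
and `p < 1 / M`. -/
structure Admissible (p : ℝ) (M : ℕ) : Prop where
  pos : 0 < p
  mul_lt : M * p < 1
  finite : ∀ k x, (T.ch k x).Finite
  card_le : ∀ k, ∀ x ∈ T.N k, (T.ch k x).ncard ≤ M

/-- `m k y` is a positive mass distribution on the cubes that follows the rule with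
parameter `p`. -/
structure IsMass (p : ℝ) (m : ℤ → X → ℝ) : Prop where
  pos : ∀ k, ∀ y ∈ T.N k, 0 < m k y
  succ : ∀ k, ∀ y ∈ T.N (k + 1), m (k + 1) y = T.weight p k y * m k (T.F k y)

variable {T} {p : ℝ} {M : ℕ}

namespace Admissible

variable (A : T.Admissible p M)
include A

theorem one_le_ncard (h0 : 0 < δ) {k : ℤ} {x : X} (hx : x ∈ T.N k) : 1 ≤ (T.ch k x).ncard :=
  (ncard_pos (A.finite k x)).2 ⟨x, T.self_mem_ch h0 hx⟩

theorem le_weight (k : ℤ) (y : X) : p ≤ T.weight p k y := by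
  unfold weight
  split_ifs with h
  · have h1 : ((T.ch k y).ncard : ℝ) ≤ M := Nat.cast_le.2 (A.card_le k y h)
    have := mul_le_mul_of_nonneg_right h1 A.pos.le
    linarith [A.mul_lt]
  · exact le_rfl

theorem le_one (h0 : 0 < δ) : p ≤ 1 := by
  have h1 := (A.one_le_ncard h0 (T.root_mem 0)).trans (A.card_le 0 _ (T.root_mem 0))
  have h2 : (1 : ℝ) ≤ M := by exact_mod_cast h1
  have := mul_le_mul_of_nonneg_right h2 A.pos.le
  linarith [A.mul_lt]

theorem weight_le_one (h0 : 0 < δ) (k : ℤ) (y : X) : T.weight p k y ≤ 1 := by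
  unfold weight
  split_ifs with h
  · have h1 : (1 : ℝ) ≤ (T.ch k y).ncard := by exact_mod_cast A.one_le_ncard h0 h
    nlinarith [A.pos]
  · exact A.le_one h0

theorem weight_pos (k : ℤ) (y : X) : 0 < T.weight p k y := A.pos.trans_le (A.le_weight k y)

theorem exists_isMass (h0 : 0 < δ) (h1 : δ < 1) : ∃ m, T.IsMass p m := by
  obtain ⟨c, hc, hcs⟩ := exists_int_orbit (fun _ (c : ℝ) => 0 < c)
    (fun k c c' => c' = T.weight p k T.root * c) ⟨1, one_pos⟩
    (fun k c hc => ⟨_, mul_pos (A.weight_pos k T.root) hc, rfl⟩)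
    (fun k c hc => ⟨c / T.weight p k T.root, div_pos hc (A.weight_pos k _),
      (mul_div_cancel₀ _ (A.weight_pos k T.root).ne').symm⟩)
  let u : ℤ → X → ℕ → ℝ := fun k y n =>
    c (k - n) * ∏ i ∈ Finset.range n, T.weight p (k - i - 1) (T.F (k - i) y)
  have hu : ∀ k y, ∃ v n₀, ∀ n ≥ n₀, u k y n = v := by
    intro k y
    obtain ⟨n₀, hn₀⟩ := T.exists_F_eq_root h0 h1 k y
    refine ⟨u k y n₀, n₀, fun n hn => ?_⟩
    induction n, hn using Nat.le_induction with
    | base => rfl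
    | succ n hn ih =>
      have h2 := hcs (k - n - 1)
      rw [sub_add_cancel] at h2
      rw [← ih]
      simp only [u, Finset.prod_range_succ, hn₀ n hn, h2]
      push_cast
      rw [← sub_sub]
      ring
  choose m hm using hu
  refine ⟨m, ⟨fun k y _ => ?_, fun k y hy => ?_⟩⟩
  · obtain ⟨n₀, hn⟩ := hm k y
    rw [← hn n₀ le_rfl]
    exact mul_pos (hc _) (Finset.prod_pos fun i _ => A.weight_pos _ _)
  · obtain ⟨n₁, hn₁⟩ := hm (k + 1) y
    obtain ⟨n₂, hn₂⟩ := hm k (T.F k y)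
    rw [← hn₁ (max n₁ n₂ + 1) (by omega), ← hn₂ (max n₁ n₂) (le_max_right _ _)]
    simp only [u, Finset.prod_range_succ']
    have e1 : k + 1 - ((max n₁ n₂ + 1 : ℕ) : ℤ) = k - (max n₁ n₂ : ℕ) := by push_cast; ring
    have e2 : k + 1 - ((0 : ℕ) : ℤ) = k + 1 := by simp
    have e3 : ∀ i : ℕ, k + 1 - ((i + 1 : ℕ) : ℤ) = k - i := fun i => by push_cast; ring
    have e4 : ∀ i : ℕ, T.F (k - i) (T.F k y) = T.F (k - i) y := fun i => T.F_F h0 (by omega) y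
    simp only [e1, e2, e3, e4, add_sub_cancel_right, T.F_self h0 hy]
    ring

end Admissible

namespace IsMass

variable {m : ℤ → X → ℝ} (hm : T.IsMass p m) (A : T.Admissible p M)
include hm

theorem central (h0 : 0 < δ) {k : ℤ} {x : X} (hx : x ∈ T.N k) :
    m (k + 1) x = (1 - (((T.ch k x).ncard : ℝ) - 1) * p) * m k x := by
  rw [hm.succ k x (T.mono k hx), T.F_self h0 hx, weight, if_pos hx]

theorem boundary (h0 : 0 < δ) {k : ℤ} {x y : X} (hy : y ∈ T.ch k x) (hyx : y ≠ x) :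
    m (k + 1) y = p * m k x := by
  rw [hm.succ k y hy.1, hy.2, weight, if_neg]
  exact fun h => hyx ((T.F_self h0 h).symm.trans hy.2)

include A

theorem sum_ch (h0 : 0 < δ) {k : ℤ} {x : X} (hx : x ∈ T.N k) :
    ∑ y ∈ (A.finite k x).toFinset, m (k + 1) y = m k x := by
  classical
  have hmem : x ∈ (A.finite k x).toFinset := (A.finite k x).mem_toFinset.2 (T.self_mem_ch h0 hx)
  rw [← Finset.add_sum_erase _ _ hmem, Finset.sum_congr rfl (g := fun _ => p * m k x),
    Finset.sum_const, Finset.card_erase_of_mem hmem, ← ncard_eq_toFinset_card _ (A.finite k x),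
    hm.central h0 hx, nsmul_eq_mul, Nat.cast_sub (A.one_le_ncard h0 hx)]
  · push_cast
    ring
  · intro y hy
    rw [Finset.mem_erase, Set.Finite.mem_toFinset] at hy
    exact hm.boundary h0 hy.2 hy.1

theorem le_parent (h0 : 0 < δ) {k : ℤ} {y : X} (hy : y ∈ T.N (k + 1)) :
    m (k + 1) y ≤ m k (T.F k y) := by
  rw [hm.succ k y hy]
  exact mul_le_of_le_one_left (hm.pos k _ (T.F_mem k y)).le (A.weight_le_one h0 k y)

theorem mul_parent_le {k : ℤ} {y : X} (hy : y ∈ T.N (k + 1)) :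
    p * m k (T.F k y) ≤ m (k + 1) y := by
  rw [hm.succ k y hy]
  exact mul_le_mul_of_nonneg_right (A.le_weight k y) (hm.pos k _ (T.F_mem k y)).le

theorem pow_mul_le (h0 : 0 < δ) (k : ℤ) (n : ℕ) (q : X) :
    p ^ n * m k (T.F k q) ≤ m (k + n) (T.F (k + n) q) := by
  induction n with
  | zero => simp
  | succ n ih =>
    have h1 := hm.mul_parent_le A (T.F_mem (k + n + 1) q)
    rw [T.F_F h0 (by omega)] at h1
    push_cast
    rw [← add_assoc, pow_succ', mul_assoc]
    exact (mul_le_mul_of_nonneg_left ih A.pos.le).trans h1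

/-- Nearby cubes of the same level have comparable masses. -/
theorem le_of_dist_le (h0 : 0 < δ) (hδ : δ ≤ 1 / 100) {k : ℤ} {y z : X} (hy : y ∈ T.N k)
    (hz : z ∈ T.N k) (hyz : dist y z ≤ 10 * δ ^ k) : p * m k y ≤ m k z := by
  have key : ∀ n : ℕ, ∀ k : ℤ, ∀ y ∈ T.N k, ∀ z ∈ T.N k, dist y z ≤ 10 * δ ^ k →
      T.F (k - n) y = T.F (k - n) z → p * m k y ≤ m k z := by
    intro n
    induction n with
    | zero =>
      intro k y hy z hz _ h
      simp only [Nat.cast_zero, sub_zero, T.F_self h0 hy, T.F_self h0 hz] at h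
      rw [h]
      exact mul_le_of_le_one_left (hm.pos k z hz).le (A.le_one h0)
    | succ n ih =>
      intro k y hy z hz hyz h
      obtain ⟨k, rfl⟩ : ∃ k', k = k' + 1 := ⟨k - 1, by ring⟩
      rw [show k + 1 - ((n + 1 : ℕ) : ℤ) = k - n by push_cast; ring] at h
      have hk := zpow_pos h0 k
      have h2 : δ ^ (k + 1) = δ ^ k * δ := zpow_add_one₀ h0.ne' k
      have h5 := mul_le_mul_of_nonneg_left hδ hk.le
      by_cases hF : T.F k y = T.F k z
      · have h3 := hm.mul_parent_le A hz
        rw [← hF] at h3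
        exact (mul_le_mul_of_nonneg_left (hm.le_parent A h0 hy) A.pos.le).trans h3
      · have hy' : y ≠ T.F k y := fun e => hF (by
          rw [T.F_eq k z _ (T.F_mem k y)]
          rw [← e, dist_comm]
          linarith)
        have hz' : z ≠ T.F k z := fun e => hF (by
          rw [T.F_eq k y _ (T.F_mem k z)]
          rw [← e]
          linarith)
        rw [hm.boundary h0 ⟨hy, rfl⟩ hy', hm.boundary h0 ⟨hz, rfl⟩ hz']
        refine mul_le_mul_of_nonneg_left (ih k _ (T.F_mem k y) _ (T.F_mem k z) ?_ ?_) A.pos.le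
        · have h6 := dist_triangle4 (T.F k y) y z (T.F k z)
          rw [dist_comm (T.F k y) y] at h6
          linarith [T.dist_F k y, T.dist_F k z]
        · rwa [T.F_F h0 (by omega), T.F_F h0 (by omega)]
  obtain ⟨n₁, hn₁⟩ := T.exists_F_eq_root h0 (hδ.trans_lt (by norm_num)) k y
  obtain ⟨n₂, hn₂⟩ := T.exists_F_eq_root h0 (hδ.trans_lt (by norm_num)) k z
  exact key (max n₁ n₂) k y hy z hz hyz
    ((hn₁ _ (le_max_left _ _)).trans (hn₂ _ (le_max_right _ _)).symm)

end IsMass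

end CubeMap

open Filter Topology TopologicalSpace in
/-- A sequence of measures, bounded on compact sets, has a limit measure in the sense of the
inequalities of the portmanteau theorem. -/
theorem exists_limit_measure {X : Type*} [MetricSpace X] [MeasurableSpace X] [BorelSpace X]
    (ν : ℕ → Measure X) (hν : ∀ K, IsCompact K → ∃ c < ⊤, ∀ n, ν n K ≤ c) :
    ∃ μ : Measure X,
      (∀ U, IsOpen U → ∀ (c : ℝ≥0∞) (n₀ : ℕ), (∀ n ≥ n₀, ν n U ≤ c) → μ U ≤ c) ∧
      ∀ K, IsCompact K → ∀ (c : ℝ≥0∞) (n₀ : ℕ), (∀ n ≥ n₀, c ≤ ν n K) → c ≤ μ K := by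
  have hlim : ∀ K : Set X, ∃ l, Tendsto (fun n => ν n K) (hyperfilter ℕ : Filter ℕ) (𝓝 l) :=
    fun K => ⟨_, ((hyperfilter ℕ).map fun n => ν n K).le_nhds_lim⟩
  choose l hl using hlim
  have hev : ∀ n₀ : ℕ, ∀ᶠ n in (hyperfilter ℕ : Filter ℕ), n₀ ≤ n := fun n₀ =>
    Nat.hyperfilter_le_atTop (eventually_ge_atTop n₀)
  have hfin : ∀ K : Compacts X, l K ≠ ⊤ := fun K => by
    obtain ⟨c, hc, h⟩ := hν K K.isCompact
    exact ((le_of_tendsto' (hl K) h).trans_lt hc).ne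
  let κ : Content X :=
    { toFun := fun K => (l K).toNNReal
      mono' := fun K₁ K₂ h => ENNReal.toNNReal_mono (hfin K₂)
        (le_of_tendsto_of_tendsto' (hl K₁) (hl K₂) fun n => measure_mono h)
      sup_disjoint' := fun K₁ K₂ h _ h₂ => by
        rw [← ENNReal.toNNReal_add (hfin K₁) (hfin K₂)]
        congr 1
        refine tendsto_nhds_unique (hl _) (((hl K₁).add (hl K₂)).congr fun n => ?_)
        rw [Compacts.coe_sup, measure_union h h₂.measurableSet]
      sup_le' := fun K₁ K₂ => by
        rw [← ENNReal.toNNReal_add (hfin K₁) (hfin K₂)]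
        refine ENNReal.toNNReal_mono (ENNReal.add_ne_top.2 ⟨hfin K₁, hfin K₂⟩) ?_
        refine le_of_tendsto_of_tendsto' (hl _) ((hl K₁).add (hl K₂)) fun n => ?_
        rw [Compacts.coe_sup]
        exact measure_union_le _ _ }
  have hκ : ∀ K : Compacts X, κ K = l K := fun K => ENNReal.coe_toNNReal (hfin K)
  refine ⟨κ.measure, fun U hU c n₀ h => ?_, fun K hK c n₀ h => ?_⟩
  · rw [κ.measure_apply hU.measurableSet, κ.outerMeasure_of_isOpen U hU]
    refine iSup₂_le fun K hK => ?_
    rw [hκ]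
    exact le_of_tendsto (hl K) ((hev n₀).mono fun n hn => (measure_mono hK).trans (h n hn))
  · rw [κ.measure_apply hK.measurableSet]
    refine le_trans ?_ (κ.le_outerMeasure_compacts ⟨K, hK⟩)
    rw [hκ]
    exact ge_of_tendsto (hl K) ((hev n₀).mono h)

namespace CubeMap

variable {X : Type*} [MetricSpace X] [MeasurableSpace X] {δ : ℝ} {T : CubeMap X δ}

theorem exists_closedBall_subset_cube (T : CubeMap X δ) (h0 : 0 < δ) (h1 : δ < 1) (R : ℝ) :
    ∃ n : ℕ, closedBall T.root R ⊆ T.cube (-n) T.root := by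
  obtain ⟨n, hn⟩ := pow_unbounded_of_one_lt (3 * R) (one_lt_inv_iff₀.2 ⟨h0, h1⟩)
  refine ⟨n, fun q hq => T.F_eq _ q _ (T.root_mem _) ?_⟩
  rw [zpow_neg, zpow_natCast, ← inv_pow]
  linarith [mem_closedBall.1 hq]

/-- The points of the cube of level `k` with centre `x` that lie in a boundary cube at each of the
next `n` levels. -/
def stall (T : CubeMap X δ) (k : ℤ) (x : X) (n : ℕ) : Set X :=
  {q | T.F k q = x ∧ ∀ i < n, T.F (k + i + 1) q ≠ T.F (k + i) q}

theorem stall_succ_subset (T : CubeMap X δ) (h0 : 0 < δ) (k : ℤ) (x : X) (n : ℕ) :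
    T.stall k x (n + 1) ⊆ ⋃ y ∈ T.ch k x \ {x}, T.stall (k + 1) y n := by
  rintro q ⟨rfl, hq⟩
  refine mem_iUnion₂.2 ⟨T.F (k + 1) q, ⟨⟨T.F_mem _ _, T.F_F h0 (by omega) q⟩, ?_⟩, rfl,
    fun i hi => ?_⟩
  · simpa using hq 0 (by omega)
  · have := hq (i + 1) (by omega)
    push_cast at this
    rwa [show k + ((i : ℤ) + 1) = k + 1 + i by ring] at this

theorem frontier_cube_subset (T : CubeMap X δ) (h0 : 0 < δ) (hδ : δ ≤ 1 / 100) (k : ℤ) (x : X) :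
    frontier (T.cube k x) ⊆ ⋃ x' ∈ T.N k, ⋂ n, T.stall k x' n := by
  intro q hq
  refine mem_iUnion₂.2 ⟨_, T.F_mem k q, mem_iInter.2 fun n => ⟨rfl, fun i _ hi => ?_⟩⟩
  have hj := zpow_pos h0 (k + i)
  have h1 : dist q (T.F (k + i) q) ≤ 2 * δ ^ (k + i + 1) := by
    rw [← hi]
    exact T.dist_F _ q
  rw [zpow_add_one₀ h0.ne'] at h1
  have h2 := mul_le_mul_of_nonneg_left hδ hj.le
  have hball : ball q (δ ^ (k + i) / 4) ⊆ {q' | T.F k q' = T.F k q} := fun q' hq' => by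
    refine T.F_congr_le (show k ≤ k + i by omega) (T.F_eq _ _ _ (T.F_mem _ q) ?_)
    linarith [dist_triangle q' q (T.F (k + i) q), mem_ball.1 hq']
  have hr : 0 < δ ^ (k + i) / 4 := by positivity
  by_cases hx : T.F k q = x
  · refine hq.2 (mem_interior_iff_mem_nhds.2 (Filter.mem_of_superset (ball_mem_nhds q hr) ?_))
    exact fun q' hq' => (hball hq').trans hx
  · obtain ⟨q', hq', hd⟩ := Metric.mem_closure_iff.1 hq.1 _ hr
    exact hx ((hball (mem_ball'.2 hd)).symm.trans hq')

variable {p : ℝ} {M : ℕ} {m : ℤ → X → ℝ}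

namespace IsMass

variable (hm : T.IsMass p m) (A : T.Admissible p M)
include hm A

theorem measure_cube_of_le (h0 : 0 < δ) {ν : Measure X} {n : ℤ}
    (hν : ∀ x ∈ T.N n, ν (T.cube n x) = ENNReal.ofReal (m n x)) {k : ℤ} (hk : k ≤ n) :
    ∀ x ∈ T.N k, ν (T.cube k x) = ENNReal.ofReal (m k x) := by
  induction k, hk using Int.leInductionDown with
  | base => exact hν
  | pred k _ ih =>
    obtain ⟨k, rfl⟩ : ∃ k', k = k' + 1 := ⟨k - 1, by ring⟩
    rw [add_sub_cancel_right]
    intro x hx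
    have h1 : T.cube k x = ⋃ y ∈ (A.finite k x).toFinset, T.cube (k + 1) y := by
      simpa using T.cube_eq_biUnion h0 k x
    rw [h1, measure_biUnion_finset (T.pairwiseDisjoint_cube _ _)
      (fun y _ => T.measurableSet_cube _ y), ← hm.sum_ch A h0 hx,
      ENNReal.ofReal_sum_of_nonneg]
    · exact Finset.sum_congr rfl fun y hy => ih y ((A.finite k x).mem_toFinset.1 hy).1
    · exact fun y hy => (hm.pos _ y ((A.finite k x).mem_toFinset.1 hy).1).le

variable {C α : ℝ}

theorem measure_closedBall_le (H : CoverBound X C α) (hC : 0 ≤ C) (h0 : 0 < δ)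
    (hδ : δ ≤ 1 / 100) {ν : Measure X} {k : ℤ}
    (hν : ∀ x ∈ T.N k, ν (T.cube k x) = ENNReal.ofReal (m k x)) {z : X} (hz : z ∈ T.N k) :
    ν (closedBall z (3 * δ ^ k)) ≤ ENNReal.ofReal (C * 30 ^ α / p * m k z) := by
  have hk := zpow_pos h0 k
  have hfin := T.finite_near H hC h0 k z (5 * δ ^ k)
  have hcard := T.ncard_near_le H hC h0 k z (R := 5 * δ ^ k) (by linarith)
  rw [ncard_eq_toFinset_card _ hfin, show 6 * (5 * δ ^ k) / δ ^ k = 30 by field_simp; norm_num]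
    at hcard
  calc ν (closedBall z (3 * δ ^ k))
      ≤ ν (⋃ y ∈ hfin.toFinset, T.cube k y) := measure_mono fun q hq => by
        refine mem_iUnion₂.2 ⟨_, hfin.mem_toFinset.2 ⟨T.F_mem k q, ?_⟩, rfl⟩
        linarith [dist_triangle_left (T.F k q) z q, T.dist_F k q, mem_closedBall.1 hq]
    _ ≤ ∑ y ∈ hfin.toFinset, ν (T.cube k y) := measure_biUnion_finset_le _ _
    _ ≤ ∑ y ∈ hfin.toFinset, ENNReal.ofReal (m k z / p) := Finset.sum_le_sum fun y hy => by
        obtain ⟨hy, hyz⟩ := hfin.mem_toFinset.1 hy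
        rw [hν y hy]
        refine ENNReal.ofReal_le_ofReal ((le_div_iff₀' A.pos).2 ?_)
        exact hm.le_of_dist_le A h0 hδ hy hz (by linarith)
    _ = ENNReal.ofReal (hfin.toFinset.card * (m k z / p)) := by
        rw [Finset.sum_const, nsmul_eq_mul, ENNReal.ofReal_mul (Nat.cast_nonneg _),
          ENNReal.ofReal_natCast]
    _ ≤ _ := by
        refine ENNReal.ofReal_le_ofReal ?_
        rw [div_mul_eq_mul_div, mul_div_assoc]
        exact mul_le_mul_of_nonneg_right hcard (div_nonneg (hm.pos k z hz).le A.pos.le)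

theorem measure_stall_le (h0 : 0 < δ) {μ : Measure X} {K : ℝ}
    (hμ : ∀ k, ∀ x ∈ T.N k, μ (T.cube k x) ≤ ENNReal.ofReal (K * m k x)) (hK : 0 ≤ K)
    (n : ℕ) : ∀ k, ∀ x ∈ T.N k,
      μ (T.stall k x n) ≤ ENNReal.ofReal (K * ((M - 1) * p) ^ n * m k x) := by
  have hM : 0 ≤ ((M : ℝ) - 1) * p := by
    have h1 := (A.one_le_ncard h0 (T.root_mem 0)).trans (A.card_le 0 _ (T.root_mem 0))
    have h2 : (1 : ℝ) ≤ M := by exact_mod_cast h1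
    exact mul_nonneg (by linarith) A.pos.le
  induction n with
  | zero =>
    intro k x hx
    simpa using (measure_mono fun q hq => hq.1).trans (hμ k x hx)
  | succ n ih =>
    intro k x hx
    have hfin : (T.ch k x \ {x}).Finite := (A.finite k x).sdiff
    have hpos := hm.pos k x hx
    calc μ (T.stall k x (n + 1))
        ≤ μ (⋃ y ∈ hfin.toFinset, T.stall (k + 1) y n) :=
          measure_mono (by simpa using T.stall_succ_subset h0 k x n)
      _ ≤ ∑ y ∈ hfin.toFinset, μ (T.stall (k + 1) y n) := measure_biUnion_finset_le _ _
      _ ≤ ∑ y ∈ hfin.toFinset, ENNReal.ofReal (K * ((M - 1) * p) ^ n * (p * m k x)) :=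
          Finset.sum_le_sum fun y hy => by
            obtain ⟨hy, hyx⟩ := hfin.mem_toFinset.1 hy
            rw [← hm.boundary h0 hy hyx]
            exact ih (k + 1) y hy.1
      _ = ENNReal.ofReal (hfin.toFinset.card * (K * ((M - 1) * p) ^ n * (p * m k x))) := by
          rw [Finset.sum_const, nsmul_eq_mul, ENNReal.ofReal_mul (Nat.cast_nonneg _),
            ENNReal.ofReal_natCast]
      _ ≤ _ := by
          refine ENNReal.ofReal_le_ofReal ?_
          have h1 : (hfin.toFinset.card : ℝ) ≤ M - 1 := by
            rw [← ncard_eq_toFinset_card _ hfin, ncard_sdiff_singleton_of_mem (T.self_mem_ch h0 hx),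
              Nat.cast_sub (A.one_le_ncard h0 hx), Nat.cast_one]
            exact sub_le_sub_right (Nat.cast_le.2 (A.card_le k x hx)) 1
          have h2 : 0 ≤ K * ((M - 1) * p) ^ n * (p * m k x) := by
            have := A.pos
            positivity
          refine (mul_le_mul_of_nonneg_right h1 h2).trans_eq ?_
          ring

theorem measure_frontier_cube (h0 : 0 < δ) (hδ : δ ≤ 1 / 100) {μ : Measure X} {K : ℝ}
    (hμ : ∀ k, ∀ x ∈ T.N k, μ (T.cube k x) ≤ ENNReal.ofReal (K * m k x)) (hK : 0 ≤ K)
    (k : ℤ) (x : X) : μ (frontier (T.cube k x)) = 0 := by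
  refine measure_mono_null (T.frontier_cube_subset h0 hδ k x) ?_
  refine (measure_biUnion_null_iff (T.countable k)).2 fun x' hx' => ?_
  have h1 := (A.one_le_ncard h0 hx').trans (A.card_le k x' hx')
  have h2 : (1 : ℝ) ≤ M := by exact_mod_cast h1
  have hθ := A.pos
  have hlim : Filter.Tendsto (fun n : ℕ => ENNReal.ofReal (K * ((M - 1) * p) ^ n * m k x'))
      Filter.atTop (nhds 0) := by
    have h3 := tendsto_pow_atTop_nhds_zero_of_lt_one (r := ((M : ℝ) - 1) * p)
      (mul_nonneg (by linarith) hθ.le) (by linarith [A.mul_lt])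
    simpa using ENNReal.tendsto_ofReal ((h3.const_mul K).mul_const (m k x'))
  refine le_antisymm (ge_of_tendsto' hlim fun n => ?_) zero_le
  exact (measure_mono (iInter_subset _ n)).trans (hm.measure_stall_le A h0 hμ hK n k x' hx')

theorem exists_measure [BorelSpace X] [CompleteSpace X] (H : CoverBound X C α) (hC : 0 ≤ C)
    (h0 : 0 < δ) (hδ : δ ≤ 1 / 100) :
    ∃ μ : Measure X, ∀ k, ∀ x ∈ T.N k, μ (T.cube k x) = ENNReal.ofReal (m k x) := by
  let ν : ℕ → Measure X := fun n =>
    Measure.sum fun y : T.N n => ENNReal.ofReal (m n y) • Measure.dirac (y : X)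
  have hν₀ : ∀ n : ℕ, ∀ x ∈ T.N n, ν n (T.cube n x) = ENNReal.ofReal (m n x) := by
    intro n x hx
    have hmeas := T.measurableSet_cube n x
    rw [Measure.sum_apply _ hmeas, tsum_eq_single ⟨x, hx⟩]
    · simp [Measure.dirac_apply' _ hmeas, mem_cube, T.F_self h0 hx]
    · rintro ⟨y, hy⟩ hyx
      have : y ≠ x := fun h => hyx (Subtype.ext h)
      simp [Measure.dirac_apply' _ hmeas, mem_cube, T.F_self h0 hy, this]
  have hν : ∀ (n : ℕ) (k : ℤ), k ≤ n → ∀ x ∈ T.N k, ν n (T.cube k x) = ENNReal.ofReal (m k x) :=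
    fun n k hk => hm.measure_cube_of_le A h0 (hν₀ n) hk
  obtain ⟨μ, hopen, hcomp⟩ := exists_limit_measure ν (fun K hK => by
    obtain ⟨R, hR⟩ := hK.isBounded.subset_closedBall T.root
    obtain ⟨j, hj⟩ := T.exists_closedBall_subset_cube h0 (hδ.trans_lt (by norm_num)) R
    refine ⟨ENNReal.ofReal (m (-j) T.root), ENNReal.ofReal_lt_top, fun n => ?_⟩
    rw [← hν n (-j) (by omega) _ (T.root_mem _)]
    exact measure_mono (hR.trans hj))
  have hcrude : ∀ k, ∀ x ∈ T.N k,
      μ (T.cube k x) ≤ ENNReal.ofReal (C * 30 ^ α / p * m k x) := by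
    intro k x hx
    have hk := zpow_pos h0 k
    refine (measure_mono (t := ball x (3 * δ ^ k)) fun q hq => ?_).trans
      (hopen _ isOpen_ball _ k.toNat fun n hn => (measure_mono ball_subset_closedBall).trans
        (hm.measure_closedBall_le A H hC h0 hδ (hν n k (by omega)) hx))
    have := T.dist_F k q
    rw [T.mem_cube.1 hq] at this
    exact mem_ball.2 (by linarith)
  have hnull := hm.measure_frontier_cube A h0 hδ hcrude
    (div_nonneg (mul_nonneg hC (by positivity)) A.pos.le)
  refine ⟨μ, fun k x hx => le_antisymm ?_ ?_⟩
  · calc μ (T.cube k x) ≤ μ (interior (T.cube k x) ∪ frontier (T.cube k x)) :=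
          measure_mono (subset_closure.trans (closure_eq_interior_union_frontier _).subset)
      _ ≤ μ (interior (T.cube k x)) + μ (frontier (T.cube k x)) := measure_union_le _ _
      _ = μ (interior (T.cube k x)) := by rw [hnull, add_zero]
      _ ≤ _ := hopen _ isOpen_interior _ k.toNat fun n hn =>
          (measure_mono interior_subset).trans_eq (hν n k (by omega) x hx)
  · have hcl : IsCompact (closure (T.cube k x)) :=
      (H.isCompact_closedBall x (2 * δ ^ k)).of_isClosed_subset isClosed_closure
        (closure_minimal (fun q hq => by
          have := T.dist_F k q
          rwa [T.mem_cube.1 hq] at this) isClosed_closedBall)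
    calc ENNReal.ofReal (m k x) ≤ μ (closure (T.cube k x)) :=
          hcomp _ hcl _ k.toNat fun n hn =>
            (hν n k (by omega) x hx).symm.trans_le (measure_mono subset_closure)
      _ ≤ μ (T.cube k x) + μ (frontier (T.cube k x)) := by
          rw [closure_eq_self_union_frontier]
          exact measure_union_le _ _
      _ = _ := by rw [hnull, add_zero]

end IsMass

end CubeMap

theorem exists_zpow_scales {δ r R : ℝ} (h0 : 0 < δ) (h1 : δ < 1) (hr : 0 < r) (hrR : r < R) :
    ∃ (k : ℤ) (n : ℕ), R ≤ δ ^ k ∧ 4 * δ ^ (k + n) ≤ r ∧ (δ ^ n)⁻¹ ≤ 4 / δ ^ 2 * (R / r) := by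
  have hL : 1 < δ⁻¹ := one_lt_inv_iff₀.2 ⟨h0, h1⟩
  obtain ⟨a, ha, ha'⟩ := exists_mem_Ioc_zpow (hr.trans hrR) hL
  obtain ⟨b, hb, hb'⟩ := exists_mem_Ico_zpow (show 0 < r / 4 by positivity) hL
  rw [inv_zpow', neg_add] at ha' hb'
  rw [inv_zpow'] at ha hb
  have hab : -a + -1 < -b := by
    refine (zpow_lt_zpow_iff_right_of_lt_one₀ h0 h1).1 ?_
    have := zpow_pos h0 (-b)
    linarith
  obtain ⟨n, hn⟩ := Int.eq_ofNat_of_zero_le (show 0 ≤ -b - (-a + -1) by omega)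
  refine ⟨-a + -1, n, ha', ?_, ?_⟩
  · rw [← hn, show -a + -1 + (-b - (-a + -1)) = -b by ring]
    linarith
  · have h2 : (δ ^ n)⁻¹ = δ ^ (-a) / δ ^ (-b + -1) / δ ^ 2 := by
      rw [← zpow_natCast, ← zpow_natCast, ← zpow_neg, ← zpow_sub₀ h0.ne', ← zpow_sub₀ h0.ne']
      congr 1
      push_cast
      omega
    have h3 : δ ^ (-a) / δ ^ (-b + -1) ≤ R / (r / 4) :=
      div_le_div₀ (hr.trans hrR).le ha.le (by positivity) hb'.le
    rw [h2, show 4 / δ ^ 2 * (R / r) = R / (r / 4) / δ ^ 2 by field_simp]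
    gcongr

namespace CubeMap

variable {X : Type*} [MetricSpace X] [MeasurableSpace X] {δ : ℝ} (T : CubeMap X δ)

theorem cube_inj (h0 : 0 < δ) {k : ℤ} {y z : X} (hy : y ∈ T.N k) (h : T.cube k y = T.cube k z) :
    y = z := by
  have : y ∈ T.cube k z := h ▸ T.mem_cube.2 (T.F_self h0 hy)
  exact (T.F_self h0 hy).symm.trans (T.mem_cube.1 this)

/-- The centre of a cube of level `k`. -/
noncomputable def centre [Nonempty X] (k : ℤ) (Q : Set X) : X :=
  T.F k (Classical.epsilon (· ∈ Q))

theorem centre_cube [Nonempty X] (h0 : 0 < δ) {k : ℤ} {y : X} (hy : y ∈ T.N k) :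
    T.centre k (T.cube k y) = y :=
  Classical.epsilon_spec (p := (· ∈ T.cube k y)) ⟨y, T.F_self h0 hy⟩

theorem image_centre [Nonempty X] (h0 : 0 < δ) (k : ℤ) :
    T.centre k '' (T.cube k '' T.N k) = T.N k := by
  rw [image_image]
  exact (image_congr fun y hy => T.centre_cube h0 hy).trans (image_id' _)

/-- The `δ`-adic cube system formed by the fibres of the maps `T.F k`. -/
noncomputable def toCubeSystem [Nonempty X] (h0 : 0 < δ) : CubeSystem X δ where
  cubes k := T.cube k '' T.N k
  center := T.centre
  countable k := (T.countable k).image _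
  borel := by
    rintro k _ ⟨y, -, rfl⟩
    exact T.measurableSet_cube k y
  covers k := eq_univ_of_forall fun p => ⟨_, ⟨_, T.F_mem k p, rfl⟩, rfl⟩
  nested := by
    rintro k k' hk _ ⟨y, -, rfl⟩ _ ⟨z, -, rfl⟩ ⟨q, hq, hq'⟩ p hp
    exact (T.F_congr_le hk ((T.mem_cube.1 hp).trans (T.mem_cube.1 hq').symm)).trans hq
  ball_subset := by
    rintro k _ ⟨y, hy, rfl⟩ p hp
    rw [T.centre_cube h0 hy] at hp
    exact T.F_eq k p y hy hp
  subset_ball := by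
    rintro k _ ⟨y, hy, rfl⟩ p hp
    rw [T.centre_cube h0 hy, mem_closedBall, ← T.mem_cube.1 hp]
    exact T.dist_F k p
  origin := ⟨T.root, fun k => by rw [T.image_centre h0]; exact T.root_mem k⟩
  centers_nested k := by
    rw [T.image_centre h0, T.image_centre h0]
    exact T.mono k

section CubeSystem

variable (h0 : 0 < δ)

include h0 in
theorem cube_subset_cube_iff {k : ℤ} {x y : X} (hy : y ∈ T.N (k + 1)) :
    T.cube (k + 1) y ⊆ T.cube k x ↔ T.F k y = x := by
  refine ⟨fun h => h (T.F_self h0 hy), ?_⟩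
  rintro rfl p rfl
  exact (T.F_F h0 (by omega) p).symm

include h0 in
theorem injOn_cube_ch (k : ℤ) (x : X) : InjOn (T.cube (k + 1)) (T.ch k x) :=
  fun _ hy _ _ h => T.cube_inj h0 hy.1 h

variable [Nonempty X]

theorem children_toCubeSystem (k : ℤ) (x : X) :
    (T.toCubeSystem h0).children k (T.cube k x) = T.cube (k + 1) '' T.ch k x := by
  ext Q
  constructor
  · rintro ⟨⟨y, hy, rfl⟩, hQ⟩
    exact ⟨y, ⟨hy, (T.cube_subset_cube_iff h0 hy).1 hQ⟩, rfl⟩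
  · rintro ⟨y, hy, rfl⟩
    exact ⟨⟨y, hy.1, rfl⟩, (T.cube_subset_cube_iff h0 hy.1).2 hy.2⟩

theorem ncard_children_toCubeSystem (k : ℤ) (x : X) :
    ((T.toCubeSystem h0).children k (T.cube k x)).ncard = (T.ch k x).ncard := by
  rw [T.children_toCubeSystem h0, (T.injOn_cube_ch h0 k x).ncard_image]

theorem exists_maxChildCount_eq {α C : ℝ} (H : CoverBound X C α) (hC : 0 ≤ C) (h1 : δ < 1) :
    ∃ M : ℕ, (T.toCubeSystem h0).maxChildCount = M ∧ (M : ℝ) ≤ C * (12 / δ) ^ α ∧ 1 ≤ M ∧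
      ∀ k, ∀ x ∈ T.N k, (T.ch k x).ncard ≤ M := by
  have hcount : ∀ k x, (T.toCubeSystem h0).childCount k (T.cube k x) = (T.ch k x).ncard := by
    intro k x
    rw [CubeSystem.childCount, T.children_toCubeSystem h0, (T.injOn_cube_ch h0 k x).encard_image,
      (T.finite_ch H hC h0 k x).cast_ncard_eq]
  have hle : (T.toCubeSystem h0).maxChildCount ≤ (⌊C * (12 / δ) ^ α⌋₊ : ℕ) := by
    refine iSup_le fun k => iSup₂_le ?_
    rintro _ ⟨x, -, rfl⟩
    rw [hcount, Nat.cast_le]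
    exact Nat.le_floor (T.ncard_ch_le H hC h0 h1 k x)
  obtain ⟨M, hM⟩ := ENat.ne_top_iff_exists.1 (ne_top_of_le_ne_top (ENat.natCast_ne_top _) hle)
  have hch : ∀ k, ∀ x ∈ T.N k, (T.ch k x).ncard ≤ M := by
    intro k x hx
    rw [← Nat.cast_le (α := ℕ∞), hM, ← hcount]
    exact le_iSup_of_le k (le_iSup₂_of_le (T.cube k x) ⟨x, hx, rfl⟩ le_rfl)
  refine ⟨M, hM.symm, ?_, ?_, hch⟩
  · rw [← hM, Nat.cast_le] at hle
    exact (Nat.cast_le.2 hle).trans (Nat.floor_le (by positivity))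
  · refine le_trans ?_ (hch 0 _ (T.root_mem 0))
    exact (ncard_pos (T.finite_ch H hC h0 _ _)).2 ⟨_, T.self_mem_ch h0 (T.root_mem 0)⟩

end CubeSystem

namespace IsMass

variable {T} {p : ℝ} {M : ℕ} {m : ℤ → X → ℝ} (hm : T.IsMass p m) (A : T.Admissible p M)
  {μ : Measure X} (hμ : ∀ k, ∀ x ∈ T.N k, μ (T.cube k x) = ENNReal.ofReal (m k x))
include hm hμ

theorem hasFullSupport (h1 : δ < 1) : HasFullSupport μ := by
  rintro U hU ⟨q, hq⟩
  obtain ⟨ε, hε, hball⟩ := Metric.isOpen_iff.1 hU q hq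
  obtain ⟨n, hn⟩ := exists_pow_lt_of_lt_one (show 0 < ε / 4 by positivity) h1
  refine (ENNReal.ofReal_pos.2 (hm.pos n _ (T.F_mem n q))).trans_le ?_
  rw [← hμ _ _ (T.F_mem n q)]
  refine measure_mono (Subset.trans (fun z hz => ?_) hball)
  have h2 := T.dist_F n z
  have h3 := T.dist_F n q
  rw [T.mem_cube.1 hz] at h2
  rw [zpow_natCast] at h2 h3
  rw [mem_ball]
  linarith [dist_triangle_right z q (T.F n q)]

variable (h0 : 0 < δ)
include A h0

theorem adapted [Nonempty X] (h1 : δ < 1) : (T.toCubeSystem h0).Adapted p μ := by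
  refine ⟨hm.hasFullSupport hμ h1, ?_⟩
  rintro k _ ⟨x, hx, rfl⟩ Q' hQ'
  have hncard := T.ncard_children_toCubeSystem h0 k x
  rw [T.children_toCubeSystem h0] at hQ'
  obtain ⟨y, hy, rfl⟩ := hQ'
  have hcy := T.centre_cube h0 hy.1
  have hcx := T.centre_cube h0 hx
  rw [hμ _ _ hy.1, hμ _ _ hx]
  refine ⟨fun ⟨_, h⟩ => ?_, fun ⟨_, h⟩ => ?_⟩
  · change T.centre (k + 1) _ ≠ T.centre k _ at h
    rw [hcx, hcy] at h
    rw [hm.boundary h0 hy h, ENNReal.ofReal_mul A.pos.le]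
  · change T.centre (k + 1) _ = T.centre k _ at h
    rw [hcx, hcy] at h
    rw [h, hm.central h0 hx, hncard, ENNReal.ofReal_mul' (hm.pos k x hx).le]

theorem measure_div_le {C α β : ℝ} (H : CoverBound X C α) (hC : 0 ≤ C) (hδ : δ ≤ 1 / 100)
    (hβ : 0 ≤ β) (hp : p = δ ^ β) (x : X) {r R : ℝ} (hr : 0 < r) (hrR : r < R) :
    μ (closedBall x R) / μ (closedBall x r) ≤
      ENNReal.ofReal (C * 30 ^ α / p * (4 / δ ^ 2) ^ β * (R / r) ^ β) := by
  obtain ⟨k, n, hR, hr', hn⟩ := exists_zpow_scales h0 (hδ.trans_lt (by norm_num)) hr hrR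
  have hp0 := A.pos
  have hpos := hm.pos k _ (T.F_mem k x)
  have hRr : 0 < R / r := div_pos (hr.trans hrR) hr
  have hupper : μ (closedBall x R) ≤ ENNReal.ofReal (C * 30 ^ α / p * m k (T.F k x)) := by
    refine (measure_mono (fun z hz => ?_)).trans
      (hm.measure_closedBall_le A H hC h0 hδ (hμ k) (T.F_mem k x))
    rw [mem_closedBall] at hz ⊢
    linarith [dist_triangle z x (T.F k x), T.dist_F k x]
  have hlower : ENNReal.ofReal (p ^ n * m k (T.F k x)) ≤ μ (closedBall x r) := by
    refine (ENNReal.ofReal_le_ofReal (hm.pow_mul_le A h0 k n x)).trans ?_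
    rw [← hμ _ _ (T.F_mem (k + n) x)]
    refine measure_mono fun z hz => ?_
    have h2 := T.dist_F (k + n) z
    rw [T.mem_cube.1 hz] at h2
    rw [mem_closedBall]
    linarith [dist_triangle_right z x (T.F (k + n) x), T.dist_F (k + n) x]
  have hpn : 1 ≤ (4 / δ ^ 2) ^ β * (R / r) ^ β * p ^ n := by
    rw [← Real.mul_rpow (by positivity) hRr.le, hp, Real.rpow_pow_comm h0.le,
      ← Real.mul_rpow (by positivity) (by positivity)]
    refine Real.one_le_rpow ?_ hβ
    rwa [← div_le_iff₀ (by positivity), one_div]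
  refine ENNReal.div_le_of_le_mul (hupper.trans (le_trans ?_ (mul_le_mul_right hlower _)))
  rw [← ENNReal.ofReal_mul (by positivity)]
  refine ENNReal.ofReal_le_ofReal ?_
  calc C * 30 ^ α / p * m k (T.F k x) = C * 30 ^ α / p * m k (T.F k x) * 1 := (mul_one _).symm
    _ ≤ C * 30 ^ α / p * m k (T.F k x) * ((4 / δ ^ 2) ^ β * (R / r) ^ β * p ^ n) := by gcongr
    _ = _ := by ring

end IsMass

end CubeMap

theorem exists_small_scale {α β : ℝ} (hαβ : α < β) (K : ℝ) :
    ∃ δ : ℝ, 0 < δ ∧ δ ≤ 1 / 100 ∧ K * (δ ^ β / δ ^ α) < 1 := by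
  have h1 : Filter.Tendsto (fun δ : ℝ => K * δ ^ (β - α)) (nhdsWithin 0 (Ioi 0)) (nhds 0) := by
    have := ((Real.continuousAt_rpow_const 0 (β - α) (Or.inr (sub_pos.2 hαβ).le)).tendsto.const_mul
      K).mono_left (nhdsWithin_le_nhds (s := Ioi 0))
    rwa [Real.zero_rpow (sub_pos.2 hαβ).ne', mul_zero] at this
  obtain ⟨δ, h, hδ⟩ := ((h1.eventually_lt_const one_pos).and
    (Ioc_mem_nhdsGT (show (0 : ℝ) < 1 / 100 by norm_num))).exists
  exact ⟨δ, hδ.1, hδ.2, by rwa [← Real.rpow_sub hδ.1]⟩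

/-- **Lemma (adapted measures of small Assouad dimension).** If `X` is a nonempty complete
metric space with `dim_A X < ∞`, then for every `t > dim_A X` there are `0 < δ < 1/7`, a
`δ`-adic cube system on `X`, a parameter `0 < p < 1/M`, and a measure `μ_p` adapted to `p`
such that `dim_A μ_p < t`. -/
theorem exists_adapted_measure_dim_lt (X : Type*) [MetricSpace X] [CompleteSpace X]
    [MeasurableSpace X] [BorelSpace X] [Nonempty X]
    (hX : assouadDim X < ⊤) (t : ℝ) (ht : assouadDim X < ENNReal.ofReal t) :
    ∃ δ : ℝ, 0 < δ ∧ δ < 1 / 7 ∧ ∃ S : CubeSystem X δ, ∃ M : ℕ,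
      S.maxChildCount = M ∧ ∃ p : ℝ, 0 < p ∧ p < 1 / M ∧
        ∃ μ : MeasureTheory.Measure X, S.Adapted p μ ∧
          measureAssouadDim μ < ENNReal.ofReal t := by
  obtain ⟨_, ⟨α, hα, rfl, C, hC, H⟩, hαt⟩ := sInf_lt_iff.1 ht
  replace H : CoverBound X C α := H
  have hαt : α < t := (ENNReal.ofReal_lt_ofReal_iff_of_nonneg hα).1 hαt
  obtain ⟨β, hαβ, hβt⟩ := exists_between hαt
  have hβ : 0 < β := hα.trans_lt hαβ
  obtain ⟨δ, h0, hδ, hsmall⟩ := exists_small_scale hαβ (C * 12 ^ α)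
  have h1 : δ < 1 := hδ.trans_lt (by norm_num)
  obtain ⟨T⟩ := CubeMap.nonempty H hC.le h0 hδ
  obtain ⟨M, hM, hMC, hM1, hch⟩ := T.exists_maxChildCount_eq h0 H hC.le h1
  have hp : 0 < δ ^ β := Real.rpow_pos_of_pos h0 β
  have hMp : M * δ ^ β < 1 := by
    refine (mul_le_mul_of_nonneg_right hMC hp.le).trans_lt ?_
    rw [Real.div_rpow (by norm_num) h0.le]
    refine lt_of_eq_of_lt ?_ hsmall
    ring
  have A : T.Admissible (δ ^ β) M := ⟨hp, hMp, T.finite_ch H hC.le h0, hch⟩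
  obtain ⟨m, hm⟩ := A.exists_isMass h0 h1
  obtain ⟨μ, hμ⟩ := hm.exists_measure A H hC.le h0 hδ
  have hM0 : (0 : ℝ) < M := by exact_mod_cast hM1
  refine ⟨δ, h0, hδ.trans_lt (by norm_num), T.toCubeSystem h0, M, hM, δ ^ β, hp,
    (lt_div_iff₀ hM0).2 (by rwa [mul_comm]), μ, hm.adapted A hμ h0 h1, ?_⟩
  refine lt_of_le_of_lt (sInf_le ⟨β, hβ.le, rfl, C * 30 ^ α / δ ^ β * (4 / δ ^ 2) ^ β,
    by positivity, fun x r R hr hrR => hm.measure_div_le A hμ h0 H hC.le hδ hβ.le rfl x hr hrR⟩) ?_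
  exact (ENNReal.ofReal_lt_ofReal_iff_of_nonneg hβ.le).2 hβt
end
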